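/- arXiv:2511.11544 — 2 statements merged into one kernel-verified Lean document; each statement's English description precedes it below -/
import Mathlib

section
/- The projective special linear group PSL(3, 3) satisfies |Solv(PSL(3, 3))| = 1562. -/
/-- The solvabilizer of an element `x` of a group `G`:
the set of `y ∈ G` such that `⟨x, y⟩` is solvable. -/
def solvabilizer {G : Type*} [Group G] (x : G) : Set G :=
  {y | IsSolvable ↥(Subgroup.closure {x, y})}

/-- `Solv(G)`, the set of distinct solvabilizers of elements of `G`. -/
def solvSet (G : Type*) [Group G] : Set (Set G) :=
  Set.range fun x : G => solvabilizer x

/-- The projective special linear group `PSL(n, R)`. -/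
noncomputable abbrev PSL (n : ℕ) (R : Type*) [CommRing R] : Type _ :=
  Matrix.SpecialLinearGroup (Fin n) R ⧸
    Subgroup.center (Matrix.SpecialLinearGroup (Fin n) R)

set_option maxRecDepth 100000
set_option linter.all false
set_option linter.deprecated false

namespace SolvPSL

/-! ## A kernel-friendly model of 3×3 matrices over the field with three elements -/

/-- The field with three elements, as an enumerated type. -/
inductive T | z | o | t

/-- addition -/
def T.add : T → T → T
  | .z, b => b
  | .o, .z => .o | .o, .o => .t | .o, .t => .z
  | .t, .z => .t | .t, .o => .z | .t, .t => .o

/-- negation -/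
def T.neg : T → T
  | .z => .z | .o => .t | .t => .o

/-- multiplication -/
def T.mul : T → T → T
  | .z, _ => .z
  | .o, b => b
  | .t, b => b.neg

/-- boolean equality -/
def T.beq : T → T → Bool
  | .z, .z => true | .o, .o => true | .t, .t => true
  | _, _ => false

/-- evaluate the argument before passing it on -/
def T.force {α : Type} (x : T) (f : T → α) : α :=
  match x with
  | .z => f .z
  | .o => f .o
  | .t => f .t

theorem T.force_eq {α : Type} (x : T) (f : T → α) : x.force f = f x := by cases x <;> rfl

theorem T.beq_iff (x y : T) : x.beq y = true ↔ x = y := by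
  cases x <;> cases y <;> simp [T.beq]

/-- the element of `ZMod 3` -/
def T.toZ : T → ZMod 3
  | .z => 0 | .o => 1 | .t => 2

theorem T.toZ_add (x y : T) : (x.add y).toZ = x.toZ + y.toZ := by
  cases x <;> cases y <;> decide
theorem T.toZ_mul (x y : T) : (x.mul y).toZ = x.toZ * y.toZ := by
  cases x <;> cases y <;> decide
theorem T.toZ_neg (x : T) : (x.neg).toZ = -x.toZ := by
  cases x <;> decide
theorem T.toZ_inj {x y : T} (h : x.toZ = y.toZ) : x = y := by
  cases x <;> cases y <;> first | rfl | (exfalso; revert h; decide)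
theorem T.toZ_surj (x : ZMod 3) : ∃ y : T, y.toZ = x := by
  fin_cases x
  · exact ⟨.z, rfl⟩
  · exact ⟨.o, rfl⟩
  · exact ⟨.t, rfl⟩

/-- the inverse of `toZ` -/
noncomputable def ofZ (x : ZMod 3) : T := (T.toZ_surj x).choose
theorem toZ_ofZ (x : ZMod 3) : (ofZ x).toZ = x := (T.toZ_surj x).choose_spec
theorem ofZ_toZ (x : T) : ofZ x.toZ = x := T.toZ_inj (toZ_ofZ _)

/-- vectors -/
structure V3 where
  x : T
  y : T
  z : T

/-- matrices, row by row -/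
structure M9 where
  a : T
  b : T
  c : T
  d : T
  e : T
  f : T
  g : T
  h : T
  i : T

/-- inner product -/
def dot (a b c x y z : T) : T := (a.mul x).add ((b.mul y).add (c.mul z))

/-- product -/
def M9.mul (p q : M9) : M9 :=
  ⟨dot p.a p.b p.c q.a q.d q.g, dot p.a p.b p.c q.b q.e q.h, dot p.a p.b p.c q.c q.f q.i,
   dot p.d p.e p.f q.a q.d q.g, dot p.d p.e p.f q.b q.e q.h, dot p.d p.e p.f q.c q.f q.i,
   dot p.g p.h p.i q.a q.d q.g, dot p.g p.h p.i q.b q.e q.h, dot p.g p.h p.i q.c q.f q.i⟩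

/-- identity -/
def M9.one : M9 := ⟨.o, .z, .z, .z, .o, .z, .z, .z, .o⟩

/-- first cofactor -/
def cofA (e f h i : T) : T := (e.mul i).add (f.mul h).neg

/-- determinant -/
def M9.det (p : M9) : T :=
  dot p.a p.b p.c (cofA p.e p.f p.h p.i) (cofA p.f p.d p.i p.g) (cofA p.d p.e p.g p.h)

/-- matrix times column -/
def M9.app (p : M9) (v : V3) : V3 :=
  ⟨dot p.a p.b p.c v.x v.y v.z, dot p.d p.e p.f v.x v.y v.z, dot p.g p.h p.i v.x v.y v.z⟩

/-- row times matrix -/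
def M9.rap (v : V3) (p : M9) : V3 :=
  ⟨dot v.x v.y v.z p.a p.d p.g, dot v.x v.y v.z p.b p.e p.h, dot v.x v.y v.z p.c p.f p.i⟩

/-- negation -/
def V3.neg (v : V3) : V3 := ⟨v.x.neg, v.y.neg, v.z.neg⟩

/-- boolean equality -/
def V3.beq (v w : V3) : Bool := v.x.beq w.x && (v.y.beq w.y && v.z.beq w.z)

/-- boolean equality -/
def M9.beq (p q : M9) : Bool :=
  p.a.beq q.a && (p.b.beq q.b && (p.c.beq q.c && (p.d.beq q.d && (p.e.beq q.e &&
  (p.f.beq q.f && (p.g.beq q.g && (p.h.beq q.h && p.i.beq q.i)))))))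

theorem V3.beq_iff (v w : V3) : v.beq w = true ↔ v = w := by
  cases v; cases w; simp [V3.beq, T.beq_iff]
theorem M9.beq_iff (v w : M9) : v.beq w = true ↔ v = w := by
  cases v; cases w; simp [M9.beq, T.beq_iff]

/-- universal quantifier over `T` -/
def allT (f : T → Bool) : Bool := f .z && (f .o && f .t)
theorem allT_spec {f : T → Bool} (h : allT f = true) (x : T) : f x = true := by
  simp [allT] at h
  cases x <;> simp [h]

/-- universal quantifier over vectors -/
def allV (f : V3 → Bool) : Bool := allT fun x => allT fun y => allT fun z => f ⟨x, y, z⟩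
theorem allV_spec {f : V3 → Bool} (h : allV f = true) (v : V3) : f v = true :=
  allT_spec (allT_spec (allT_spec h v.x) v.y) v.z

/-- universal quantifier over the matrices of determinant one -/
def allS (F : M9 → Bool) : Bool :=
  allT fun d => allT fun e => allT fun f => allT fun g => allT fun h => allT fun i =>
  (cofA e f h i).force fun A => (cofA f d i g).force fun B => (cofA d e g h).force fun C =>
  allT fun a => allT fun b => allT fun c =>
  match dot a b c A B C with
  | .o => F ⟨a, b, c, d, e, f, g, h, i⟩
  | _ => true

theorem allS_spec {F : M9 → Bool} (h : allS F = true) (m : M9) (hm : m.det = .o) :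
    F m = true := by
  have := allT_spec (allT_spec (allT_spec (allT_spec (allT_spec (allT_spec h m.d) m.e) m.f)
    m.g) m.h) m.i
  rw [T.force_eq, T.force_eq, T.force_eq] at this
  have := allT_spec (allT_spec (allT_spec this m.a) m.b) m.c
  change dot m.a m.b m.c _ _ _ = _ at hm
  rw [hm] at this
  exact this

/-- sums over `T` -/
def cntT (f : T → Nat) : Nat := Nat.add (f .z) (Nat.add (f .o) (f .t))

/-- sums over the matrices of determinant one -/
def cntS (F : M9 → Nat) : Nat :=
  cntT fun d => cntT fun e => cntT fun f => cntT fun g => cntT fun h => cntT fun i =>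
  (cofA e f h i).force fun A => (cofA f d i g).force fun B => (cofA d e g h).force fun C =>
  cntT fun a => cntT fun b => cntT fun c =>
  match dot a b c A B C with
  | .o => F ⟨a, b, c, d, e, f, g, h, i⟩
  | _ => 0

instance : Fintype T := ⟨⟨{T.z, T.o, T.t}, by simp⟩, fun x => by cases x <;> simp⟩

theorem cntT_eq (f : T → Nat) : cntT f = ∑ x : T, f x := by
  have : (Finset.univ : Finset T) = ⟨{T.z, T.o, T.t}, by simp⟩ := rfl
  rw [this]
  simp [cntT, Finset.sum]

/-- the special linear group -/
abbrev G := Matrix.SpecialLinearGroup (Fin 3) (ZMod 3)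

/-- translation into Mathlib's matrices -/
def M9.toMat (m : M9) : Matrix (Fin 3) (Fin 3) (ZMod 3) :=
  !![m.a.toZ, m.b.toZ, m.c.toZ; m.d.toZ, m.e.toZ, m.f.toZ; m.g.toZ, m.h.toZ, m.i.toZ]

/-- translation into Mathlib's vectors -/
def V3.toVec (v : V3) : Fin 3 → ZMod 3 := ![v.x.toZ, v.y.toZ, v.z.toZ]

theorem toMat_mul (p q : M9) : (p.mul q).toMat = p.toMat * q.toMat := by
  ext i j
  fin_cases i <;> fin_cases j <;>
    simp [M9.toMat, M9.mul, dot, T.toZ_add, T.toZ_mul, Matrix.mul_apply, Fin.sum_univ_three,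
      add_assoc]

theorem toMat_det (p : M9) : (p.toMat).det = p.det.toZ := by
  rw [Matrix.det_fin_three]
  simp [M9.toMat, M9.det, cofA, dot, T.toZ_add, T.toZ_mul, T.toZ_neg]
  ring

theorem toMat_app (p : M9) (v : V3) : (p.app v).toVec = p.toMat.mulVec v.toVec := by
  ext i
  fin_cases i <;>
    simp [M9.toMat, M9.app, V3.toVec, dot, T.toZ_add, T.toZ_mul, Matrix.mulVec, dotProduct,
      Fin.sum_univ_three, add_assoc]

theorem toMat_rap (p : M9) (v : V3) : (M9.rap v p).toVec = Matrix.vecMul v.toVec p.toMat := by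
  ext i
  fin_cases i <;>
    simp [M9.toMat, M9.rap, V3.toVec, dot, T.toZ_add, T.toZ_mul, Matrix.vecMul, dotProduct,
      Fin.sum_univ_three, add_assoc]

theorem toVec_neg (v : V3) : v.neg.toVec = -v.toVec := by
  ext i
  fin_cases i <;> simp [V3.toVec, V3.neg, T.toZ_neg]

theorem toVec_inj {v w : V3} (h : v.toVec = w.toVec) : v = w := by
  have h0 := T.toZ_inj (congrFun h 0)
  have h1 := T.toZ_inj (congrFun h 1)
  have h2 := T.toZ_inj (congrFun h 2)
  cases v; cases w; simp_all

theorem toMat_inj {p q : M9} (h : p.toMat = q.toMat) : p = q := by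
  have h0 := T.toZ_inj (congrFun (congrFun h 0) 0)
  have h1 := T.toZ_inj (congrFun (congrFun h 0) 1)
  have h2 := T.toZ_inj (congrFun (congrFun h 0) 2)
  have h3 := T.toZ_inj (congrFun (congrFun h 1) 0)
  have h4 := T.toZ_inj (congrFun (congrFun h 1) 1)
  have h5 := T.toZ_inj (congrFun (congrFun h 1) 2)
  have h6 := T.toZ_inj (congrFun (congrFun h 2) 0)
  have h7 := T.toZ_inj (congrFun (congrFun h 2) 1)
  have h8 := T.toZ_inj (congrFun (congrFun h 2) 2)
  cases p; cases q; simp_all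

theorem toMat_one : M9.one.toMat = 1 := by
  ext i j
  fin_cases i <;> fin_cases j <;> rfl

/-- code of a vector -/
noncomputable def cv (v : Fin 3 → ZMod 3) : V3 := ⟨ofZ (v 0), ofZ (v 1), ofZ (v 2)⟩
theorem toVec_cv (v : Fin 3 → ZMod 3) : (cv v).toVec = v := by
  ext i
  fin_cases i <;> simp [cv, V3.toVec, toZ_ofZ]
theorem cv_toVec (v : V3) : cv v.toVec = v := toVec_inj (toVec_cv _)

/-- code of a matrix -/
noncomputable def cm (x : G) : M9 :=
  ⟨ofZ (x.1 0 0), ofZ (x.1 0 1), ofZ (x.1 0 2), ofZ (x.1 1 0), ofZ (x.1 1 1), ofZ (x.1 1 2),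
   ofZ (x.1 2 0), ofZ (x.1 2 1), ofZ (x.1 2 2)⟩
theorem toMat_cm (x : G) : (cm x).toMat = x.1 := by
  ext i j
  fin_cases i <;> fin_cases j <;> simp [cm, M9.toMat, toZ_ofZ]
theorem cm_det (x : G) : (cm x).det = .o := by
  apply T.toZ_inj
  rw [← toMat_det, toMat_cm, x.2]
  rfl
theorem cm_inj {x y : G} (h : cm x = cm y) : x = y := by
  apply Subtype.ext
  rw [← toMat_cm x, h, toMat_cm]
theorem cm_mul (x y : G) : cm (x * y) = (cm x).mul (cm y) := by
  apply toMat_inj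
  rw [toMat_mul, toMat_cm, toMat_cm, toMat_cm]
  rfl
theorem cm_one : cm 1 = M9.one := by
  apply toMat_inj
  rw [toMat_cm, toMat_one]
  rfl

/-- the group element with a given code -/
def mk (m : M9) (h : m.det = .o) : G := ⟨m.toMat, by rw [toMat_det, h]; rfl⟩
theorem cm_mk (m : M9) (h : m.det = .o) : cm (mk m h) = m := by
  apply toMat_inj
  rw [toMat_cm]
  rfl
theorem mk_cm (x : G) : mk (cm x) (cm_det x) = x := cm_inj (cm_mk _ _)

theorem eq_mk_iff (x : G) (m : M9) (h : m.det = .o) : x = mk m h ↔ cm x = m :=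
  ⟨fun e => by rw [e, cm_mk], fun e => cm_inj (by rw [e, cm_mk])⟩

/-- the action on column vectors, in codes -/
theorem act_iff (x : G) (v w : Fin 3 → ZMod 3) :
    x.1.mulVec v = w ↔ (cm x).app (cv v) = cv w := by
  constructor
  · intro h
    apply toVec_inj
    rw [toMat_app, toMat_cm, toVec_cv, toVec_cv, h]
  · intro h
    rw [← toVec_cv w, ← h, toMat_app, toMat_cm, toVec_cv]

/-- the action on row vectors, in codes -/
theorem ract_iff (x : G) (v w : Fin 3 → ZMod 3) :
    Matrix.vecMul v x.1 = w ↔ M9.rap (cv v) (cm x) = cv w := by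
  constructor
  · intro h
    apply toVec_inj
    rw [toMat_rap, toMat_cm, toVec_cv, toVec_cv, h]
  · intro h
    rw [← toVec_cv w, ← h, toMat_rap, toMat_cm, toVec_cv]

theorem cv_neg (v : Fin 3 → ZMod 3) : cv (-v) = (cv v).neg :=
  toVec_inj (by rw [toVec_cv, toVec_neg, toVec_cv])

/-- codes form a product of copies of `T` -/
def M9.equiv : M9 ≃ (T × T × T × T × T × T) × (T × T × T) where
  toFun m := ((m.d, m.e, m.f, m.g, m.h, m.i), (m.a, m.b, m.c))
  invFun p := ⟨p.2.1, p.2.2.1, p.2.2.2, p.1.1, p.1.2.1, p.1.2.2.1, p.1.2.2.2.1,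
    p.1.2.2.2.2.1, p.1.2.2.2.2.2⟩
  left_inv _ := rfl
  right_inv _ := rfl

noncomputable instance : Fintype M9 := Fintype.ofEquiv _ M9.equiv.symm

theorem cntS_eq (F : M9 → Nat) : cntS F = ∑ x : G, F (cm x) := by
  classical
  have h1 : ∑ x : G, F (cm x) = ∑ m : M9, if m.det = .o then F m else 0 := by
    rw [← Finset.sum_filter]
    refine Finset.sum_bij (fun x _ => cm x) ?_ ?_ ?_ ?_
    · intro x _; simp [cm_det]
    · intro x _ y _ h; exact cm_inj h
    · intro m hm
      simp at hm
      exact ⟨mk m hm, by simp, cm_mk m hm⟩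
    · intro x _; rfl
  rw [h1, ← Equiv.sum_comp M9.equiv.symm]
  simp only [Fintype.sum_prod_type]
  simp only [cntS, T.force_eq, cntT_eq]
  refine Finset.sum_congr rfl fun d _ => Finset.sum_congr rfl fun e _ =>
    Finset.sum_congr rfl fun f _ => Finset.sum_congr rfl fun g _ => Finset.sum_congr rfl fun h _ =>
    Finset.sum_congr rfl fun i _ => Finset.sum_congr rfl fun a _ => Finset.sum_congr rfl fun b _ =>
    Finset.sum_congr rfl fun c _ => ?_
  change _ = if dot a b c (cofA e f h i) (cofA f d i g) (cofA d e g h) = T.o then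
    F ⟨a, b, c, d, e, f, g, h, i⟩ else 0
  generalize dot a b c (cofA e f h i) (cofA f d i g) (cofA d e g h) = q
  cases q <;> simp

/-! ## Computations -/

/-- trace -/
def M9.tr (m : M9) : T := m.a.add (m.e.add m.i)
/-- second coefficient of the characteristic polynomial -/
def M9.e2 (m : M9) : T :=
  (cofA m.a m.b m.d m.e).add ((cofA m.a m.c m.g m.i).add (cofA m.e m.f m.h m.i))
/-- companion matrix -/
def compM (t s : T) : M9 := ⟨.z, .z, .o, .o, .z, s.neg, .z, .o, t⟩
/-- matrix with given columns -/
def cols (u v w : V3) : M9 := ⟨u.x, v.x, w.x, u.y, v.y, w.y, u.z, v.z, w.z⟩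
/-- difference -/
def V3.sub (u v : V3) : V3 := ⟨u.x.add v.x.neg, u.y.add v.y.neg, u.z.add v.z.neg⟩
/-- existential quantifier over `T` -/
def anyT (f : T → Bool) : Bool := f .z || (f .o || f .t)
/-- existential quantifier over vectors -/
def anyV (f : V3 → Bool) : Bool := anyT fun x => anyT fun y => anyT fun z => f ⟨x, y, z⟩

theorem anyT_spec {f : T → Bool} (h : anyT f = true) : ∃ x, f x = true := by
  simp [anyT] at h
  rcases h with h | h | h <;> exact ⟨_, h⟩
theorem anyV_spec {f : V3 → Bool} (h : anyV f = true) : ∃ x, f x = true := by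
  obtain ⟨x, h⟩ := anyT_spec h
  obtain ⟨y, h⟩ := anyT_spec h
  obtain ⟨z, h⟩ := anyT_spec h
  exact ⟨_, h⟩

/-- an involution -/
def r2 : M9 := ⟨.o, .z, .z, .z, .t, .z, .z, .z, .t⟩
/-- a transvection -/
def r3A : M9 := ⟨.o, .z, .o, .z, .o, .z, .z, .z, .o⟩
/-- an element of order four -/
def r4 : M9 := ⟨.o, .z, .z, .z, .z, .t, .z, .o, .z⟩
/-- an element of order eight -/
def r8 : M9 := ⟨.t, .z, .z, .z, .o, .o, .z, .o, .z⟩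
/-- a monomial element of order four -/
def zz : M9 := ⟨.z, .o, .z, .t, .z, .z, .z, .z, .o⟩
/-- a vector -/
def e1 : V3 := ⟨.o, .z, .z⟩
/-- the zero vector -/
def z3 : V3 := ⟨.z, .z, .z⟩

/-- conjugation certificate -/
def cert (m r g : M9) : Bool := g.det.beq .o && M9.beq (m.mul g) (g.mul r)

/-- evaluate a vector before passing it on -/
def V3.force {α : Type} (v : V3) (f : V3 → α) : α :=
  v.x.force fun x => v.y.force fun y => v.z.force fun z => f ⟨x, y, z⟩
theorem V3.force_eq {α : Type} (v : V3) (f : V3 → α) : v.force f = f v := by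
  simp [V3.force, T.force_eq]
/-- `v + t w - s u` -/
def lc (t s : T) (v u w : V3) : V3 :=
  ⟨v.x.add ((t.mul w.x).add (s.mul u.x).neg), v.y.add ((t.mul w.y).add (s.mul u.y).neg),
   v.z.add ((t.mul w.z).add (s.mul u.z).neg)⟩
/-- existence of a cyclic basis -/
def cycB (m : M9) : Bool :=
  anyV fun v => !(V3.beq v z3) && ((m.app v).force fun u => (m.app u).force fun w =>
    !((cols v u w).det.beq .z) && V3.beq (m.app w) (lc m.tr m.e2 v u w))
/-- conjugate to `r2` -/
def invB (m : M9) : Bool :=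
  anyV fun u => V3.beq (m.app u) u && (!(V3.beq u z3) && anyV fun v => V3.beq (m.app v) v.neg &&
    anyV fun w => V3.beq (m.app w) w.neg && cert m r2 (cols u v w))
/-- conjugate to `r3A` -/
def traB (m : M9) : Bool :=
  anyV fun w => !(V3.beq (m.app w) w) && anyV fun v => V3.beq (m.app v) v &&
    cert m r3A (cols ((m.app w).sub w) v w)
/-- every matrix is conjugate to a representative -/
def conjB (m : M9) : Bool :=
  if M9.beq (m.mul m) M9.one then M9.beq m M9.one || invB m
  else cycB m || (m.tr.beq m.e2 && traB m)
/-- counting weights -/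
def kindN (m : M9) : Nat :=
  if m.tr.beq m.e2 then (if M9.beq (m.mul m) M9.one then 1 else 10000) else 100000000

/-- test for a common fixed point or line -/
def fixB (m : M9) (v w : V3) : Bool :=
  (V3.beq (m.app v) v || V3.beq (m.app v) v.neg) ||
    (V3.beq (M9.rap w m) w || V3.beq (M9.rap w m) w.neg)
/-- first column -/
def M9.col (g : M9) : V3 := ⟨g.a, g.d, g.g⟩
/-- first row -/
def M9.row (g : M9) : V3 := ⟨g.a, g.b, g.c⟩
/-- a sequence of tests -/
def testsB (m : M9) : List (M9 × M9 × Bool) → Bool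
  | [] => true
  | p :: L => (fixB m p.1.col p.2.1.row == p.2.2) && testsB m L

/-- membership -/
def memV (v : V3) : List V3 → Bool
  | [] => false
  | w :: L => V3.beq v w || memV v L
/-- insertion -/
def insV (v : V3) (L : List V3) : List V3 :=
  v.x.force fun x => v.y.force fun y => v.z.force fun z =>
    if memV ⟨x, y, z⟩ L then L else ⟨x, y, z⟩ :: L
/-- one step of the orbit algorithm -/
def stepV (p q : M9) : List V3 → List V3 → List V3
  | [], acc => acc
  | v :: L, acc => stepV p q L (insV (p.app v) (insV (q.app v) acc))
/-- length at least seven -/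
def len7 : List V3 → Bool
  | _ :: _ :: _ :: _ :: _ :: _ :: _ :: _ => true
  | _ => false
/-- orbit algorithm: the orbit has at least seven elements -/
def orbB (p q : M9) : Nat → List V3 → Bool
  | 0, L => len7 L
  | n + 1, L => len7 L || orbB p q n (stepV p q L L)
/-- order eight -/
def ord8 (h : M9) : Bool :=
  let h2 := h.mul h
  let h4 := h2.mul h2
  !(M9.beq h4 M9.one) && M9.beq (h4.mul h4) M9.one
/-- some short word has order eight -/
def word8 (p q : M9) : Bool :=
  ord8 (p.mul (q.mul q)) || (ord8 (p.mul q) || (ord8 (p.mul (p.mul q)) ||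
    ord8 (((p.mul p).mul (q.mul p)).mul ((q.mul p).mul (q.mul q)))))
/-- certificate for two elements to generate a nonsolvable group -/
def nonsolv (p q : M9) : Bool :=
  word8 p q && ((allV fun v => V3.beq v z3 || orbB p q 6 [v]) &&
    allV fun w => V3.beq w z3 ||
      (!(V3.beq (M9.rap w p) w || V3.beq (M9.rap w p) w.neg) ||
       !(V3.beq (M9.rap w q) w || V3.beq (M9.rap w q) w.neg)))

/-- elements of order eight fixing the standard antiflag -/
def t8 (m : M9) : Bool :=
  m.b.beq .z && (m.c.beq .z && (m.d.beq .z && (m.g.beq .z && ord8 m)))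
/-- conjugate of the second argument -/
def cj (h r hi : M9) : M9 := (h.mul r).mul hi
/-- an inverse -/
def r4i : M9 := ⟨.o, .z, .z, .z, .z, .o, .z, .t, .z⟩
/-- block matrix -/
def h1 : M9 := ⟨.o, .z, .z, .z, .z, .o, .z, .t, .o⟩
/-- its inverse -/
def h1i : M9 := ⟨.o, .z, .z, .z, .o, .t, .z, .o, .z⟩
/-- block matrix -/
def h2 : M9 := ⟨.o, .z, .z, .z, .z, .o, .z, .t, .t⟩
/-- its inverse -/
def h2i : M9 := ⟨.o, .z, .z, .z, .t, .t, .z, .o, .z⟩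
/-- elements of order four fixing the standard antiflag -/
def t4 (m : M9) : Bool :=
  (M9.beq m r4 || M9.beq m r4i) ||
  ((M9.beq m (cj h1 r4 h1i) || M9.beq m (cj h1 r4i h1i)) ||
   (M9.beq m (cj h2 r4 h2i) || M9.beq m (cj h2 r4i h2i)))
/-- fixed vector test for powers -/
def orb8 (m : M9) (v : V3) : Bool :=
  let v1 := m.app v
  let v2 := m.app v1
  let v3 := m.app v2
  let v4 := m.app v3
  let v5 := m.app v4
  let v6 := m.app v5
  (V3.beq v z3 || (V3.beq v e1 || V3.beq v e1.neg)) ||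
   !(V3.beq v1 v || (V3.beq v2 v || (V3.beq v3 v || (V3.beq v4 v || (V3.beq v5 v ||
      V3.beq v6 v)))))
/-- membership in the first `n` powers of `c`, starting from `q` -/
def powB (m c : M9) : Nat → M9 → Bool
  | 0, _ => false
  | n + 1, q => M9.beq m q || powB m c n (q.mul c)
/-- commuting elements are powers -/
def cenB (c m : M9) : Bool :=
  !(M9.beq (m.mul c) (c.mul m)) || powB m c 13 M9.one
/-- membership -/
def memM (v : M9) : List M9 → Bool
  | [] => false
  | w :: L => M9.beq v w || memM v L
/-- all pairs -/
def pairB (f : M9 → M9 → Bool) (L : List M9) : List M9 → Bool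
  | [] => true
  | a :: K => L.all (f a) && pairB f L K
/-- there is `c` in the list with `u = c * v` -/
def quoB (u v : M9) : List M9 → Bool
  | [] => false
  | c :: L => M9.beq u (c.mul v) || quoB u v L
/-- test elements -/
def l1 : List (M9 × M9 × Bool) :=
  [(⟨.z, .z, .o, .o, .z, .o, .z, .o, .z⟩, ⟨.t, .o, .z, .z, .z, .o, .o, .z, .z⟩, true),
   (⟨.o, .z, .o, .t, .z, .z, .z, .t, .z⟩, ⟨.z, .t, .z, .z, .z, .t, .o, .o, .z⟩, true),
   (⟨.z, .z, .o, .o, .o, .z, .o, .t, .z⟩, ⟨.z, .t, .t, .z, .t, .o, .o, .z, .z⟩, true),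
   (⟨.o, .z, .o, .z, .t, .z, .t, .o, .o⟩, ⟨.t, .o, .o, .z, .t, .z, .t, .t, .t⟩, true),
   (⟨.o, .z, .o, .o, .z, .t, .o, .t, .z⟩, ⟨.t, .t, .z, .t, .t, .t, .t, .o, .z⟩, true),
   (⟨.z, .z, .o, .o, .o, .z, .z, .o, .z⟩, ⟨.z, .o, .t, .z, .z, .o, .o, .z, .z⟩, true)]

/-- test elements -/
def l2 : List (M9 × M9 × Bool) :=
  [(⟨.z, .z, .o, .o, .z, .o, .z, .o, .z⟩, ⟨.t, .o, .z, .z, .z, .o, .o, .z, .z⟩, true),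
   (⟨.o, .z, .o, .t, .z, .z, .z, .t, .z⟩, ⟨.z, .t, .z, .z, .z, .t, .o, .o, .z⟩, true),
   (⟨.z, .z, .o, .o, .o, .z, .o, .t, .z⟩, ⟨.z, .t, .t, .z, .t, .o, .o, .z, .z⟩, true),
   (⟨.o, .z, .o, .t, .z, .o, .z, .o, .z⟩, ⟨.t, .o, .z, .z, .z, .o, .t, .t, .z⟩, false),
   (⟨.o, .z, .o, .z, .o, .z, .o, .z, .t⟩, ⟨.t, .z, .t, .z, .o, .z, .t, .z, .o⟩, false)]

/-- test elements -/
def l3A : List (M9 × M9 × Bool) :=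
  [(⟨.z, .z, .o, .o, .z, .o, .z, .o, .z⟩, ⟨.t, .o, .z, .z, .z, .o, .o, .z, .z⟩, true),
   (⟨.o, .z, .o, .t, .z, .z, .z, .t, .z⟩, ⟨.z, .t, .z, .z, .z, .t, .o, .o, .z⟩, true),
   (⟨.z, .z, .o, .o, .o, .z, .o, .t, .z⟩, ⟨.z, .t, .t, .z, .t, .o, .o, .z, .z⟩, true),
   (⟨.o, .z, .z, .o, .z, .o, .t, .t, .z⟩, ⟨.o, .z, .z, .t, .z, .t, .t, .o, .z⟩, false),
   (⟨.z, .z, .o, .z, .o, .z, .t, .z, .o⟩, ⟨.o, .z, .t, .z, .o, .z, .o, .z, .z⟩, false)]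

/-- test elements -/
def l6 : List (M9 × M9 × Bool) :=
  [(⟨.o, .z, .o, .t, .o, .z, .o, .z, .t⟩, ⟨.t, .z, .t, .t, .o, .t, .t, .z, .o⟩, true),
   (⟨.z, .z, .o, .o, .o, .z, .o, .t, .t⟩, ⟨.t, .t, .t, .o, .t, .o, .o, .z, .z⟩, true),
   (⟨.z, .z, .o, .o, .t, .z, .o, .z, .t⟩, ⟨.o, .z, .o, .o, .t, .o, .o, .z, .z⟩, false),
   (⟨.z, .z, .o, .z, .o, .z, .t, .o, .t⟩, ⟨.t, .o, .t, .z, .o, .z, .o, .z, .z⟩, true),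
   (⟨.z, .z, .o, .z, .o, .z, .t, .z, .o⟩, ⟨.o, .z, .t, .z, .o, .z, .o, .z, .z⟩, false)]

/-- test elements -/
def l4 : List (M9 × M9 × Bool) :=
  [(⟨.o, .z, .z, .o, .z, .o, .t, .t, .z⟩, ⟨.o, .z, .z, .t, .z, .t, .t, .o, .z⟩, true),
   (⟨.o, .z, .o, .z, .o, .z, .z, .t, .o⟩, ⟨.o, .t, .t, .z, .o, .z, .z, .o, .o⟩, true),
   (⟨.o, .z, .o, .o, .o, .z, .t, .t, .o⟩, ⟨.o, .t, .t, .t, .t, .o, .z, .o, .o⟩, false),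
   (⟨.z, .z, .o, .z, .o, .z, .t, .z, .z⟩, ⟨.z, .z, .t, .z, .o, .z, .o, .z, .z⟩, false),
   (⟨.z, .z, .o, .o, .o, .z, .o, .t, .z⟩, ⟨.z, .t, .t, .z, .t, .o, .o, .z, .z⟩, false)]

/-- test elements -/
def l3B : List (M9 × M9 × Bool) :=
  [(⟨.o, .z, .o, .o, .o, .z, .o, .z, .t⟩, ⟨.t, .z, .t, .o, .o, .o, .t, .z, .o⟩, true),
   (⟨.z, .z, .o, .z, .o, .z, .t, .t, .t⟩, ⟨.t, .t, .t, .z, .o, .z, .o, .z, .z⟩, true),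
   (⟨.o, .z, .o, .z, .z, .o, .t, .t, .z⟩, ⟨.o, .t, .z, .t, .o, .t, .z, .o, .z⟩, false),
   (⟨.z, .z, .o, .z, .o, .z, .t, .z, .o⟩, ⟨.o, .z, .t, .z, .o, .z, .o, .z, .z⟩, false),
   (⟨.z, .z, .o, .o, .t, .z, .t, .t, .z⟩, ⟨.z, .t, .o, .z, .o, .o, .o, .z, .z⟩, false),
   (⟨.o, .z, .z, .t, .z, .o, .z, .t, .z⟩, ⟨.o, .z, .z, .z, .z, .t, .o, .o, .z⟩, false)]

/-- a subgroup of order 24 -/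
def s0 : List M9 :=
  [⟨.z, .z, .o, .z, .o, .z, .t, .z, .z⟩,
   ⟨.z, .z, .o, .z, .t, .z, .o, .z, .z⟩,
   ⟨.z, .z, .o, .o, .z, .z, .z, .o, .z⟩,
   ⟨.z, .z, .o, .t, .z, .z, .z, .t, .z⟩,
   ⟨.z, .z, .t, .z, .o, .z, .o, .z, .z⟩,
   ⟨.z, .z, .t, .z, .t, .z, .t, .z, .z⟩,
   ⟨.z, .z, .t, .o, .z, .z, .z, .t, .z⟩,
   ⟨.z, .z, .t, .t, .z, .z, .z, .o, .z⟩,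
   ⟨.z, .o, .z, .z, .z, .o, .o, .z, .z⟩,
   ⟨.z, .o, .z, .z, .z, .t, .t, .z, .z⟩,
   ⟨.z, .o, .z, .o, .z, .z, .z, .z, .t⟩,
   ⟨.z, .o, .z, .t, .z, .z, .z, .z, .o⟩,
   ⟨.z, .t, .z, .z, .z, .o, .t, .z, .z⟩,
   ⟨.z, .t, .z, .z, .z, .t, .o, .z, .z⟩,
   ⟨.z, .t, .z, .o, .z, .z, .z, .z, .o⟩,
   ⟨.z, .t, .z, .t, .z, .z, .z, .z, .t⟩,
   ⟨.o, .z, .z, .z, .z, .o, .z, .t, .z⟩,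
   ⟨.o, .z, .z, .z, .z, .t, .z, .o, .z⟩,
   ⟨.o, .z, .z, .z, .o, .z, .z, .z, .o⟩,
   ⟨.o, .z, .z, .z, .t, .z, .z, .z, .t⟩,
   ⟨.t, .z, .z, .z, .z, .o, .z, .o, .z⟩,
   ⟨.t, .z, .z, .z, .z, .t, .z, .t, .z⟩,
   ⟨.t, .z, .z, .z, .o, .z, .z, .z, .t⟩,
   ⟨.t, .z, .z, .z, .t, .z, .z, .z, .o⟩]

/-- a subgroup of order 12 -/
def s1 : List M9 :=
  [⟨.z, .z, .o, .o, .z, .z, .z, .o, .z⟩,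
   ⟨.z, .z, .o, .t, .z, .z, .z, .t, .z⟩,
   ⟨.z, .z, .t, .o, .z, .z, .z, .t, .z⟩,
   ⟨.z, .z, .t, .t, .z, .z, .z, .o, .z⟩,
   ⟨.z, .o, .z, .z, .z, .o, .o, .z, .z⟩,
   ⟨.z, .o, .z, .z, .z, .t, .t, .z, .z⟩,
   ⟨.z, .t, .z, .z, .z, .o, .t, .z, .z⟩,
   ⟨.z, .t, .z, .z, .z, .t, .o, .z, .z⟩,
   ⟨.o, .z, .z, .z, .o, .z, .z, .z, .o⟩,
   ⟨.o, .z, .z, .z, .t, .z, .z, .z, .t⟩,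
   ⟨.t, .z, .z, .z, .o, .z, .z, .z, .t⟩,
   ⟨.t, .z, .z, .z, .t, .z, .z, .z, .o⟩]

/-- a subgroup of order 4 -/
def s2 : List M9 :=
  [⟨.o, .z, .z, .z, .o, .z, .z, .z, .o⟩,
   ⟨.o, .z, .z, .z, .t, .z, .z, .z, .t⟩,
   ⟨.t, .z, .z, .z, .o, .z, .z, .z, .t⟩,
   ⟨.t, .z, .z, .z, .t, .z, .z, .z, .o⟩]

theorem conj_check : allS conjB = true := by decide +kernel
theorem kind_check : cntS kindN = 118 + 2366 * 10000 + 3132 * 100000000 := by decide +kernel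
theorem l1_check : (allS fun m => !(testsB m l1) || M9.beq m M9.one) = true := by decide +kernel
theorem l2_check : (allS fun m => !(testsB m l2) || M9.beq m r2) = true := by decide +kernel
theorem l3A_check : (allS fun m => !(testsB m l3A) || (M9.beq m r3A || M9.beq (m.mul r3A) M9.one))
    = true := by decide +kernel
theorem l6_check : (allS fun m => !(testsB m l6) || (M9.beq m (compM .t .t) ||
    M9.beq (m.mul (compM .t .t)) M9.one)) = true := by decide +kernel
theorem l4_check : (allS fun m => !(testsB m l4) || (t8 m || t4 m)) = true := by decide +kernel
theorem l3B_check : (allS fun m => !(testsB m l3B) || (M9.beq m (compM .z .z) ||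
    (M9.beq (m.mul (compM .z .z)) M9.one || nonsolv m zz))) = true := by decide +kernel
theorem n4_check : (allS fun m => !(t4 m) || (M9.beq m r4 || (M9.beq (m.mul r4) M9.one ||
    nonsolv m zz))) = true := by decide +kernel
theorem t8_check : (allS fun m => !(t8 m) || allV (orb8 m)) = true := by decide +kernel
theorem t8_count : (cntS fun m => if t8 m then 1 else 0) = 12 := by decide +kernel
theorem cen_check : (allS fun m => cenB (compM .z .t) m && (cenB (compM .o .t) m &&
    (cenB (compM .t .z) m && cenB (compM .t .o) m))) = true := by decide +kernel
theorem inv_check : (allS fun m => !(V3.beq (m.app e1) e1) || (!(M9.beq (m.mul r2) (r2.mul m)) ||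
    (!(M9.beq (m.mul m) M9.one) || (M9.beq m M9.one || M9.beq m r2)))) = true := by decide +kernel
theorem eig_check : (allV fun v => V3.beq v z3 ||
    (!(fixB (compM .z .t) v v) && (!(fixB (compM .o .t) v v) &&
    (!(fixB (compM .t .z) v v) && !(fixB (compM .t .o) v v))))) = true := by decide +kernel
theorem r2_check : (allV fun v => !(V3.beq (r2.app v) v) ||
    (V3.beq v z3 || (V3.beq v e1 || V3.beq v e1.neg))) = true := by decide +kernel
theorem s0_check : pairB (fun a b => memM (a.mul b) s0 && quoB (a.mul b) (b.mul a) s1) s0 s0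
    = true := by decide +kernel
theorem s1_check : pairB (fun a b => memM (a.mul b) s1 && quoB (a.mul b) (b.mul a) s2) s1 s1
    = true := by decide +kernel
theorem s2_check : pairB (fun a b => memM (a.mul b) s2 && quoB (a.mul b) (b.mul a) [M9.one]) s2 s2
    = true := by decide +kernel

/-! ## Generalities on solvabilizers -/

section general
variable {H K : Type*} [Group H] [Group K]

/-- two elements generate a solvable subgroup -/
def R (x y : H) : Prop := Group.IsSolvable ↥(Subgroup.closure {x, y})

theorem mem_sol {x y : H} : y ∈ solvabilizer x ↔ R x y := Iff.rfl

theorem R_symm {x y : H} : R x y ↔ R y x := by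
  unfold R
  rw [Set.pair_comm]

theorem solvable_le {A B : Subgroup H} (h : A ≤ B) (hB : Group.IsSolvable B) : Group.IsSolvable A :=
  solvable_of_solvable_injective (Subgroup.inclusion_injective h)

theorem R_of_mem {A : Subgroup H} (hA : Group.IsSolvable A) {x y : H} (hx : x ∈ A) (hy : y ∈ A) :
    R x y := by
  refine solvable_le ?_ hA
  rw [Subgroup.closure_le]
  rintro z (rfl | rfl)
  · exact hx
  · exact hy

theorem mem_left (x y : H) : x ∈ Subgroup.closure {x, y} :=
  Subgroup.subset_closure (by simp)
theorem mem_right (x y : H) : y ∈ Subgroup.closure {x, y} :=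
  Subgroup.subset_closure (by simp)

theorem R_map (f : H →* K) {x y : H} (h : R x y) : R (f x) (f y) := by
  have h1 : Group.IsSolvable ((Subgroup.closure {x, y}).map f) := by
    haveI : Group.IsSolvable ↥(Subgroup.closure {x, y}) := h
    exact solvable_of_surjective (f.subgroupMap_surjective _)
  exact R_of_mem h1 (Subgroup.mem_map_of_mem f (mem_left x y))
    (Subgroup.mem_map_of_mem f (mem_right x y))

theorem R_equiv (f : H ≃* K) {x y : H} : R (f x) (f y) ↔ R x y := by
  constructor
  · intro h
    have := R_map f.symm.toMonoidHom h
    simpa using this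
  · exact fun h => R_map f.toMonoidHom h

theorem R_conj (g : H) {x y : H} : R (g * x * g⁻¹) (g * y * g⁻¹) ↔ R x y := by
  have := R_equiv (MulAut.conj g) (x := x) (y := y)
  simpa using this

theorem sol_eq_of_zpowers {x x' : H} (h : x' ∈ Subgroup.zpowers x)
    (h' : x ∈ Subgroup.zpowers x') : solvabilizer x = solvabilizer x' := by
  ext y
  rw [mem_sol, mem_sol]
  have aux : ∀ {a b : H}, b ∈ Subgroup.zpowers a → R a y → R b y := by
    intro a b hb hR
    refine R_of_mem hR ?_ (mem_right a y)
    exact (Subgroup.zpowers_le.2 (mem_left a y)) hb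
  exact ⟨aux h, aux h'⟩

theorem sol_inv (x : H) : solvabilizer x⁻¹ = solvabilizer x :=
  sol_eq_of_zpowers (by
    rw [← Subgroup.zpowers_inv]
    simp) (by simp)

theorem sol_conj_iff (g x y : H) :
    solvabilizer (g * x * g⁻¹) = solvabilizer (g * y * g⁻¹) ↔ solvabilizer x = solvabilizer y := by
  have key : ∀ (g x y : H), solvabilizer x = solvabilizer y →
      solvabilizer (g * x * g⁻¹) = solvabilizer (g * y * g⁻¹) := by
    intro g x y h
    ext w
    have hw : w = g * (g⁻¹ * w * g) * g⁻¹ := by group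
    rw [mem_sol, mem_sol, hw, R_conj, R_conj, ← mem_sol, ← mem_sol, h]
  constructor
  · intro h
    have := key g⁻¹ _ _ h
    simpa [mul_assoc] using this
  · exact key g x y

theorem solvSet_ncard_equiv (f : H ≃* K) : (solvSet H).ncard = (solvSet K).ncard := by
  have : solvSet K = (Set.image f) '' solvSet H := by
    ext S
    constructor
    · rintro ⟨x, rfl⟩
      refine ⟨_, ⟨f.symm x, rfl⟩, ?_⟩
      ext y
      constructor
      · rintro ⟨w, hw, rfl⟩
        have h2 : R (f (f.symm x)) (f w) := (R_equiv f).2 hw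
        rw [f.apply_symm_apply] at h2
        exact h2
      · intro hy
        refine ⟨f.symm y, (R_equiv f).1 ?_, by simp⟩
        rw [f.apply_symm_apply, f.apply_symm_apply]
        exact hy
    · rintro ⟨_, ⟨x, rfl⟩, rfl⟩
      refine ⟨f x, ?_⟩
      ext y
      constructor
      · intro hy
        refine ⟨f.symm y, (R_equiv f).1 ?_, by simp⟩
        rw [f.apply_symm_apply]
        exact hy
      · rintro ⟨w, hw, rfl⟩
        exact (R_equiv f).2 hw
  rw [this, Set.ncard_image_of_injective]
  exact Set.image_injective.2 f.injective

end general

theorem ncard_range_eq {α β : Type*} [Fintype α] (f : α → β) (k : α → ℕ)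
    (hk : ∀ x, {y | f y = f x}.ncard = k x) :
    ((Set.range f).ncard : ℚ) = ∑ x : α, (1 : ℚ) / k x := by
  classical
  have h1 : (Set.range f) = ((Finset.univ.image f : Finset β) : Set β) := by simp
  rw [h1, Set.ncard_coe_finset]
  rw [← Finset.sum_fiberwise_of_maps_to (t := Finset.univ.image f) (g := f)
    (fun x _ => Finset.mem_image_of_mem f (Finset.mem_univ x))]
  rw [Finset.card_eq_sum_ones, Nat.cast_sum]
  refine Finset.sum_congr rfl fun b hb => ?_
  obtain ⟨x, -, rfl⟩ := Finset.mem_image.1 hb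
  have h2 : ∀ y ∈ Finset.univ.filter (fun y => f y = f x), (1 : ℚ) / k y = 1 / k x := by
    intro y hy
    have : f y = f x := by simpa using hy
    rw [← hk y, ← hk x, this]
  rw [Finset.sum_congr rfl h2, Finset.sum_const]
  have h3 : (Finset.univ.filter (fun y => f y = f x)).card = k x := by
    rw [← hk x, ← Set.ncard_coe_finset]
    simp
  rw [h3]
  have h4 : k x ≠ 0 := by
    rw [← h3]
    exact (Finset.card_pos.2 ⟨x, by simp⟩).ne'
  have : (k x : ℚ) ≠ 0 := by exact_mod_cast h4
  simp [this]

/-! ## Conjugacy representatives -/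

theorem mul_assoc9 (p q r : M9) : (p.mul q).mul r = p.mul (q.mul r) := by
  apply toMat_inj
  simp only [toMat_mul, mul_assoc]
theorem one_mul9 (p : M9) : M9.one.mul p = p := by
  apply toMat_inj
  simp only [toMat_mul, toMat_one, one_mul]
theorem mul_one9 (p : M9) : p.mul M9.one = p := by
  apply toMat_inj
  simp only [toMat_mul, toMat_one, mul_one]

/-- being conjugate to the element with a given code -/
def CJ (x : G) (r : M9) : Prop := ∃ g : G, (cm x).mul (cm g) = (cm g).mul r

theorem CJ_of_cert {x : G} {r g : M9} (h : cert (cm x) r g = true) : CJ x r := by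
  simp only [cert, Bool.and_eq_true, T.beq_iff, M9.beq_iff] at h
  exact ⟨mk g h.1, by rw [cm_mk]; exact h.2⟩

theorem CJ.eq {x : G} {r : M9} (hr : r.det = .o) (h : CJ x r) : ∃ g : G, x = g * mk r hr * g⁻¹ := by
  obtain ⟨g, hg⟩ := h
  refine ⟨g, ?_⟩
  rw [eq_mul_inv_iff_mul_eq]
  apply cm_inj
  rw [cm_mul, cm_mul, cm_mk, hg]

theorem CJ.trans {x : G} {r s g : M9} (h : CJ x r) (hc : cert r s g = true) : CJ x s := by
  simp only [cert, Bool.and_eq_true, T.beq_iff, M9.beq_iff] at hc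
  obtain ⟨k, hk⟩ := h
  refine ⟨k * mk g hc.1, ?_⟩
  rw [cm_mul, cm_mk, ← mul_assoc9, hk, mul_assoc9, hc.2, mul_assoc9]

theorem app_cols (m : M9) (u v w : V3) :
    m.mul (cols u v w) = cols (m.app u) (m.app v) (m.app w) := rfl

theorem cols_comp (t s : T) (v u w : V3) :
    (cols v u w).mul (compM t s) = cols u w (lc t s v u w) := by
  apply toMat_inj
  ext i j
  fin_cases i <;> fin_cases j <;>
    simp [M9.toMat, M9.mul, dot, T.toZ_add, T.toZ_mul, T.toZ_neg, cols, compM, lc] <;>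
    simp [T.toZ] <;> ring

theorem app_neg (m : M9) (v : V3) : m.app v.neg = (m.app v).neg := by
  apply toVec_inj
  simp only [toMat_app, toVec_neg, Matrix.mulVec_neg]

theorem lc_neg (t s : T) (v u w : V3) : lc t s v.neg u.neg w.neg = (lc t s v u w).neg := by
  apply toVec_inj
  ext i
  fin_cases i <;>
    simp [V3.toVec, V3.neg, lc, T.toZ_add, T.toZ_mul, T.toZ_neg] <;> ring

theorem det_neg (v u w : V3) : (cols v.neg u.neg w.neg).det = (cols v u w).det.neg := by
  apply T.toZ_inj
  simp [cols, M9.det, V3.neg, dot, cofA, T.toZ_add, T.toZ_mul, T.toZ_neg]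
  ring

theorem cyc_spec {x : G} (h : cycB (cm x) = true) : CJ x (compM (cm x).tr (cm x).e2) := by
  obtain ⟨v, hv⟩ := anyV_spec h
  simp only [V3.force_eq, Bool.and_eq_true, V3.beq_iff] at hv
  obtain ⟨-, h1, h2⟩ := hv
  have key : ∀ v : V3, (cols v ((cm x).app v) ((cm x).app ((cm x).app v))).det = .o →
      (cm x).app ((cm x).app ((cm x).app v)) =
        lc (cm x).tr (cm x).e2 v ((cm x).app v) ((cm x).app ((cm x).app v)) →
      CJ x (compM (cm x).tr (cm x).e2) := by
    intro v hd hl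
    refine ⟨mk _ hd, ?_⟩
    rw [cm_mk, app_cols, cols_comp, hl]
  cases hd : (cols v ((cm x).app v) ((cm x).app ((cm x).app v))).det
  · rw [hd] at h1
    simp [T.beq] at h1
  · exact key v hd h2
  · apply key v.neg
    · rw [app_neg, app_neg, det_neg, hd]
      rfl
    · rw [app_neg, app_neg, app_neg, lc_neg, h2]

theorem conj_main (x : G) :
    ((cm x).mul (cm x) = M9.one ∧ (cm x = M9.one ∨ CJ x r2)) ∨
    ((cm x).mul (cm x) ≠ M9.one ∧
      (CJ x (compM (cm x).tr (cm x).e2) ∨ ((cm x).tr = (cm x).e2 ∧ CJ x r3A))) := by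
  have h := allS_spec conj_check (cm x) (cm_det x)
  unfold conjB at h
  by_cases h0 : M9.beq ((cm x).mul (cm x)) M9.one = true
  · rw [if_pos h0] at h
    refine Or.inl ⟨(M9.beq_iff _ _).1 h0, ?_⟩
    rw [Bool.or_eq_true] at h
    rcases h with h | h
    · exact Or.inl ((M9.beq_iff _ _).1 h)
    · right
      obtain ⟨u, h⟩ := anyV_spec h
      simp only [Bool.and_eq_true] at h
      obtain ⟨v, h⟩ := anyV_spec h.2.2
      simp only [Bool.and_eq_true] at h
      obtain ⟨w, h⟩ := anyV_spec h.2
      simp only [Bool.and_eq_true] at h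
      exact CJ_of_cert h.2
  · rw [if_neg h0] at h
    refine Or.inr ⟨fun h' => h0 ((M9.beq_iff _ _).2 h'), ?_⟩
    rw [Bool.or_eq_true] at h
    rcases h with h | h
    · exact Or.inl (cyc_spec h)
    · right
      rw [Bool.and_eq_true, T.beq_iff] at h
      refine ⟨h.1, ?_⟩
      obtain ⟨w, h⟩ := anyV_spec h.2
      simp only [Bool.and_eq_true] at h
      obtain ⟨v, h⟩ := anyV_spec h.2
      simp only [Bool.and_eq_true] at h
      exact CJ_of_cert h.2

/-- the four kinds of elements of order thirteen -/
def CJ13 (x : G) : Prop :=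
  CJ x (compM .z .t) ∨ CJ x (compM .o .t) ∨ CJ x (compM .t .z) ∨ CJ x (compM .t .o)

theorem kind_two {x : G} (h1 : (cm x).tr = (cm x).e2) (h2 : (cm x).mul (cm x) ≠ M9.one) :
    CJ x r3A ∨ CJ x (compM .z .z) ∨ CJ x r4 ∨ CJ x (compM .t .t) := by
  rcases conj_main x with ⟨h, -⟩ | ⟨-, h | ⟨-, h⟩⟩
  · exact absurd h h2
  · rw [← h1] at h
    cases ht : (cm x).tr
    · rw [ht] at h; exact Or.inr (Or.inl h)
    · rw [ht] at h
      refine Or.inr (Or.inr (Or.inl ?_))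
      exact h.trans (g := ⟨.o, .o, .o, .z, .o, .z, .o, .o, .t⟩) (by decide +kernel)
    · rw [ht] at h; exact Or.inr (Or.inr (Or.inr h))
  · exact Or.inl h

/-- the inverse of `r8` -/
def r8i : M9 := ⟨.t, .z, .z, .z, .z, .o, .z, .o, .t⟩

theorem inv_kind (x : G) (h2 : (cm x).mul (cm x) = M9.one) : (cm x).tr = (cm x).e2 := by
  by_contra h
  have h3 := allS_spec (F := fun m => !(M9.beq (m.mul m) M9.one) || m.tr.beq m.e2)
    (by decide +kernel) (cm x) (cm_det x)
  simp only [Bool.or_eq_true, T.beq_iff, Bool.not_eq_true', ← Bool.not_eq_true, M9.beq_iff] at h3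
  tauto

theorem kind_twelve {x : G} (h1 : (cm x).tr ≠ (cm x).e2) :
    CJ x r8 ∨ CJ x r8i ∨ CJ13 x := by
  rcases conj_main x with ⟨h, -⟩ | ⟨-, h | ⟨h, -⟩⟩
  · exact absurd (inv_kind x h) h1
  · unfold CJ13
    have ha : cert (compM .z .o) r8 ⟨.o, .z, .o, .o, .o, .o, .t, .o, .z⟩ = true := by decide +kernel
    have hb : cert (compM .o .z) r8i ⟨.o, .o, .z, .t, .o, .o, .t, .z, .o⟩ = true := by
      decide +kernel
    cases ht : (cm x).tr <;> cases hs : (cm x).e2 <;> rw [ht, hs] at h <;>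
      first
      | (exfalso; rw [ht, hs] at h1; exact h1 rfl)
      | exact Or.inl (h.trans ha)
      | exact Or.inr (Or.inl (h.trans hb))
      | tauto
  · exact absurd h h1

theorem all_kinds (x : G) : cm x = M9.one ∨ CJ x r2 ∨ CJ x r3A ∨ CJ x (compM .z .z) ∨ CJ x r4 ∨
    CJ x (compM .t .t) ∨ CJ x r8 ∨ CJ x r8i ∨ CJ13 x := by
  by_cases h1 : (cm x).tr = (cm x).e2
  · by_cases h2 : (cm x).mul (cm x) = M9.one
    · rcases conj_main x with ⟨-, h⟩ | ⟨h, -⟩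
      · tauto
      · exact absurd h2 h
    · have := kind_two h1 h2
      tauto
  · have := kind_twelve h1
    tauto

/-! ## Some solvable subgroups -/

section chain
variable {H : Type*} [Group H]

/-- a multiplicatively closed subset of a finite group is a subgroup -/
def subOf [Finite H] (P : H → Prop) (h1 : P 1) (hm : ∀ x y, P x → P y → P (x * y)) :
    Subgroup H where
  carrier := {x | P x}
  one_mem' := h1
  mul_mem' := fun {x y} hx hy => hm x y hx hy
  inv_mem' := by
    intro x hx
    have hp : ∀ n : ℕ, P (x ^ n) := by
      intro n
      induction n with
      | zero => simpa using h1
      | succ k ih => rw [pow_succ]; exact hm _ _ ih hx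
    have h2 : x⁻¹ = x ^ (orderOf x - 1) := by
      rw [inv_eq_iff_mul_eq_one, ← pow_succ', Nat.sub_add_cancel (orderOf_pos x),
        pow_orderOf_eq_one]
    change P x⁻¹
    rw [h2]
    exact hp _

theorem mem_subOf [Finite H] {P : H → Prop} {h1 : P 1} {hm : ∀ x y, P x → P y → P (x * y)}
    {x : H} : x ∈ subOf P h1 hm ↔ P x := Iff.rfl

theorem solv_step {A B : Subgroup H} (hB : Group.IsSolvable B)
    (hc : ∀ x ∈ A, ∀ y ∈ A, x * y * (y * x)⁻¹ ∈ B) : Group.IsSolvable A := by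
  have h1 : (commutator A).map A.subtype ≤ B := by
    rw [commutator_def, Subgroup.map_commutator, Subgroup.commutator_le]
    rintro _ ⟨x, -, rfl⟩ _ ⟨y, -, rfl⟩
    have := hc x x.2 y y.2
    rw [commutatorElement_def]
    simpa [mul_assoc] using this
  have h2 : Group.IsSolvable ((commutator A).map A.subtype) := solvable_le h1 hB
  have h3 : Group.IsSolvable (commutator A) := by
    have := ((commutator A).equivMapOfInjective A.subtype A.subtype_injective)
    exact solvable_of_solvable_injective (f := this.toMonoidHom) this.injective
  refine solvable_of_ker_le_range (commutator A).subtype (Abelianization.of (G := A)) ?_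
  rw [Abelianization.ker_of, Subgroup.range_subtype]

theorem solv_bot : Group.IsSolvable (⊥ : Subgroup H) := inferInstance
end chain

theorem memM_iff (m : M9) (L : List M9) : memM m L = true ↔ m ∈ L := by
  induction L with
  | nil => simp [memM]
  | cons a L ih => simp [memM, ih, M9.beq_iff]

theorem pairB_spec {f : M9 → M9 → Bool} {L K : List M9} (h : pairB f L K = true) {a b : M9}
    (ha : a ∈ K) (hb : b ∈ L) : f a b = true := by
  induction K with
  | nil => simp at ha
  | cons k K ih =>
    simp only [pairB, Bool.and_eq_true, List.all_eq_true] at h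
    rcases List.mem_cons.1 ha with rfl | ha
    · exact h.1 b hb
    · exact ih h.2 ha

theorem quoB_spec {u v : M9} {L : List M9} (h : quoB u v L = true) : ∃ c ∈ L, u = c.mul v := by
  induction L with
  | nil => simp [quoB] at h
  | cons k K ih =>
    simp only [quoB, Bool.or_eq_true, M9.beq_iff] at h
    rcases h with h | h
    · exact ⟨k, by simp, h⟩
    · obtain ⟨c, hc, e⟩ := ih h
      exact ⟨c, by simp [hc], e⟩

/-- the subgroup with codes in a list -/
def lsub (L K : List M9) (h1 : M9.one ∈ L)
    (h : pairB (fun a b => memM (a.mul b) L && quoB (a.mul b) (b.mul a) K) L L = true) :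
    Subgroup G :=
  subOf (fun x => cm x ∈ L) (by rw [cm_one]; exact h1) (fun x y hx hy => by
    have := pairB_spec h hx hy
    simp only [Bool.and_eq_true, memM_iff] at this
    rw [cm_mul]
    exact this.1)

theorem lsub_solv {L K : List M9} {h1 : M9.one ∈ L}
    {h : pairB (fun a b => memM (a.mul b) L && quoB (a.mul b) (b.mul a) K) L L = true}
    {B : Subgroup G} (hB : Group.IsSolvable B) (hK : ∀ x : G, cm x ∈ K → x ∈ B) :
    Group.IsSolvable (lsub L K h1 h) := by
  refine solv_step hB fun x hx y hy => ?_
  have hx' : cm x ∈ L := hx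
  have hy' : cm y ∈ L := hy
  have := pairB_spec h hx' hy'
  simp only [Bool.and_eq_true] at this
  obtain ⟨c, hc, e⟩ := quoB_spec this.2
  have e : cm (x * y) = c.mul (cm (y * x)) := by rw [cm_mul, cm_mul]; exact e
  apply hK
  have h2 : cm (x * y * (y * x)⁻¹) = c := by
    rw [cm_mul, e, mul_assoc9, ← cm_mul, mul_inv_cancel, cm_one, mul_one9]
  rw [h2]
  exact hc

theorem one_mem_aux {L : List M9} (h : memM M9.one L = true) : M9.one ∈ L := (memM_iff _ _).1 h

theorem s0_solv : Group.IsSolvable (lsub s0 s1 (one_mem_aux (by decide +kernel)) s0_check) := by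
  refine lsub_solv (B := lsub s1 s2 (one_mem_aux (by decide +kernel)) s1_check) ?_
    (fun x hx => hx)
  refine lsub_solv (B := lsub s2 [M9.one] (one_mem_aux (by decide +kernel)) s2_check) ?_
    (fun x hx => hx)
  refine lsub_solv (B := ⊥) solv_bot ?_
  intro x hx
  rw [List.mem_singleton, ← cm_one] at hx
  rw [cm_inj hx]
  exact one_mem _

theorem R_s0 {p q : M9} (hp : p.det = .o) (hq : q.det = .o) (h1 : memM p s0 = true)
    (h2 : memM q s0 = true) : R (mk p hp) (mk q hq) := by
  refine R_of_mem s0_solv ?_ ?_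
  · change cm _ ∈ s0
    rw [cm_mk]
    exact (memM_iff _ _).1 h1
  · change cm _ ∈ s0
    rw [cm_mk]
    exact (memM_iff _ _).1 h2

/-! ### Parabolic subgroups -/

theorem two_check1 : ∀ a b c d a' b' c' d' : ZMod 3, a * d - b * c = 1 → a' * d' - b' * c' = 1 →
    (a + d = 0 ∨ (b = 0 ∧ c = 0)) → (a' + d' = 0 ∨ (b' = 0 ∧ c' = 0)) →
    ((a * a' + b * c') + (c * b' + d * d') = 0 ∨
      (a * b' + b * d' = 0 ∧ c * a' + d * c' = 0)) := by decide +kernel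


/-- entries of a commutator -/
theorem two_check2 : ∀ a b c d a' b' c' d' : ZMod 3, a * d - b * c = 1 → a' * d' - b' * c' = 1 →
    ((a * a' + b * c') * (c' * b + d' * d) - (a * b' + b * d') * (c' * a + d' * c) +
     ((c * b' + d * d') * (a' * a + b' * c) - (c * a' + d * c') * (a' * b + b' * d)) = 0 ∨
     ((a * b' + b * d') * (a' * a + b' * c) - (a * a' + b * c') * (a' * b + b' * d) = 0 ∧
      (c * a' + d * c') * (c' * b + d' * d) - (c * b' + d * d') * (c' * a + d' * c) = 0)) := by
  decide +kernel

set_option synthInstance.maxHeartbeats 400000 in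
set_option synthInstance.maxSize 1000 in
theorem two_check3 : ∀ a b c d a' b' c' d' : ZMod 3, a * d - b * c = 1 → a' * d' - b' * c' = 1 →
    (a + d = 0 ∨ (b = 0 ∧ c = 0)) → (a' + d' = 0 ∨ (b' = 0 ∧ c' = 0)) →
     ((a * b' + b * d') * (a' * a + b' * c) - (a * a' + b * c') * (a' * b + b' * d) = 0 ∧
      (c * a' + d * c') * (c' * b + d' * d) - (c * b' + d * d') * (c' * a + d' * c) = 0) := by
  decide +kernel

/-- the special linear group in dimension two -/
abbrev S2 := Matrix.SpecialLinearGroup (Fin 2) (ZMod 3)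

theorem S2_det (x : S2) : x.1 0 0 * x.1 1 1 - x.1 0 1 * x.1 1 0 = 1 := by
  have := x.2
  rwa [Matrix.det_fin_two] at this

theorem S2_mul (x y : S2) (i j : Fin 2) :
    (x * y).1 i j = x.1 i 0 * y.1 0 j + x.1 i 1 * y.1 1 j := by
  change (x.1 * y.1) i j = _
  rw [Matrix.mul_apply, Fin.sum_univ_two]

theorem S2_inv (x : S2) : (x⁻¹).1 = !![x.1 1 1, -x.1 0 1; -x.1 1 0, x.1 0 0] := by
  change x.1.adjugate = _
  exact Matrix.adjugate_fin_two x.1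

/-- the quaternion subgroup -/
noncomputable def q8 : Subgroup S2 :=
  subOf (fun x => x.1 0 0 + x.1 1 1 = 0 ∨ (x.1 0 1 = 0 ∧ x.1 1 0 = 0)) (by right; decide)
    (fun x y hx hy => by
      rw [S2_mul, S2_mul, S2_mul, S2_mul]
      exact two_check1 _ _ _ _ _ _ _ _ (S2_det x) (S2_det y) hx hy)

/-- the diagonal subgroup -/
noncomputable def d2 : Subgroup S2 :=
  subOf (fun x => x.1 0 1 = 0 ∧ x.1 1 0 = 0) (by decide)
    (fun x y hx hy => by
      rw [S2_mul, S2_mul, hx.1, hx.2, hy.1, hy.2]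
      simp)

theorem S2_solv : Group.IsSolvable S2 := by
  have hd : Group.IsSolvable d2 := by
    refine solv_step solv_bot fun x hx y hy => ?_
    have hx := mem_subOf.1 hx
    have hy := mem_subOf.1 hy
    rw [Subgroup.mem_bot, mul_inv_eq_one]
    apply Subtype.ext
    ext i j
    rw [S2_mul, S2_mul]
    fin_cases i <;> fin_cases j <;> simp [hx.1, hx.2, hy.1, hy.2, mul_comm]
  have hq : Group.IsSolvable q8 := by
    refine solv_step hd fun x hx y hy => ?_
    have hx' : x.1 0 0 + x.1 1 1 = 0 ∨ (x.1 0 1 = 0 ∧ x.1 1 0 = 0) := hx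
    have hy' : y.1 0 0 + y.1 1 1 = 0 ∨ (y.1 0 1 = 0 ∧ y.1 1 0 = 0) := hy
    have h := two_check3 _ _ _ _ _ _ _ _ (S2_det x) (S2_det y) hx' hy'
    refine mem_subOf.2 ⟨?_, ?_⟩
    · rw [← h.1, S2_mul, S2_inv]
      simp [S2_mul]
      ring
    · rw [← h.2, S2_mul, S2_inv]
      simp [S2_mul]
      ring
  have ht : Group.IsSolvable (⊤ : Subgroup S2) := by
    refine solv_step hq fun x _ y _ => ?_
    have h := two_check2 _ _ _ _ _ _ _ _ (S2_det x) (S2_det y)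
    refine mem_subOf.2 ?_
    convert h using 1
    · simp only [S2_mul, S2_inv]
      simp
      ring_nf
    · simp only [S2_mul, S2_inv]
      simp
      ring_nf
  exact solvable_of_solvable_injective (f := (Subgroup.topEquiv (G := S2)).symm.toMonoidHom)
    (Subgroup.topEquiv (G := S2)).symm.injective

theorem GL2_solv : Group.IsSolvable (Matrix.GeneralLinearGroup (Fin 2) (ZMod 3)) := by
  haveI := S2_solv
  refine solvable_of_ker_le_range (Matrix.SpecialLinearGroup.toGL (n := Fin 2) (R := ZMod 3))
    (Matrix.GeneralLinearGroup.det (n := Fin 2) (R := ZMod 3)) ?_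
  intro x hx
  rw [MonoidHom.mem_ker] at hx
  have : x.1.det = 1 := congrArg Units.val hx
  exact ⟨⟨x.1, this⟩, Units.ext rfl⟩

theorem G_mul (x y : G) (i j : Fin 3) :
    (x * y).1 i j = x.1 i 0 * y.1 0 j + x.1 i 1 * y.1 1 j + x.1 i 2 * y.1 2 j := by
  change (x.1 * y.1) i j = _
  rw [Matrix.mul_apply, Fin.sum_univ_three]

theorem G_det (x : G) :
    x.1 0 0 * x.1 1 1 * x.1 2 2 - x.1 0 0 * x.1 1 2 * x.1 2 1 - x.1 0 1 * x.1 1 0 * x.1 2 2 +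
    x.1 0 1 * x.1 1 2 * x.1 2 0 + x.1 0 2 * x.1 1 0 * x.1 2 1 - x.1 0 2 * x.1 1 1 * x.1 2 0 = 1 := by
  have := x.2
  rwa [Matrix.det_fin_three] at this

/-- the lower right block -/
def blk (x : G) : Matrix (Fin 2) (Fin 2) (ZMod 3) := !![x.1 1 1, x.1 1 2; x.1 2 1, x.1 2 2]

theorem solv_of_blk (A : Subgroup G) (hm : ∀ x ∈ A, ∀ y ∈ A, blk (x * y) = blk x * blk y)
    (hk : ∀ x ∈ A, ∀ y ∈ A, blk x = 1 → blk y = 1 → x * y = y * x) : Group.IsSolvable A := by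
  let f : A →* Matrix (Fin 2) (Fin 2) (ZMod 3) :=
    { toFun := fun x => blk x
      map_one' := by
        ext i j
        fin_cases i <;> fin_cases j <;> rfl
      map_mul' := fun x y => hm x x.2 y y.2 }
  haveI := GL2_solv
  have hc : Group.IsSolvable (f.toHomUnits.ker) := by
    have : ∀ x y : f.toHomUnits.ker, x * y = y * x := by
      rintro ⟨⟨x, hx⟩, hx'⟩ ⟨⟨y, hy⟩, hy'⟩
      apply Subtype.ext
      apply Subtype.ext
      refine hk x hx y hy ?_ ?_
      · exact congrArg Units.val (MonoidHom.mem_ker.1 hx')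
      · exact congrArg Units.val (MonoidHom.mem_ker.1 hy')
    exact isSolvable_of_comm this
  exact solvable_of_ker_le_range (G'' := Matrix.GeneralLinearGroup (Fin 2) (ZMod 3))
    (f.toHomUnits.ker).subtype f.toHomUnits
    (by rw [Subgroup.range_subtype])

/-- stabilizer of a point -/
noncomputable def P1 : Subgroup G :=
  subOf (fun x => x.1 1 0 = 0 ∧ x.1 2 0 = 0) (by decide) (fun x y hx hy => by
    rw [G_mul, G_mul, hx.1, hx.2, hy.1, hy.2]
    simp)

/-- stabilizer of a line -/
noncomputable def L1 : Subgroup G :=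
  subOf (fun x => x.1 0 1 = 0 ∧ x.1 0 2 = 0) (by decide) (fun x y hx hy => by
    rw [G_mul, G_mul, hx.1, hx.2, hy.1, hy.2]
    simp)

theorem blk_one {x : G} (h : blk x = 1) :
    x.1 1 1 = 1 ∧ x.1 1 2 = 0 ∧ x.1 2 1 = 0 ∧ x.1 2 2 = 1 :=
  ⟨congrFun (congrFun h 0) 0, congrFun (congrFun h 0) 1, congrFun (congrFun h 1) 0,
    congrFun (congrFun h 1) 1⟩

theorem P1_solv : Group.IsSolvable P1 := by
  refine solv_of_blk _ ?_ ?_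
  · intro x hx y hy
    have hx := mem_subOf.1 hx
    have hy := mem_subOf.1 hy
    ext i j
    fin_cases i <;> fin_cases j <;>
      simp [blk, G_mul, hx.1, hx.2, hy.1, hy.2]
  · intro x hx y hy bx bby
    have hx := mem_subOf.1 hx
    have hy := mem_subOf.1 hy
    obtain ⟨x1, x2, x3, x4⟩ := blk_one bx
    obtain ⟨y1, y2, y3, y4⟩ := blk_one bby
    have dx := G_det x
    have dy := G_det y
    simp [hx.1, hx.2, x1, x2, x3, x4] at dx
    simp [hy.1, hy.2, y1, y2, y3, y4] at dy
    apply Subtype.ext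
    ext i j
    rw [G_mul, G_mul]
    fin_cases i <;> fin_cases j <;>
      simp [hx.1, hx.2, hy.1, hy.2, x1, x2, x3, x4, y1, y2, y3, y4, dx, dy, add_comm]

theorem L1_solv : Group.IsSolvable L1 := by
  refine solv_of_blk _ ?_ ?_
  · intro x hx y hy
    have hx := mem_subOf.1 hx
    have hy := mem_subOf.1 hy
    ext i j
    fin_cases i <;> fin_cases j <;>
      simp [blk, G_mul, hx.1, hx.2, hy.1, hy.2]
  · intro x hx y hy bx bby
    have hx := mem_subOf.1 hx
    have hy := mem_subOf.1 hy
    obtain ⟨x1, x2, x3, x4⟩ := blk_one bx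
    obtain ⟨y1, y2, y3, y4⟩ := blk_one bby
    have dx := G_det x
    have dy := G_det y
    simp [hx.1, hx.2, x1, x2, x3, x4] at dx
    simp [hy.1, hy.2, y1, y2, y3, y4] at dy
    apply Subtype.ext
    ext i j
    rw [G_mul, G_mul]
    fin_cases i <;> fin_cases j <;>
      simp [hx.1, hx.2, hy.1, hy.2, x1, x2, x3, x4, y1, y2, y3, y4, dx, dy, add_comm]

/-! ## The structure of solvable subgroups -/

/-- the natural module -/
abbrev V := Fin 3 → ZMod 3

instance actG : MulAction G V where
  smul x v := x.1.mulVec v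
  one_smul v := Matrix.one_mulVec v
  mul_smul x y v := by
    change (x.1 * y.1).mulVec v = _
    rw [← Matrix.mulVec_mulVec]
    rfl

theorem smul_def9 (x : G) (v : V) : x • v = x.1.mulVec v := rfl
theorem g_add (x : G) (v w : V) : x • (v + w) = x • v + x • w := Matrix.mulVec_add _ _ _
theorem g_neg (x : G) (v : V) : x • (-v) = -(x • v) := Matrix.mulVec_neg _ _
theorem g_zero (x : G) : x • (0 : V) = 0 := Matrix.mulVec_zero _
theorem g_smul (x : G) (c : ZMod 3) (v : V) : x • (c • v) = c • (x • v) := Matrix.mulVec_smul _ _ _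
theorem g_eq_zero {x : G} {v : V} (h : x • v = 0) : v = 0 := by
  have := congrArg (fun w => x⁻¹ • w) h
  simpa [g_zero] using this

theorem g_act_iff (x : G) (v w : V) : x • v = w ↔ (cm x).app (cv v) = cv w := act_iff x v w

theorem cv_zero_iff (v : V) : cv v = z3 ↔ v = 0 := by
  have : (z3).toVec = 0 := by
    ext i
    fin_cases i <;> rfl
  rw [← this]
  exact ⟨fun h => by rw [← h, toVec_cv], fun h => by rw [h, cv_toVec]⟩

/-- powers of codes -/
def pw (m : M9) : Nat → M9
  | 0 => M9.one
  | n + 1 => (pw m n).mul m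

theorem cm_pow (x : G) (n : ℕ) : cm (x ^ n) = pw (cm x) n := by
  induction n with
  | zero => rw [pow_zero, cm_one]; rfl
  | succ n ih => rw [pow_succ, cm_mul, ih]; rfl

theorem CJ_pow {x : G} {r : M9} (n : ℕ) (h : CJ x r) (hd : r.det = .o)
    (hn : M9.beq (pw r n) M9.one = true) : x ^ n = 1 := by
  obtain ⟨g, rfl⟩ := h.eq hd
  rw [conj_pow]
  have : (mk r hd) ^ n = 1 := by
    apply cm_inj
    rw [cm_pow, cm_mk, cm_one]
    exact (M9.beq_iff _ _).1 hn
  rw [this, mul_one, mul_inv_cancel]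

theorem CJ13.pow {x : G} (h : CJ13 x) : x ^ 13 = 1 := by
  rcases h with h | h | h | h <;> exact CJ_pow 13 h rfl (by decide +kernel)

theorem pow_cases (x : G) : x ^ 24 = 1 ∨ CJ13 x := by
  rcases all_kinds x with h | h | h | h | h | h | h | h | h
  · left
    rw [← cm_one] at h
    rw [cm_inj h, one_pow]
  · exact Or.inl (CJ_pow 24 h rfl (by decide +kernel))
  · exact Or.inl (CJ_pow 24 h rfl (by decide +kernel))
  · exact Or.inl (CJ_pow 24 h rfl (by decide +kernel))
  · exact Or.inl (CJ_pow 24 h rfl (by decide +kernel))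
  · exact Or.inl (CJ_pow 24 h rfl (by decide +kernel))
  · exact Or.inl (CJ_pow 24 h rfl (by decide +kernel))
  · exact Or.inl (CJ_pow 24 h rfl (by decide +kernel))
  · exact Or.inr h

theorem eq_one_of_pows {x : G} {m n : ℕ} (h1 : x ^ m = 1) (h2 : x ^ n = 1)
    (h : Nat.Coprime m n) : x = 1 := by
  have h3 := Nat.dvd_gcd (orderOf_dvd_of_pow_eq_one h1) (orderOf_dvd_of_pow_eq_one h2)
  rw [h.gcd_eq_one, Nat.dvd_one, orderOf_eq_one_iff] at h3
  exact h3

theorem CJ13_of_pow {x : G} (h : x ^ 13 = 1) (h1 : x ≠ 1) : CJ13 x := by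
  rcases pow_cases x with h2 | h2
  · exact absurd (eq_one_of_pows h2 h (by norm_num)) h1
  · exact h2

theorem powB_spec {m c : M9} {n k : ℕ} (h : powB m c n (pw c k) = true) : ∃ j, m = pw c j := by
  induction n generalizing k with
  | zero => simp [powB] at h
  | succ n ih =>
    simp only [powB, Bool.or_eq_true, M9.beq_iff] at h
    rcases h with h | h
    · exact ⟨k, h⟩
    · exact ih (k := k + 1) h

theorem cenB_spec {x y : G} (h : cenB (cm x) (cm y) = true) (hc : y * x = x * y) :
    y ∈ Subgroup.zpowers x := by
  unfold cenB at h
  rw [Bool.or_eq_true] at h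
  rcases h with h | h
  · rw [Bool.not_eq_true', ← Bool.not_eq_true, M9.beq_iff, ← cm_mul, ← cm_mul, hc] at h
    exact absurd rfl h
  · obtain ⟨j, hj⟩ := powB_spec (k := 0) h
    rw [← cm_pow] at hj
    rw [cm_inj hj]
    exact Subgroup.npow_mem_zpowers x j

theorem cen13 {x y : G} (hx : CJ13 x) (hc : y * x = x * y) : y ∈ Subgroup.zpowers x := by
  have key : ∀ (r : M9) (hd : r.det = .o), CJ x r →
      (∀ m : M9, m.det = .o → cenB r m = true) → y ∈ Subgroup.zpowers x := by
    intro r hd h hr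
    obtain ⟨g, hg⟩ := h.eq hd
    have h1 : g⁻¹ * y * g ∈ Subgroup.zpowers (mk r hd) := by
      apply cenB_spec
      · rw [cm_mk]
        exact hr _ (cm_det _)
      · have e : mk r hd = g⁻¹ * x * g := by rw [hg]; group
        rw [e]
        calc g⁻¹ * y * g * (g⁻¹ * x * g) = g⁻¹ * (y * x) * g := by group
          _ = g⁻¹ * (x * y) * g := by rw [hc]
          _ = _ := by group
    obtain ⟨k, hk⟩ := Subgroup.mem_zpowers_iff.1 h1
    refine Subgroup.mem_zpowers_iff.2 ⟨k, ?_⟩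
    rw [hg, conj_zpow, hk]
    group
  have h0 := fun m hm => allS_spec cen_check m hm
  simp only [Bool.and_eq_true] at h0
  rcases hx with h | h | h | h
  · exact key _ rfl h fun m hm => (h0 m hm).1
  · exact key _ rfl h fun m hm => (h0 m hm).2.1
  · exact key _ rfl h fun m hm => (h0 m hm).2.2.1
  · exact key _ rfl h fun m hm => (h0 m hm).2.2.2

/-- a solvable nontrivial subgroup has a nontrivial abelian normal subgroup -/
theorem exists_abelian {K : Type*} [Group K] (H : Subgroup K) (hs : Group.IsSolvable H)
    (hne : H ≠ ⊥) :
    ∃ A : Subgroup K, A ≠ ⊥ ∧ (∀ x ∈ A, ∀ y ∈ A, x * y = y * x) ∧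
      ∀ h ∈ H, ∀ x ∈ A, h * x * h⁻¹ ∈ A := by
  classical
  obtain ⟨n, hn⟩ := hs.solvable
  have hex : ∃ n, derivedSeries H n = ⊥ := ⟨n, hn⟩
  obtain ⟨m, hm⟩ : ∃ m, Nat.find hex = m + 1 := by
    refine Nat.exists_eq_succ_of_ne_zero fun h0 => hne ?_
    have h1 := Nat.find_spec hex
    rw [h0, derivedSeries_zero] at h1
    rw [eq_bot_iff]
    intro x hx
    have : (⟨x, hx⟩ : H) ∈ (⊥ : Subgroup H) := by rw [← h1]; trivial
    rw [Subgroup.mem_bot] at this ⊢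
    exact congrArg Subtype.val this
  refine ⟨(derivedSeries H m).map H.subtype, ?_, ?_, ?_⟩
  · intro h
    rw [Subgroup.map_eq_bot_iff_of_injective _ H.subtype_injective] at h
    exact Nat.find_min hex (by omega) h
  · have h1 := Nat.find_spec hex
    rw [hm, derivedSeries_succ] at h1
    rintro _ ⟨x, hx, rfl⟩ _ ⟨y, hy, rfl⟩
    have h2 := Subgroup.commutator_mem_commutator hx hy
    rw [h1, Subgroup.mem_bot, commutatorElement_eq_one_iff_mul_comm] at h2
    rw [← map_mul, h2, map_mul]
  · rintro h hh _ ⟨x, hx, rfl⟩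
    exact ⟨⟨h, hh⟩ * x * ⟨h, hh⟩⁻¹,
      (derivedSeries_normal (G := H) m).conj_mem x hx ⟨h, hh⟩, by simp⟩

/-- the conclusion of the structure theorem -/
def STC (H : Subgroup G) : Prop :=
  (∃ S : Finset V, S.Nonempty ∧ 0 ∉ S ∧ S.card ≤ 6 ∧ ∀ h ∈ H, ∀ v ∈ S, h • v ∈ S) ∨
  (∃ w : V, w ≠ 0 ∧ ∀ h ∈ H, Matrix.vecMul w h.1 = w ∨ Matrix.vecMul w h.1 = -w) ∨
  (∃ a : G, a ^ 13 = 1 ∧ a ≠ 1 ∧ ∀ h ∈ H, h ^ 12 ∈ Subgroup.zpowers a)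

theorem case13 {H A : Subgroup G} (hA : ∀ x ∈ A, ∀ y ∈ A, x * y = y * x)
    (hn : ∀ h ∈ H, ∀ x ∈ A, h * x * h⁻¹ ∈ A) {a : G} (ha : a ∈ A) (h1 : a ≠ 1)
    (h13 : a ^ 13 = 1) : STC H := by
  refine Or.inr (Or.inr ⟨a, h13, h1, fun h hh => ?_⟩)
  have hc := CJ13_of_pow h13 h1
  have hz : h * a * h⁻¹ ∈ Subgroup.zpowers a := cen13 hc (hA _ (hn h hh a ha) a ha)
  obtain ⟨m, hm⟩ := Subgroup.mem_zpowers_iff.1 hz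
  have hk : ∀ k : ℕ, h ^ k * a * (h ^ k)⁻¹ = a ^ (m ^ k) := by
    intro k
    induction k with
    | zero => simp
    | succ k ih =>
      rw [pow_succ']
      calc h * h ^ k * a * (h * h ^ k)⁻¹ = h * (h ^ k * a * (h ^ k)⁻¹) * h⁻¹ := by group
        _ = (h * a * h⁻¹) ^ (m ^ k) := by rw [ih, conj_zpow]
        _ = _ := by rw [← hm, ← zpow_mul, pow_succ']
  have ho : orderOf a = 13 := by
    have := orderOf_dvd_of_pow_eq_one h13
    rcases (Nat.dvd_prime (by norm_num)).1 this with h | h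
    · exact absurd (orderOf_eq_one_iff.1 h) h1
    · exact h
  have hm0 : ¬ (13 : ℤ) ∣ m := by
    intro hd
    have h2 : a ^ m = 1 := by
      rw [← orderOf_dvd_iff_zpow_eq_one, ho]
      exact hd
    rw [h2] at hm
    have h3 : h * a = h := by
      have := mul_inv_eq_one.1 hm.symm
      exact this
    exact h1 (by simpa using h3)
  have hf : (13 : ℤ) ∣ m ^ 12 - 1 := by
    haveI : Fact (Nat.Prime 13) := ⟨by norm_num⟩
    have h2 : (m : ZMod 13) ≠ 0 := by
      intro h0
      exact hm0 ((ZMod.intCast_zmod_eq_zero_iff_dvd m 13).1 h0)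
    have h3 := ZMod.pow_card_sub_one_eq_one h2
    have := (ZMod.intCast_zmod_eq_zero_iff_dvd (m ^ 12 - 1) 13).1 (by
      push_cast
      rw [sub_eq_zero]
      exact h3)
    exact this
  have h12 := hk 12
  have h4 : a ^ (m ^ 12) = a := by
    have : a ^ (m ^ 12 - 1) = 1 := by
      rw [← orderOf_dvd_iff_zpow_eq_one, ho]
      exact hf
    rw [zpow_sub, zpow_one, mul_inv_eq_one] at this
    exact this
  rw [h4, mul_inv_eq_iff_eq_mul] at h12
  exact cen13 hc h12

/-- the module of fixed vectors -/
def fixW (A : Subgroup G) : Submodule (ZMod 3) V where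
  carrier := {v | ∀ a ∈ A, a • v = v}
  add_mem' := fun {v w} hv hw a ha => by rw [g_add, hv a ha, hw a ha]
  zero_mem' := fun a _ => g_zero a
  smul_mem' := fun c v hv a ha => by rw [g_smul, hv a ha]

theorem vecMul_dot (w : V) (x : G) (v : V) : Matrix.vecMul w x.1 ⬝ᵥ v = w ⬝ᵥ (x • v) :=
  (Matrix.dotProduct_mulVec w x.1 v).symm

theorem zmod_ne : ∀ c : ZMod 3, c ≠ 0 → c = 1 ∨ c = -1 := by decide

theorem case3 {H A : Subgroup G} (hA : ∀ x ∈ A, x ^ 3 = 1)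
    (hn : ∀ h ∈ H, ∀ x ∈ A, h * x * h⁻¹ ∈ A) (hne : A ≠ ⊥) : STC H := by
  classical
  have hst : ∀ h ∈ H, ∀ v ∈ fixW A, h • v ∈ fixW A := by
    intro h hh v hv a ha
    have h1 := hv _ (hn h⁻¹ (H.inv_mem hh) a ha)
    rw [inv_inv] at h1
    rw [← mul_smul, show a * h = h * (h⁻¹ * a * h) by group, mul_smul, h1]
  have hp : IsPGroup 3 A := by
    intro x
    refine ⟨1, ?_⟩
    apply Subtype.ext
    simpa using hA x x.2
  have hbot : fixW A ≠ ⊥ := by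
    have h0 : (0 : V) ∈ MulAction.fixedPoints A V := fun a => g_zero a.1
    obtain ⟨v, hv, hv0⟩ := hp.exists_fixed_point_of_prime_dvd_card_of_fixed_point V
      (by simp [Nat.card_eq_fintype_card]) h0
    intro hb
    have : v ∈ fixW A := fun a ha => hv ⟨a, ha⟩
    rw [hb, Submodule.mem_bot] at this
    exact hv0 this.symm
  have htop : fixW A ≠ ⊤ := by
    intro ht
    apply hne
    rw [eq_bot_iff]
    intro a ha
    rw [Subgroup.mem_bot]
    apply Subtype.ext
    have h1 : ∀ v : V, a.1.mulVec v = (1 : Matrix (Fin 3) (Fin 3) (ZMod 3)).mulVec v := by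
      intro v
      rw [Matrix.one_mulVec]
      have : v ∈ fixW A := by rw [ht]; trivial
      exact this a ha
    exact Matrix.ext_of_mulVec_single fun i => h1 _
  have hf : Module.finrank (ZMod 3) V = 3 := by simp
  have hlt := Submodule.finrank_lt htop
  rw [hf] at hlt
  have hpos : 0 < Module.finrank (ZMod 3) (fixW A) := by
    rw [Nat.pos_iff_ne_zero, Ne, Submodule.finrank_eq_zero]
    exact hbot
  obtain h1 | h2 : Module.finrank (ZMod 3) (fixW A) = 1 ∨ Module.finrank (ZMod 3) (fixW A) = 2 := by
    omega
  · left
    refine ⟨Finset.univ.filter fun v => v ∈ fixW A ∧ v ≠ 0, ?_, ?_, ?_, ?_⟩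
    · obtain ⟨v, hv, hv0⟩ := Submodule.exists_mem_ne_zero_of_ne_bot hbot
      exact ⟨v, by simp [hv, hv0]⟩
    · simp
    · have hc : Nat.card (fixW A) = 3 := by
        rw [Module.natCard_eq_pow_finrank (K := ZMod 3), h1]
        simp
      have h3 : (Finset.univ.filter fun v => v ∈ fixW A).card = 3 := by
        have h4 := Nat.card_eq_fintype_card (α := fixW A)
        rw [hc, Fintype.card_subtype] at h4
        exact h4.symm
      calc _ ≤ (Finset.univ.filter fun v => v ∈ fixW A).card := by
            apply Finset.card_le_card
            intro v
            simp
            tauto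
        _ ≤ 6 := by omega
    · intro h hh v hv
      simp at hv ⊢
      exact ⟨hst h hh v hv.1, fun h0 => hv.2 (g_eq_zero h0)⟩
  · right; left
    obtain ⟨φ, hφ0, hφ⟩ := Submodule.exists_le_ker_of_lt_top _ htop.lt_top
    have hker : fixW A = LinearMap.ker φ := by
      apply Submodule.eq_of_le_of_finrank_le hφ
      have h5 : LinearMap.ker φ ≠ ⊤ := by
        rw [Ne, LinearMap.ker_eq_top]
        exact hφ0
      have := Submodule.finrank_lt h5
      rw [hf] at this
      omega
    let w : V := fun i => φ (Pi.single i 1)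
    have hw : ∀ v, φ v = w ⬝ᵥ v := by
      intro v
      have h5 : v = ∑ i, v i • (Pi.single i 1 : V) := by
        ext j
        simp [Finset.sum_apply, Pi.single_apply]
      conv_lhs => rw [h5]
      rw [map_sum]
      simp only [map_smul, smul_eq_mul, dotProduct, w]
      exact Finset.sum_congr rfl fun i _ => mul_comm _ _
    have hw0 : w ≠ 0 := by
      intro h0
      apply hφ0
      refine LinearMap.ext fun v => ?_
      rw [hw, h0]
      simp
    refine ⟨w, hw0, fun h hh => ?_⟩
    obtain ⟨u, hu⟩ : ∃ u, φ u ≠ 0 := by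
      by_contra hc
      push Not at hc
      exact hφ0 (LinearMap.ext hc)
    obtain ⟨u, hu⟩ : ∃ u, φ u = 1 := ⟨(φ u)⁻¹ • u, by simp [hu]⟩
    have hc : ∀ v, φ (h • v) = φ (h • u) * φ v := by
      intro v
      have h6 : v - φ v • u ∈ fixW A := by
        rw [hker, LinearMap.mem_ker]
        simp [hu]
      have h7 := hst h hh _ h6
      rw [hker, LinearMap.mem_ker, sub_eq_add_neg, g_add, g_neg, g_smul] at h7
      simp only [map_add, map_neg, map_smul, smul_eq_mul] at h7
      linear_combination h7
    have hc0 : φ (h • u) ≠ 0 := by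
      intro h0
      have := hc (h⁻¹ • u)
      rw [smul_inv_smul, hu, h0, zero_mul] at this
      exact one_ne_zero this
    have hv : Matrix.vecMul w h.1 = φ (h • u) • w := by
      apply dotProduct_eq
      intro v
      rw [vecMul_dot, ← hw, hc, smul_dotProduct, ← hw, smul_eq_mul]
    rw [hv]
    rcases zmod_ne _ hc0 with h9 | h9 <;> rw [h9] <;> simp

theorem r2_det : r2.det = .o := rfl

theorem CJ_inv {a : G} (h2 : a * a = 1) (h1 : a ≠ 1) : CJ a r2 := by
  have h : (cm a).mul (cm a) = M9.one := by rw [← cm_mul, h2, cm_one]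
  rcases conj_main a with ⟨-, h | h⟩ | ⟨h', -⟩
  · rw [← cm_one] at h
    exact absurd (cm_inj h) h1
  · exact h
  · exact absurd h h'

theorem smul_conj_iff (g x : G) (v w : V) : (g * x * g⁻¹) • v = w ↔ x • (g⁻¹ • v) = g⁻¹ • w := by
  rw [mul_smul, mul_smul]
  exact smul_eq_iff_eq_inv_smul g

theorem fix_inv {a : G} (h2 : a * a = 1) (h1 : a ≠ 1) :
    ∃ u : V, u ≠ 0 ∧ a • u = u ∧ (∀ v, a • v = v → v = 0 ∨ v = u ∨ v = -u) ∧
      ∀ b : G, b * b = 1 → b * a = a * b → b • u = u → b = 1 ∨ b = a := by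
  obtain ⟨g, hg⟩ := (CJ_inv h2 h1).eq r2_det
  have hr : ∀ v : V, (mk r2 r2_det) • v = v → v = 0 ∨ v = e1.toVec ∨ v = -e1.toVec := by
    intro v hv
    rw [g_act_iff, cm_mk] at hv
    have h := allV_spec r2_check (cv v)
    simp only [Bool.or_eq_true, Bool.not_eq_true', ← Bool.not_eq_true, V3.beq_iff] at h
    rcases h with h | h | h | h
    · exact absurd hv h
    · exact Or.inl ((cv_zero_iff v).1 h)
    · right; left; rw [← h, toVec_cv]
    · right; right; rw [← toVec_neg, ← h, toVec_cv]
  refine ⟨g • e1.toVec, ?_, ?_, ?_, ?_⟩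
  · intro h
    have := g_eq_zero h
    have h3 := congrFun this 0
    exact absurd h3 (by decide)
  · rw [hg, smul_conj_iff, inv_smul_smul, g_act_iff, cm_mk, cv_toVec]
    rfl
  · intro v hv
    rw [hg, smul_conj_iff] at hv
    rcases hr _ hv with h | h | h
    · exact Or.inl (g_eq_zero h)
    · right; left; exact inv_smul_eq_iff.1 h
    · right; right
      rw [inv_smul_eq_iff.1 h, g_neg]
  · intro b hb hc hu
    have h := allS_spec inv_check (cm (g⁻¹ * b * g)) (cm_det _)
    have e : mk r2 r2_det = g⁻¹ * a * g := by rw [hg]; group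
    have f1 : (cm (g⁻¹ * b * g)).app e1 = e1 := by
      have : (g⁻¹ * b * g) • e1.toVec = e1.toVec := by
        rw [mul_smul, mul_smul, hu, inv_smul_smul]
      rwa [g_act_iff, cv_toVec] at this
    have f2 : (cm (g⁻¹ * b * g)).mul r2 = r2.mul (cm (g⁻¹ * b * g)) := by
      have e4 : g⁻¹ * b * g * (g⁻¹ * a * g) = (g⁻¹ * a * g) * (g⁻¹ * b * g) :=
        calc g⁻¹ * b * g * (g⁻¹ * a * g) = g⁻¹ * (b * a) * g := by group
        _ = g⁻¹ * (a * b) * g := by rw [hc]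
        _ = _ := by group
      rw [← e] at e4
      have e5 := congrArg cm e4
      rw [cm_mul, cm_mul _ (g⁻¹ * b * g), cm_mk] at e5
      exact e5
    have f3 : (cm (g⁻¹ * b * g)).mul (cm (g⁻¹ * b * g)) = M9.one := by
      have e4 : g⁻¹ * b * g * (g⁻¹ * b * g) = 1 :=
        calc g⁻¹ * b * g * (g⁻¹ * b * g) = g⁻¹ * (b * b) * g := by group
        _ = 1 := by rw [hb]; group
      have e5 := congrArg cm e4
      rw [cm_mul, cm_one] at e5
      exact e5
    simp only [Bool.or_eq_true, Bool.not_eq_true', ← Bool.not_eq_true, V3.beq_iff, M9.beq_iff] at h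
    rcases h with h | h | h | h | h
    · exact absurd f1 h
    · exact absurd f2 h
    · exact absurd f3 h
    · left
      rw [← cm_one] at h
      have := cm_inj h
      have e3 : b = g * (g⁻¹ * b * g) * g⁻¹ := by group
      rw [e3, this]
      group
    · right
      have := (eq_mk_iff _ _ r2_det).2 h
      have e3 : b = g * (g⁻¹ * b * g) * g⁻¹ := by group
      rw [e3, this, hg]

theorem case2 {H A : Subgroup G} (hA : ∀ x ∈ A, ∀ y ∈ A, x * y = y * x)
    (h2 : ∀ x ∈ A, x * x = 1)
    (hn : ∀ h ∈ H, ∀ x ∈ A, h * x * h⁻¹ ∈ A) (hne : A ≠ ⊥) : STC H := by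
  classical
  left
  let I := {a : G // a ∈ A ∧ a ≠ 1}
  have hex : ∀ a : I, _ := fun a => fix_inv (h2 a.1 a.2.1) a.2.2
  choose u hu0 hu1 hu2 hu3 using hex
  have hij : ∀ i j : I, i ≠ j → i.1 • u j = -u j := by
    intro i j hne
    have h3 : j.1 • (i.1 • u j) = i.1 • u j := by
      rw [← mul_smul, hA _ j.2.1 _ i.2.1, mul_smul, hu1]
    rcases hu2 j _ h3 with h | h | h
    · exact absurd (g_eq_zero h) (hu0 j)
    · rcases hu3 j i.1 (h2 _ i.2.1) (hA _ i.2.1 _ j.2.1) h with h | h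
      · exact absurd h i.2.2
      · exact absurd (Subtype.ext h) hne
    · exact h
  have hli : LinearIndependent (ZMod 3) u := by
    rw [Fintype.linearIndependent_iff]
    intro c hc j
    have h3 : ∑ i, c i • (u i + j.1 • u i) = 0 := by
      have h4 : j.1 • (∑ i, c i • u i) = ∑ i, c i • (j.1 • u i) := by
        have := map_sum (Matrix.mulVecLin j.1.1) (fun i => c i • u i) Finset.univ
        simp only [Matrix.mulVecLin_apply, Matrix.mulVec_smul] at this
        exact this
      simp only [smul_add, Finset.sum_add_distrib]
      rw [← h4, hc, g_zero, add_zero]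
    rw [Finset.sum_eq_single j] at h3
    · rw [hu1, smul_eq_zero] at h3
      rcases h3 with h3 | h3
      · exact h3
      · exfalso
        apply hu0 j
        ext i
        have h4 := congrFun h3 i
        simp only [Pi.add_apply, Pi.zero_apply] at h4 ⊢
        have : ∀ c : ZMod 3, c + c = 0 → c = 0 := by decide
        exact this _ h4
    · intro i _ hi
      rw [hij j i (Ne.symm hi)]
      simp
    · intro h
      exact absurd (Finset.mem_univ j) h
  have hcard : Fintype.card I ≤ 3 := by
    have := hli.fintype_card_le_finrank
    simpa using this
  refine ⟨Finset.univ.filter fun v : V => v ≠ 0 ∧ ∃ a ∈ A, a ≠ 1 ∧ a • v = v, ?_, ?_, ?_, ?_⟩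
  · obtain ⟨⟨a, ha⟩, ha1⟩ := (Subgroup.ne_bot_iff_exists_ne_one).1 hne
    have ha1 : a ≠ 1 := fun h => ha1 (Subtype.ext h)
    exact ⟨u ⟨a, ha, ha1⟩, by
      simp only [Finset.mem_filter, Finset.mem_univ, true_and]
      exact ⟨hu0 _, a, ha, ha1, hu1 ⟨a, ha, ha1⟩⟩⟩
  · simp
  · have hsub : (Finset.univ.filter fun v : V => v ≠ 0 ∧ ∃ a ∈ A, a ≠ 1 ∧ a • v = v) ⊆
        (Finset.univ : Finset I).biUnion fun i => {u i, -u i} := by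
      intro v hv
      simp only [Finset.mem_filter, Finset.mem_univ, true_and] at hv
      obtain ⟨hv0, a, ha, ha1, hav⟩ := hv
      simp only [Finset.mem_biUnion, Finset.mem_univ, true_and, Finset.mem_insert,
        Finset.mem_singleton]
      refine ⟨⟨a, ha, ha1⟩, ?_⟩
      have := hu2 ⟨a, ha, ha1⟩ v hav
      tauto
    refine (Finset.card_le_card hsub).trans ?_
    refine (Finset.card_biUnion_le_card_mul _ _ 2 fun i _ => Finset.card_le_two).trans ?_
    rw [Finset.card_univ]
    omega
  · intro h hh v hv
    simp only [Finset.mem_filter, Finset.mem_univ, true_and] at hv ⊢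
    obtain ⟨hv0, a, ha, ha1, hav⟩ := hv
    refine ⟨fun h0 => hv0 (g_eq_zero h0), h * a * h⁻¹, hn h hh a ha, ?_, ?_⟩
    · intro h1
      apply ha1
      have e : a = h⁻¹ * (h * a * h⁻¹) * h := by group
      rw [e, h1]
      group
    · rw [smul_conj_iff, inv_smul_smul, hav]

/-- the subgroup of elements of exponent `p` in a commutative subgroup -/
def torsSub (A : Subgroup G) (hA : ∀ x ∈ A, ∀ y ∈ A, x * y = y * x) (p : ℕ) : Subgroup G :=
  subOf (fun x => x ∈ A ∧ x ^ p = 1) ⟨A.one_mem, one_pow p⟩ (fun x y hx hy =>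
    ⟨A.mul_mem hx.1 hy.1, by
      rw [(show Commute x y from hA x hx.1 y hy.1).mul_pow, hx.2, hy.2, mul_one]⟩)

theorem ST {H : Subgroup G} (hs : Group.IsSolvable H) (hne : H ≠ ⊥) : STC H := by
  obtain ⟨A, hA0, hA, hn⟩ := exists_abelian H hs hne
  obtain ⟨⟨a, ha⟩, ha1⟩ := (Subgroup.ne_bot_iff_exists_ne_one).1 hA0
  have ha1 : a ≠ 1 := fun h => ha1 (Subtype.ext h)
  rcases pow_cases a with h | h
  · have hd := orderOf_dvd_of_pow_eq_one h
    have ho : orderOf a ≠ 1 := fun h => ha1 (orderOf_eq_one_iff.1 h)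
    have hp := Nat.minFac_prime ho
    have hpd : (orderOf a).minFac ∣ 24 := (Nat.minFac_dvd _).trans hd
    have hb := orderOf_pow_orderOf_div (orderOf_pos a).ne' (Nat.minFac_dvd (orderOf a))
    set p := (orderOf a).minFac
    set b := a ^ (orderOf a / p) with hbd
    have hbA : b ∈ A := A.pow_mem ha _
    have hb1 : b ≠ 1 := by
      intro h
      rw [h, orderOf_one] at hb
      exact hp.one_lt.ne hb
    have hbp : b ^ p = 1 := by rw [← hb, pow_orderOf_eq_one]
    have hnB : ∀ h ∈ H, ∀ x ∈ torsSub A hA p, h * x * h⁻¹ ∈ torsSub A hA p := by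
      intro h hh x hx
      refine ⟨hn h hh x hx.1, ?_⟩
      rw [conj_pow, hx.2]
      group
    have hB0 : torsSub A hA p ≠ ⊥ := by
      intro h
      have : b ∈ torsSub A hA p := ⟨hbA, hbp⟩
      rw [h, Subgroup.mem_bot] at this
      exact hb1 this
    have hp23 : p = 2 ∨ p = 3 := by
      have h24 : (24 : ℕ) = 2 ^ 3 * 3 := by norm_num
      rw [h24] at hpd
      rcases (Nat.Prime.dvd_mul hp).1 hpd with h | h
      · left
        exact (Nat.prime_dvd_prime_iff_eq hp Nat.prime_two).1 (hp.dvd_of_dvd_pow h)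
      · right
        exact (Nat.prime_dvd_prime_iff_eq hp Nat.prime_three).1 h
    rcases hp23 with hp2 | hp3
    · refine case2 (A := torsSub A hA p) (fun x hx y hy => hA x hx.1 y hy.1) ?_ hnB hB0
      intro x hx
      have := hx.2
      rw [hp2, pow_two] at this
      exact this
    · refine case3 (A := torsSub A hA p) ?_ hnB hB0
      intro x hx
      have := hx.2
      rw [hp3] at this
      exact this
  · exact case13 hA hn ha ha1 h.pow

/-! ## Criteria for solvability -/

theorem list_ins {S : Finset V} {v : V3} {L : List V3} (hn : L.Nodup)
    (hS : ∀ w ∈ L, w.toVec ∈ S) (hv : v.toVec ∈ S) :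
    (insV v L).Nodup ∧ ∀ w ∈ insV v L, w.toVec ∈ S := by
  have hm : memV v L = true ↔ v ∈ L := by
    clear hn hS
    induction L with
    | nil => simp [memV]
    | cons a L ih => simp [memV, ih, V3.beq_iff]
  have e : insV v L = if memV v L then L else v :: L := by
    simp only [insV, T.force_eq]
  rw [e]
  split_ifs with h
  · exact ⟨hn, hS⟩
  · refine ⟨List.nodup_cons.2 ⟨fun h' => h (hm.2 h'), hn⟩, ?_⟩
    intro w hw
    rcases List.mem_cons.1 hw with rfl | hw
    · exact hv
    · exact hS w hw

theorem app_mem {S : Finset V} {p : G} (hp : ∀ v ∈ S, p • v ∈ S) {w : V3} (hw : w.toVec ∈ S) :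
    ((cm p).app w).toVec ∈ S := by
  rw [toMat_app, toMat_cm]
  exact hp _ hw

theorem list_step {S : Finset V} {p q : G} (hp : ∀ v ∈ S, p • v ∈ S) (hq : ∀ v ∈ S, q • v ∈ S)
    (L acc : List V3) (hL : ∀ w ∈ L, w.toVec ∈ S) (hn : acc.Nodup)
    (hS : ∀ w ∈ acc, w.toVec ∈ S) :
    (stepV (cm p) (cm q) L acc).Nodup ∧ ∀ w ∈ stepV (cm p) (cm q) L acc, w.toVec ∈ S := by
  induction L generalizing acc with
  | nil => exact ⟨hn, hS⟩
  | cons v L ih =>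
    have hv := hL v (by simp)
    have h1 := list_ins hn hS (app_mem hq hv)
    have h2 := list_ins h1.1 h1.2 (app_mem hp hv)
    exact ih _ (fun w hw => hL w (by simp [hw])) h2.1 h2.2

theorem len7_spec {L : List V3} (h : len7 L = true) : 7 ≤ L.length := by
  unfold len7 at h
  split at h
  · simp only [List.length_cons]
    omega
  · simp at h

theorem orb_spec {S : Finset V} {p q : G} (hp : ∀ v ∈ S, p • v ∈ S) (hq : ∀ v ∈ S, q • v ∈ S)
    (n : ℕ) (L : List V3) (hn : L.Nodup) (hS : ∀ w ∈ L, w.toVec ∈ S)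
    (h : orbB (cm p) (cm q) n L = true) : 7 ≤ S.card := by
  have key : ∀ L : List V3, L.Nodup → (∀ w ∈ L, w.toVec ∈ S) → len7 L = true → 7 ≤ S.card := by
    intro L hn hS h
    refine (len7_spec h).trans ?_
    have h1 : (L.map V3.toVec).Nodup := hn.map fun a b hab => toVec_inj hab
    have h2 := List.toFinset_card_of_nodup h1
    rw [List.length_map] at h2
    rw [← h2]
    apply Finset.card_le_card
    intro v hv
    simp only [List.mem_toFinset, List.mem_map] at hv
    obtain ⟨w, hw, rfl⟩ := hv
    exact hS w hw
  induction n generalizing L with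
  | zero => exact key L hn hS h
  | succ n ih =>
    simp only [orbB, Bool.or_eq_true] at h
    rcases h with h | h
    · exact key L hn hS h
    · have h1 := list_step hp hq L L hS hn hS
      exact ih _ h1.1 h1.2 h

theorem ord8_spec {h : G} (h8 : ord8 (cm h) = true) : h ^ 4 ≠ 1 ∧ h ^ 8 = 1 := by
  have e4 : cm (h ^ 4) = ((cm h).mul (cm h)).mul ((cm h).mul (cm h)) := by
    rw [show h ^ 4 = h * h * (h * h) by simp only [pow_succ, pow_zero, one_mul, mul_assoc],
      cm_mul, cm_mul]
  have e8 : cm (h ^ 8) = (cm (h ^ 4)).mul (cm (h ^ 4)) := by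
    rw [← cm_mul, ← pow_add]
  simp only [ord8, Bool.and_eq_true, Bool.not_eq_true', ← Bool.not_eq_true, M9.beq_iff] at h8
  rw [← e4, ← e8] at h8
  exact ⟨fun h => h8.1 (by rw [h, cm_one]), cm_inj (by rw [h8.2, cm_one])⟩

theorem ord8_ne {h a : G} (h8 : ord8 (cm h) = true) (ha : a ^ 13 = 1)
    (hz : h ^ 12 ∈ Subgroup.zpowers a) : False := by
  obtain ⟨k, hk⟩ := Subgroup.mem_zpowers_iff.1 hz
  have h1 : h ^ 156 = 1 := by
    rw [show 156 = 12 * 13 from rfl, pow_mul, ← hk, ← zpow_natCast, ← zpow_mul, mul_comm, zpow_mul,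
      zpow_natCast, ha, one_zpow]
  obtain ⟨h4, h8⟩ := ord8_spec h8
  apply h4
  rw [← orderOf_dvd_iff_pow_eq_one]
  exact Nat.dvd_gcd (orderOf_dvd_of_pow_eq_one h1) (orderOf_dvd_of_pow_eq_one h8)

theorem word8_spec {p q : G} (h : word8 (cm p) (cm q) = true) :
    ∃ x ∈ Subgroup.closure {p, q}, ord8 (cm x) = true := by
  have hp := mem_left p q
  have hq := mem_right p q
  simp only [word8, ← cm_mul, Bool.or_eq_true] at h
  have m {a b : G} (ha : a ∈ Subgroup.closure {p, q}) (hb : b ∈ Subgroup.closure {p, q}) :=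
    mul_mem ha hb
  rcases h with h | h | h | h
  · exact ⟨_, m hp (m hq hq), h⟩
  · exact ⟨_, m hp hq, h⟩
  · exact ⟨_, m hp (m hp hq), h⟩
  · exact ⟨_, m (m (m hp hp) (m hq hp)) (m (m hq hp) (m hq hq)), h⟩

theorem ne_bot_of_ord8 {H : Subgroup G} {x : G} (hx : x ∈ H) (h : ord8 (cm x) = true) :
    H ≠ ⊥ := by
  rintro rfl
  rw [Subgroup.mem_bot] at hx
  apply (ord8_spec h).1
  rw [hx, one_pow]

theorem rap_iff (x : G) (w : V) :
    (Matrix.vecMul w x.1 = w ∨ Matrix.vecMul w x.1 = -w) ↔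
      (M9.rap (cv w) (cm x) = cv w ∨ M9.rap (cv w) (cm x) = (cv w).neg) := by
  rw [ract_iff, ract_iff, cv_neg]

theorem nonsolv_spec {p q : G} (h : nonsolv (cm p) (cm q) = true) : ¬ R p q := by
  intro hR
  simp only [nonsolv, Bool.and_eq_true] at h
  obtain ⟨hw, ho, hr⟩ := h
  obtain ⟨x, hx, h8⟩ := word8_spec hw
  rcases ST hR (ne_bot_of_ord8 hx h8) with ⟨S, ⟨v, hv⟩, h0, hc, hS⟩ | ⟨w, hw0, hw⟩ | ⟨a, ha, -, hz⟩
  · have h1 := allV_spec ho (cv v)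
    simp only [Bool.or_eq_true, V3.beq_iff, cv_zero_iff] at h1
    rcases h1 with h1 | h1
    · rw [h1] at hv
      exact h0 hv
    · have := orb_spec (hS p (mem_left p q)) (hS q (mem_right p q)) 6 [cv v] (by simp)
        (by simp [toVec_cv, hv]) h1
      omega
  · have h1 := allV_spec hr (cv w)
    have hp := (rap_iff p w).1 (hw p (mem_left p q))
    have hq := (rap_iff q w).1 (hw q (mem_right p q))
    simp only [Bool.or_eq_true, Bool.not_eq_true', ← Bool.not_eq_true, V3.beq_iff,
      cv_zero_iff] at h1
    tauto
  · exact ord8_ne h8 ha (hz x hx)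

/-- rows fixed by the elements of order eight -/
theorem t8_row_check : (allS fun m => !(t8 m) || allV fun w => !(V3.beq (M9.rap w m) w ||
    V3.beq (M9.rap w m) w.neg) || (V3.beq w z3 || (V3.beq w e1 || V3.beq w e1.neg))) = true := by
  decide +kernel

theorem app_mul (p q : M9) (v : V3) : (p.mul q).app v = p.app (q.app v) := by
  apply toVec_inj
  rw [toMat_app, toMat_app, toMat_app, toMat_mul, Matrix.mulVec_mulVec]

theorem rap_mul (p q : M9) (v : V3) : M9.rap v (p.mul q) = M9.rap (M9.rap v p) q := by
  apply toVec_inj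
  rw [toMat_rap, toMat_rap, toMat_rap, toMat_mul, Matrix.vecMul_vecMul]

theorem rap_neg (m : M9) (v : V3) : M9.rap v.neg m = (M9.rap v m).neg := by
  apply toVec_inj
  simp only [toMat_rap, toVec_neg, Matrix.neg_vecMul]

theorem neg_neg9 (v : V3) : v.neg.neg = v := by
  apply toVec_inj
  rw [toVec_neg, toVec_neg, neg_neg]

theorem app_e1 (m : M9) : m.app e1 = m.col := by
  apply toVec_inj
  rw [toMat_app]
  ext i
  fin_cases i <;>
    simp [M9.toMat, M9.col, V3.toVec, e1, T.toZ, Matrix.mulVec, dotProduct, Fin.sum_univ_three]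

theorem rap_e1 (m : M9) : M9.rap e1 m = m.row := by
  apply toVec_inj
  rw [toMat_rap]
  ext i
  fin_cases i <;>
    simp [M9.toMat, M9.row, V3.toVec, e1, T.toZ, Matrix.vecMul, dotProduct, Fin.sum_univ_three]

theorem fixB_iff (m : M9) (v w : V3) : fixB m v w = true ↔
    ((m.app v = v ∨ m.app v = v.neg) ∨ (M9.rap w m = w ∨ M9.rap w m = w.neg)) := by
  simp only [fixB, Bool.or_eq_true, V3.beq_iff]

theorem cm_ent (x : G) : x.1 1 0 = (cm x).d.toZ ∧ x.1 2 0 = (cm x).g.toZ ∧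
    x.1 0 1 = (cm x).b.toZ ∧ x.1 0 2 = (cm x).c.toZ := by
  rw [← toMat_cm x]
  exact ⟨rfl, rfl, rfl, rfl⟩

theorem mem_P1 {x : G} (hd : (cm x).d = .z) (hg : (cm x).g = .z) : x ∈ P1 := by
  obtain ⟨h1, h2, -, -⟩ := cm_ent x
  exact mem_subOf.2 ⟨by rw [h1, hd]; rfl, by rw [h2, hg]; rfl⟩

theorem mem_L1 {x : G} (hb : (cm x).b = .z) (hc : (cm x).c = .z) : x ∈ L1 := by
  obtain ⟨-, -, h1, h2⟩ := cm_ent x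
  exact mem_subOf.2 ⟨by rw [h1, hb]; rfl, by rw [h2, hc]; rfl⟩

/-- an element returning some vector of an invariant set of size at most six -/
theorem pigeon {S : Finset V} (hc : S.card ≤ 6) {y : G} (hy : ∀ v ∈ S, y • v ∈ S) {v : V}
    (hv : v ∈ S) : ∃ k, 1 ≤ k ∧ k ≤ 6 ∧ y ^ k • v = v := by
  have hm : ∀ k : ℕ, y ^ k • v ∈ S := by
    intro k
    induction k with
    | zero => simpa using hv
    | succ k ih => rw [pow_succ', mul_smul]; exact hy _ ih
  obtain ⟨i, hi, j, hj, hne, he⟩ := Finset.exists_ne_map_eq_of_card_lt_of_maps_to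
    (s := Finset.range 7) (t := S) (by simpa using Nat.lt_succ_of_le hc)
    (f := fun k => y ^ k • v) (fun k _ => hm k)
  simp only [Finset.mem_range] at hi hj
  have key : ∀ i j : ℕ, i < j → j < 7 → y ^ i • v = y ^ j • v →
      ∃ k, 1 ≤ k ∧ k ≤ 6 ∧ y ^ k • v = v := by
    intro i j hij hj he
    refine ⟨j - i, by omega, by omega, ?_⟩
    have h1 : y ^ j = y ^ i * y ^ (j - i) := by rw [← pow_add]; congr 1; omega
    rw [h1, mul_smul] at he
    exact (smul_left_cancel _ he).symm
  rcases Nat.lt_or_gt_of_ne hne with h | h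
  · exact key i j h hj he
  · exact key j i h hi he.symm

theorem orb8_spec {y : G} {v : V} (h : orb8 (cm y) (cv v) = true) {k : ℕ} (h1 : 1 ≤ k)
    (h6 : k ≤ 6) (hk : y ^ k • v = v) : v = 0 ∨ v = e1.toVec ∨ v = -e1.toVec := by
  have e : ∀ (w : V), (cm y).app (cv w) = cv (y • w) := fun w => (g_act_iff y w _).1 rfl
  simp only [orb8, e, ← mul_smul, ← pow_two, ← pow_succ', Bool.or_eq_true, Bool.not_eq_true',
    ← Bool.not_eq_true, V3.beq_iff] at h
  rcases h with h | h
  · rcases h with h | h | h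
    · exact Or.inl ((cv_zero_iff v).1 h)
    · right; left; rw [← h, toVec_cv]
    · right; right; rw [← toVec_neg, ← h, toVec_cv]
  · exfalso
    apply h
    have hk' : cv (y ^ k • v) = cv v := by rw [hk]
    interval_cases k
    · left; simpa using hk'
    · right; left; simpa [pow_succ', mul_assoc] using hk'
    · right; right; left; simpa [pow_succ', mul_assoc] using hk'
    · right; right; right; left; simpa [pow_succ', mul_assoc] using hk'
    · right; right; right; right; left; simpa [pow_succ', mul_assoc] using hk'
    · right; right; right; right; right; simpa [pow_succ', mul_assoc] using hk'

theorem R_t8 {x y : G} (hy : t8 (cm y) = true) : R x y ↔ fixB (cm x) e1 e1 = true := by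
  have hy' := hy
  simp only [t8, Bool.and_eq_true, T.beq_iff] at hy'
  obtain ⟨hb, hc, hd, hg, h8⟩ := hy'
  rw [fixB_iff]
  constructor
  · intro hR
    rcases ST hR (ne_bot_of_ord8 (mem_right x y) h8) with
      ⟨S, ⟨v, hv⟩, h0, hc, hS⟩ | ⟨w, hw0, hw⟩ | ⟨a, ha, -, hz⟩
    · left
      have h1 := allS_spec t8_check (cm y) (cm_det y)
      rw [hy] at h1
      have h1 := allV_spec (f := orb8 (cm y)) (by simpa using h1)
      have h2 : ∀ v ∈ S, v = e1.toVec ∨ v = -e1.toVec := by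
        intro v hv
        obtain ⟨k, hk1, hk6, hk⟩ := pigeon hc (hS y (mem_right x y)) hv
        rcases orb8_spec (h1 (cv v)) hk1 hk6 hk with h | h
        · rw [h] at hv
          exact absurd hv h0
        · exact h
      have h3 := h2 _ (hS x (mem_left x y) v hv)
      have h4 : x • e1.toVec = e1.toVec ∨ x • e1.toVec = -e1.toVec := by
        rcases h2 v hv with h | h
        · rwa [h] at h3
        · rw [h, g_neg, neg_inj, neg_eq_iff_eq_neg] at h3
          exact h3.symm
      rw [g_act_iff, g_act_iff, cv_neg, cv_toVec] at h4
      exact h4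
    · right
      have h1 := allS_spec t8_row_check (cm y) (cm_det y)
      rw [hy] at h1
      have h1 := allV_spec (by simpa only [Bool.not_true, Bool.false_or] using h1) (cv w)
      have hx := (rap_iff x w).1 (hw x (mem_left x y))
      have hy := (rap_iff y w).1 (hw y (mem_right x y))
      simp only [Bool.or_eq_true, Bool.not_eq_true', ← Bool.not_eq_true, V3.beq_iff,
        cv_zero_iff] at h1
      rcases h1 with h1 | h1 | h1 | h1
      · exact absurd hy h1
      · exact absurd h1 hw0
      · rwa [h1] at hx
      · rw [h1, rap_neg] at hx
        rcases hx with h | h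
        · left
          have := congrArg V3.neg h
          rwa [neg_neg9, neg_neg9] at this
        · right
          have := congrArg V3.neg h
          rwa [neg_neg9, neg_neg9] at this
    · exact (ord8_ne h8 ha (hz y (mem_right x y))).elim
  · rintro (h | h)
    · rw [app_e1] at h
      refine R_of_mem P1_solv (mem_P1 ?_ ?_) (mem_P1 hd hg)
      · rcases h with h | h <;> exact congrArg V3.y h
      · rcases h with h | h <;> exact congrArg V3.z h
    · rw [rap_e1] at h
      refine R_of_mem L1_solv (mem_L1 ?_ ?_) (mem_L1 hb hc)
      · rcases h with h | h <;> exact congrArg V3.y h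
      · rcases h with h | h <;> exact congrArg V3.z h

/-! ## Tests -/

theorem fixB_conj {g x : G} : fixB (cm (g⁻¹ * x * g)) e1 e1 = true ↔
    fixB (cm x) (cm g).col (cm g⁻¹).row = true := by
  rw [fixB_iff, fixB_iff, ← app_e1, ← rap_e1]
  have hgi : ∀ v, (cm g).app ((cm g⁻¹).app v) = v := by
    intro v
    rw [← app_mul, ← cm_mul, mul_inv_cancel, cm_one]
    apply toVec_inj
    rw [toMat_app, toMat_one, Matrix.one_mulVec]
  have hig : ∀ v, (cm g⁻¹).app ((cm g).app v) = v := by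
    intro v
    rw [← app_mul, ← cm_mul, inv_mul_cancel, cm_one]
    apply toVec_inj
    rw [toMat_app, toMat_one, Matrix.one_mulVec]
  have rgi : ∀ v, M9.rap (M9.rap v (cm g)) (cm g⁻¹) = v := by
    intro v
    rw [← rap_mul, ← cm_mul, mul_inv_cancel, cm_one]
    apply toVec_inj
    rw [toMat_rap, toMat_one, Matrix.vecMul_one]
  have rig : ∀ v, M9.rap (M9.rap v (cm g⁻¹)) (cm g) = v := by
    intro v
    rw [← rap_mul, ← cm_mul, inv_mul_cancel, cm_one]
    apply toVec_inj
    rw [toMat_rap, toMat_one, Matrix.vecMul_one]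
  have h1 : ∀ v w, (cm g⁻¹).app v = w ↔ v = (cm g).app w := fun v w =>
    ⟨fun h => by rw [← h, hgi], fun h => by rw [h, hig]⟩
  have h2 : ∀ v w, M9.rap v (cm g) = w ↔ v = M9.rap w (cm g⁻¹) := fun v w =>
    ⟨fun h => by rw [← h, rgi], fun h => by rw [h, rig]⟩
  rw [cm_mul, cm_mul, app_mul, app_mul, rap_mul, rap_mul, h1, h1, h2, h2, app_neg, rap_neg]

theorem r8_det : r8.det = .o := rfl
/-- the standard element of order eight -/
def y0 : G := mk r8 r8_det
theorem t8_y0 : t8 (cm y0) = true := by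
  rw [y0, cm_mk]
  decide +kernel

theorem R_y0 {g x : G} : R x (g * y0 * g⁻¹) ↔ fixB (cm x) (cm g).col (cm g⁻¹).row = true := by
  rw [← fixB_conj, ← R_t8 t8_y0]
  have := R_conj g (x := g⁻¹ * x * g) (y := y0)
  rw [← this]
  have e : g * (g⁻¹ * x * g) * g⁻¹ = x := by group
  rw [e]

/-- validity of test lists -/
def valB : List (M9 × M9 × Bool) → Bool
  | [] => true
  | p :: L => (p.1.det.beq .o && M9.beq (p.1.mul p.2.1) M9.one) && valB L

theorem fix_eq {x x' : G} (h : solvabilizer x = solvabilizer x') {g gi : M9} (hd : g.det = .o)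
    (hi : g.mul gi = M9.one) : fixB (cm x) g.col gi.row = fixB (cm x') g.col gi.row := by
  have e : cm (mk g hd)⁻¹ = gi := by
    rw [← one_mul9 gi, ← cm_one, ← inv_mul_cancel (mk g hd), cm_mul, mul_assoc9, cm_mk, hi,
      mul_one9]
  have h1 := R_y0 (g := mk g hd) (x := x)
  have h2 := R_y0 (g := mk g hd) (x := x')
  rw [cm_mk, e, ← mem_sol] at h1 h2
  rw [Bool.eq_iff_iff, ← h1, ← h2, h]

theorem tests_eq {x x' : G} (h : solvabilizer x = solvabilizer x') {L : List (M9 × M9 × Bool)}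
    (hL : valB L = true) : testsB (cm x) L = testsB (cm x') L := by
  induction L with
  | nil => rfl
  | cons p L ih =>
    simp only [valB, Bool.and_eq_true, T.beq_iff, M9.beq_iff] at hL
    simp only [testsB]
    rw [fix_eq h hL.1.1 hL.1.2, ih hL.2]

theorem tests_of {x' : G} {r : M9} (hd : r.det = .o)
    (h : solvabilizer x' = solvabilizer (mk r hd)) {L : List (M9 × M9 × Bool)}
    (hL : valB L = true) (hr : testsB r L = true) : testsB (cm x') L = true := by
  rw [tests_eq h hL, cm_mk, hr]

/-! ## Fibers -/

/-- the elements with the same solvabilizer -/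
def fib (x : G) : Set G := {y | solvabilizer y = solvabilizer x}

theorem fib_conj (g x : G) : (fib (g * x * g⁻¹)).ncard = (fib x).ncard := by
  have : fib (g * x * g⁻¹) = (fun y => g * y * g⁻¹) '' fib x := by
    ext y
    constructor
    · intro h
      refine ⟨g⁻¹ * y * g, ?_, by group⟩
      have e : y = g * (g⁻¹ * y * g) * g⁻¹ := by group
      have h : solvabilizer y = solvabilizer (g * x * g⁻¹) := h
      rw [e, sol_conj_iff] at h
      exact h
    · rintro ⟨w, hw, rfl⟩
      exact (sol_conj_iff g w x).2 hw
  rw [this, Set.ncard_image_of_injective]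
  intro a b h
  simpa using h

theorem fib_CJ {x : G} {r : M9} (hd : r.det = .o) (h : CJ x r) :
    (fib x).ncard = (fib (mk r hd)).ncard := by
  obtain ⟨g, rfl⟩ := h.eq hd
  exact fib_conj g _

theorem eq_inv_of {x : G} {r : M9} (hd : r.det = .o) (h : (cm x).mul r = M9.one) :
    x = (mk r hd)⁻¹ := by
  rw [eq_inv_iff_mul_eq_one]
  apply cm_inj
  rw [cm_mul, cm_mk, h, cm_one]

theorem fib_two {r : M9} (hd : r.det = .o) (h2 : M9.beq (r.mul r) M9.one = false)
    (h : ∀ x, solvabilizer x = solvabilizer (mk r hd) → cm x = r ∨ (cm x).mul r = M9.one) :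
    (fib (mk r hd)).ncard = 2 := by
  have : fib (mk r hd) = {mk r hd, (mk r hd)⁻¹} := by
    ext x
    constructor
    · intro hx
      rcases h x hx with h | h
      · left
        exact (eq_mk_iff _ _ _).2 h
      · right
        exact eq_inv_of hd h
    · rintro (rfl | rfl)
      · rfl
      · exact sol_inv _
  rw [this, Set.ncard_pair]
  intro he
  have h3 : mk r hd * mk r hd = 1 := by
    nth_rewrite 2 [he]
    exact mul_inv_cancel _
  have h4 := congrArg cm h3
  rw [cm_mul, cm_mk, cm_one, ← M9.beq_iff, h2] at h4
  exact absurd h4 (by simp)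

theorem fib_one {r : M9} (hd : r.det = .o)
    (h : ∀ x, solvabilizer x = solvabilizer (mk r hd) → cm x = r) :
    (fib (mk r hd)).ncard = 1 := by
  have : fib (mk r hd) = {mk r hd} := by
    ext x
    constructor
    · intro hx
      exact (eq_mk_iff _ _ _).2 (h x hx)
    · rintro rfl
      rfl
  rw [this, Set.ncard_singleton]

theorem one_det : M9.one.det = .o := rfl
theorem r3A_det : r3A.det = .o := rfl
theorem r4_det : r4.det = .o := rfl
theorem r4i_det : r4i.det = .o := rfl
theorem r8i_det : r8i.det = .o := rfl
theorem zz_det : zz.det = .o := rfl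
theorem c3_det : (compM .z .z).det = .o := rfl
theorem c6_det : (compM .t .t).det = .o := rfl

theorem fib_id : (fib (mk M9.one one_det)).ncard = 1 := by
  refine fib_one _ fun x hx => ?_
  have h1 := tests_of _ hx (L := l1) (by decide +kernel) (by decide +kernel)
  have h2 := allS_spec l1_check (cm x) (cm_det x)
  rw [h1] at h2
  simpa [M9.beq_iff] using h2

theorem fib_r2 : (fib (mk r2 r2_det)).ncard = 1 := by
  refine fib_one _ fun x hx => ?_
  have h1 := tests_of _ hx (L := l2) (by decide +kernel) (by decide +kernel)
  have h2 := allS_spec l2_check (cm x) (cm_det x)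
  rw [h1] at h2
  simpa [M9.beq_iff] using h2

theorem fib_r3A : (fib (mk r3A r3A_det)).ncard = 2 := by
  refine fib_two _ (by decide +kernel) fun x hx => ?_
  have h1 := tests_of _ hx (L := l3A) (by decide +kernel) (by decide +kernel)
  have h2 := allS_spec l3A_check (cm x) (cm_det x)
  rw [h1] at h2
  simpa [M9.beq_iff] using h2

theorem fib_c6 : (fib (mk (compM .t .t) c6_det)).ncard = 2 := by
  refine fib_two _ (by decide +kernel) fun x hx => ?_
  have h1 := tests_of _ hx (L := l6) (by decide +kernel) (by decide +kernel)
  have h2 := allS_spec l6_check (cm x) (cm_det x)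
  rw [h1] at h2
  simpa [M9.beq_iff] using h2

theorem R_of_sol {x x' y : G} (h : solvabilizer x = solvabilizer x') (hR : R x' y) : R x y := by
  rw [← mem_sol] at hR ⊢
  rwa [h]

theorem not_nonsolv {x : G} (h : R x (mk zz zz_det)) : nonsolv (cm x) zz ≠ true := by
  intro hn
  rw [← cm_mk zz zz_det] at hn
  exact nonsolv_spec hn h

theorem fib_c3 : (fib (mk (compM .z .z) c3_det)).ncard = 2 := by
  refine fib_two _ (by decide +kernel) fun x hx => ?_
  have h1 := tests_of _ hx (L := l3B) (by decide +kernel) (by decide +kernel)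
  have h2 := allS_spec l3B_check (cm x) (cm_det x)
  have h3 := not_nonsolv (R_of_sol hx (R_s0 c3_det zz_det (by decide +kernel) (by decide +kernel)))
  rw [h1] at h2
  simp only [Bool.not_true, Bool.false_or, Bool.or_eq_true, M9.beq_iff] at h2
  tauto

theorem sol_t8 {x : G} (h : t8 (cm x) = true) : solvabilizer x = solvabilizer y0 := by
  ext y
  rw [mem_sol, mem_sol, R_symm, R_symm (x := y0), R_t8 h, R_t8 t8_y0]

theorem R_sol_y0 {x y : G} (h : solvabilizer x = solvabilizer y0) (hR : R x y) :
    fixB (cm y) e1 e1 = true := by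
  have := R_of_sol h.symm hR
  rwa [R_symm, R_t8 t8_y0] at this

theorem fib_r4 : (fib (mk r4 r4_det)).ncard = 2 := by
  refine fib_two _ (by decide +kernel) fun x hx => ?_
  have h1 := tests_of _ hx (L := l4) (by decide +kernel) (by decide +kernel)
  have h2 := allS_spec l4_check (cm x) (cm_det x)
  have hR := R_of_sol hx (R_s0 r4_det zz_det (by decide +kernel) (by decide +kernel))
  have h3 := not_nonsolv hR
  rw [h1] at h2
  simp only [Bool.not_true, Bool.false_or, Bool.or_eq_true] at h2
  rcases h2 with h2 | h2
  · have h4 := R_sol_y0 (sol_t8 h2) hR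
    rw [cm_mk] at h4
    exact absurd h4 (by decide +kernel)
  · have h4 := allS_spec n4_check (cm x) (cm_det x)
    rw [h2] at h4
    simp only [Bool.not_true, Bool.false_or, Bool.or_eq_true, M9.beq_iff] at h4
    tauto

theorem t4_excl {x : G} (hx : solvabilizer x = solvabilizer y0) {h r hi : M9}
    (hr : r.det = .o) (hm : memM r s0 = true) (hd : h.det = .o) (hh : h.mul hi = M9.one)
    (hf : fixB (cj h zz hi) e1 e1 = false) (he : cm x = cj h r hi) : False := by
  have e : cm (mk h hd)⁻¹ = hi := by
    rw [← one_mul9 hi, ← cm_one, ← inv_mul_cancel (mk h hd), cm_mul, mul_assoc9, cm_mk, hh,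
      mul_one9]
  have e1 : x = mk h hd * mk r hr * (mk h hd)⁻¹ := by
    apply cm_inj
    rw [cm_mul, cm_mul, e, cm_mk, cm_mk, he]
    rfl
  have hR : R x (mk h hd * mk zz zz_det * (mk h hd)⁻¹) := by
    rw [e1, R_conj]
    exact R_s0 hr zz_det hm (by decide +kernel)
  have h4 := R_sol_y0 hx hR
  rw [cm_mul, cm_mul, e, cm_mk, cm_mk] at h4
  unfold cj at hf
  rw [hf] at h4
  exact absurd h4 (by simp)

theorem fib_y0 : fib y0 = {x | t8 (cm x) = true} := by
  ext x
  refine ⟨fun hx => ?_, fun hx => sol_t8 hx⟩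
  have hx : solvabilizer x = solvabilizer y0 := hx
  have h1 := tests_of r8_det hx (L := l4) (by decide +kernel) (by decide +kernel)
  have h2 := allS_spec l4_check (cm x) (cm_det x)
  rw [h1] at h2
  simp only [Bool.not_true, Bool.false_or, Bool.or_eq_true] at h2
  rcases h2 with h2 | h2
  · exact h2
  exfalso
  simp only [t4, Bool.or_eq_true, M9.beq_iff] at h2
  have c1 : ∀ r : M9, cj M9.one r M9.one = r := fun r => by
    unfold cj
    rw [one_mul9, mul_one9]
  rcases h2 with (h2 | h2) | (h2 | h2) | (h2 | h2)
  · exact t4_excl (h := M9.one) (hi := M9.one) hx r4_det (by decide +kernel) rfl rfl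
      (by decide +kernel) (by rw [h2, c1])
  · exact t4_excl (h := M9.one) (hi := M9.one) hx r4i_det (by decide +kernel) rfl rfl
      (by decide +kernel) (by rw [h2, c1])
  · exact t4_excl (h := SolvPSL.h1) (hi := SolvPSL.h1i) hx r4_det (by decide +kernel) rfl rfl
      (by decide +kernel) h2
  · exact t4_excl (h := SolvPSL.h1) (hi := SolvPSL.h1i) hx r4i_det (by decide +kernel) rfl rfl
      (by decide +kernel) h2
  · exact t4_excl (h := SolvPSL.h2) (hi := SolvPSL.h2i) hx r4_det (by decide +kernel) rfl rfl
      (by decide +kernel) h2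
  · exact t4_excl (h := SolvPSL.h2) (hi := SolvPSL.h2i) hx r4i_det (by decide +kernel) rfl rfl
      (by decide +kernel) h2

theorem fib_t8 {x : G} (h : t8 (cm x) = true) : (fib x).ncard = 12 := by
  have e : fib x = fib y0 := by
    unfold fib
    rw [sol_t8 h]
  rw [e, fib_y0]
  have h1 := cntS_eq (fun m => if t8 m then 1 else 0)
  rw [t8_count] at h1
  rw [h1, ← Finset.sum_filter, ← Finset.card_eq_sum_ones, ← Set.ncard_coe_finset]
  simp

theorem R_self (x : G) : R x x :=
  R_of_mem (A := Subgroup.zpowers x) (isSolvable_of_comm (by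
    rintro ⟨a, m, rfl⟩ ⟨b, n, rfl⟩
    exact Subtype.ext ((Commute.refl x).zpow_zpow m n).eq))
    (Subgroup.mem_zpowers x) (Subgroup.mem_zpowers x)

theorem CJ13.conj {x : G} (g : G) (h : CJ13 x) : CJ13 (g⁻¹ * x * g) := by
  have key : ∀ r, CJ x r → CJ (g⁻¹ * x * g) r := by
    rintro r ⟨k, hk⟩
    refine ⟨g⁻¹ * k, ?_⟩
    rw [← cm_mul, show g⁻¹ * x * g * (g⁻¹ * k) = g⁻¹ * (x * k) by group, cm_mul, cm_mul, hk,
      ← mul_assoc9, ← cm_mul]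
  rcases h with h | h | h | h
  · exact Or.inl (key _ h)
  · exact Or.inr (Or.inl (key _ h))
  · exact Or.inr (Or.inr (Or.inl (key _ h)))
  · exact Or.inr (Or.inr (Or.inr (key _ h)))

/-! ## Elements of order thirteen -/

theorem app_z3 (m : M9) : m.app z3 = z3 := by
  rcases m with ⟨a, b, c, d, e, f, g, h, i⟩
  have k : ∀ a b c : T, dot a b c .z .z .z = .z := fun a b c => by
    cases a <;> cases b <;> cases c <;> rfl
  simp only [M9.app, z3, k]

theorem rap_z3 (m : M9) : M9.rap z3 m = z3 := rfl

theorem app_inv {g : G} (v : V3) : (cm g).app ((cm g⁻¹).app v) = v := by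
  rw [← app_mul, ← cm_mul, mul_inv_cancel, cm_one]
  apply toVec_inj
  rw [toMat_app, toMat_one, Matrix.one_mulVec]

theorem rap_inv {g : G} (v : V3) : M9.rap (M9.rap v (cm g)) (cm g⁻¹) = v := by
  rw [← rap_mul, ← cm_mul, mul_inv_cancel, cm_one]
  apply toVec_inj
  rw [toMat_rap, toMat_one, Matrix.vecMul_one]

theorem noEig_aux {x : G} {r : M9} (hd : r.det = .o) (h : CJ x r)
    (hr : ∀ v, v ≠ z3 → fixB r v v = false) {v : V3} (hv : v ≠ z3) :
    ¬ (((cm x).app v = v ∨ (cm x).app v = v.neg) ∨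
      (M9.rap v (cm x) = v ∨ M9.rap v (cm x) = v.neg)) := by
  obtain ⟨g, hg⟩ := h.eq hd
  have h1 : g⁻¹ * x = mk r hd * g⁻¹ := by rw [hg]; group
  have h2 : x * g = g * mk r hd := by rw [hg]; group
  have h1 := congrArg cm h1
  have h2 := congrArg cm h2
  rw [cm_mul, cm_mul, cm_mk] at h1 h2
  rintro (h | h)
  · have hu : (cm g⁻¹).app v ≠ z3 := by
      intro h0
      apply hv
      rw [← app_inv (g := g) v, h0, app_z3]
    have h3 := hr _ hu
    rw [← Bool.not_eq_true, fixB_iff] at h3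
    apply h3
    left
    rw [← app_mul, ← h1, app_mul]
    rcases h with h | h
    · left; rw [h]
    · right; rw [h, app_neg]
  · have hu : M9.rap v (cm g) ≠ z3 := by
      intro h0
      apply hv
      rw [← rap_inv (g := g) v, h0, rap_z3]
    have h3 := hr _ hu
    rw [← Bool.not_eq_true, fixB_iff] at h3
    apply h3
    right
    rw [← rap_mul, ← h2, rap_mul]
    rcases h with h | h
    · left; rw [h]
    · right; rw [h, rap_neg]

theorem noEig {x : G} (h : CJ13 x) {v : V3} (hv : v ≠ z3) :
    ¬ (((cm x).app v = v ∨ (cm x).app v = v.neg) ∨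
      (M9.rap v (cm x) = v ∨ M9.rap v (cm x) = v.neg)) := by
  have key : ∀ v, v ≠ z3 → fixB (compM .z .t) v v = false ∧ fixB (compM .o .t) v v = false ∧
      fixB (compM .t .z) v v = false ∧ fixB (compM .t .o) v v = false := by
    intro v hv
    have h := allV_spec eig_check v
    simp only [Bool.or_eq_true, Bool.and_eq_true, Bool.not_eq_true', V3.beq_iff] at h
    tauto
  rcases h with h | h | h | h
  · exact noEig_aux rfl h (fun v hv => (key v hv).1) hv
  · exact noEig_aux rfl h (fun v hv => (key v hv).2.1) hv
  · exact noEig_aux rfl h (fun v hv => (key v hv).2.2.1) hv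
  · exact noEig_aux rfl h (fun v hv => (key v hv).2.2.2) hv

theorem e1_ne : e1 ≠ z3 := by
  intro h
  have := congrArg V3.x h
  exact T.noConfusion this

theorem not_R13 {x : G} (h : CJ13 x) (g : G) : ¬ R x (g * y0 * g⁻¹) := by
  rw [R_y0, ← fixB_conj, fixB_iff]
  exact noEig (h.conj g) e1_ne

theorem someR_aux {x : G} {r g gi : M9} (hd : r.det = .o) (h : CJ x r) (hg : g.det = .o)
    (hi : g.mul gi = M9.one) (hf : fixB r g.col gi.row = true) : ∃ g, R x (g * y0 * g⁻¹) := by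
  obtain ⟨k, hk⟩ := h.eq hd
  have e : cm (mk g hg)⁻¹ = gi := by
    rw [← one_mul9 gi, ← cm_one, ← inv_mul_cancel (mk g hg), cm_mul, mul_assoc9, cm_mk, hi,
      mul_one9]
  have h1 : R (mk r hd) (mk g hg * y0 * (mk g hg)⁻¹) := by
    rw [R_y0, cm_mk, cm_mk, e, hf]
  refine ⟨k * mk g hg, ?_⟩
  rw [← R_conj k, ← hk] at h1
  have e2 : k * mk g hg * y0 * (k * mk g hg)⁻¹ = k * (mk g hg * y0 * (mk g hg)⁻¹) * k⁻¹ := by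
    group
  rw [e2]
  exact h1

theorem someR (x : G) : CJ13 x ∨ ∃ g, R x (g * y0 * g⁻¹) := by
  rcases all_kinds x with h | h | h | h | h | h | h | h | h
  · right
    refine ⟨1, ?_⟩
    rw [R_y0, h, cm_one]
    decide +kernel
  · right
    exact someR_aux (g := M9.one) (gi := M9.one) rfl h rfl rfl (by decide +kernel)
  · right
    exact someR_aux (g := M9.one) (gi := M9.one) rfl h rfl rfl (by decide +kernel)
  · right
    exact someR_aux (g := ⟨.o, .z, .o, .o, .o, .z, .o, .z, .t⟩)
      (gi := ⟨.t, .z, .t, .o, .o, .o, .t, .z, .o⟩) rfl h rfl rfl (by decide +kernel)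
  · right
    exact someR_aux (g := M9.one) (gi := M9.one) rfl h rfl rfl (by decide +kernel)
  · right
    exact someR_aux (g := ⟨.o, .z, .o, .t, .o, .z, .o, .z, .t⟩)
      (gi := ⟨.t, .z, .t, .t, .o, .t, .t, .z, .o⟩) rfl h rfl rfl (by decide +kernel)
  · right
    exact someR_aux (g := M9.one) (gi := M9.one) rfl h rfl rfl (by decide +kernel)
  · right
    exact someR_aux (g := M9.one) (gi := M9.one) rfl h rfl rfl (by decide +kernel)
  · exact Or.inl h

theorem CJ13_of_sol {x y : G} (h : CJ13 x) (hs : solvabilizer y = solvabilizer x) : CJ13 y := by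
  rcases someR y with h1 | ⟨g, hg⟩
  · exact h1
  · exact absurd (R_of_sol hs.symm hg) (not_R13 h g)

theorem CJ13.ne_one {x : G} (h : CJ13 x) : x ≠ 1 := by
  rintro rfl
  refine noEig h e1_ne (Or.inl (Or.inl ?_))
  rw [cm_one]
  rfl

theorem CJ13.commute {x y : G} (hx : CJ13 x) (hy : CJ13 y) (hR : R x y) : y * x = x * y := by
  have hxm := mem_left x y
  have hym := mem_right x y
  have hne : Subgroup.closure {x, y} ≠ ⊥ := by
    intro h
    rw [h, Subgroup.mem_bot] at hxm
    exact hx.ne_one hxm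
  rcases ST hR hne with ⟨S, ⟨v, hv⟩, h0, hc, hS⟩ | ⟨w, hw, hS⟩ | ⟨a, ha, ha1, hS⟩
  · exfalso
    obtain ⟨k, hk1, hk6, hk⟩ := pigeon hc (hS x hxm) hv
    have hxk : CJ13 (x ^ k) := by
      apply CJ13_of_pow
      · rw [← pow_mul, mul_comm, pow_mul, hx.pow, one_pow]
      · intro h1
        apply hx.ne_one
        refine eq_one_of_pows hx.pow h1 ?_
        interval_cases k <;> norm_num
    rw [g_act_iff] at hk
    refine noEig hxk ?_ (Or.inl (Or.inl hk))
    rw [Ne, cv_zero_iff]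
    rintro rfl
    exact h0 hv
  · exfalso
    have h1 := (rap_iff x w).1 (hS x hxm)
    exact noEig hx (by rwa [Ne, cv_zero_iff]) (Or.inr h1)
  · have e : ∀ z : G, CJ13 z → z = (z ^ 12)⁻¹ := by
      intro z hz
      rw [eq_inv_iff_mul_eq_one, ← pow_succ', hz.pow]
    have h1 : x ∈ Subgroup.zpowers a := by
      rw [e x hx]
      exact inv_mem (hS x hxm)
    have h2 : y ∈ Subgroup.zpowers a := by
      rw [e y hy]
      exact inv_mem (hS y hym)
    obtain ⟨m, rfl⟩ := h1
    obtain ⟨n, rfl⟩ := h2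
    exact ((Commute.refl a).zpow_zpow n m).eq

theorem fib_13 {x : G} (h : CJ13 x) : (fib x).ncard = 12 := by
  have e : fib x = (Subgroup.zpowers x : Set G) \ {1} := by
    ext y
    constructor
    · intro hy
      have hy13 := CJ13_of_sol h hy
      have hR : R x y := R_symm.1 (R_of_sol hy (R_self x))
      exact ⟨cen13 h (h.commute hy13 hR), hy13.ne_one⟩
    · rintro ⟨hy, h1⟩
      have h1 : y ≠ 1 := h1
      obtain ⟨m, hm⟩ := Subgroup.mem_zpowers_iff.1 hy
      have hy13 : CJ13 y := by
        apply CJ13_of_pow _ h1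
        rw [← hm, ← zpow_natCast, ← zpow_mul, mul_comm, zpow_mul, zpow_natCast, h.pow, one_zpow]
      have hc : x * y = y * x := by
        rw [← hm]
        exact ((Commute.refl x).zpow_right m).eq
      exact (sol_eq_of_zpowers hy (cen13 hy13 hc)).symm
  have h13 : (Subgroup.zpowers x : Set G).ncard = 13 := by
    have : Fact (Nat.Prime 13) := ⟨by norm_num⟩
    rw [← orderOf_eq_prime h.pow h.ne_one, ← Nat.card_zpowers]
    exact (Nat.card_coe_set_eq _).symm
  rw [e, Set.ncard_diff_singleton_of_mem (one_mem (Subgroup.zpowers x)), h13]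

/-! ## The count -/

/-- size of the fibers -/
def kk (m : M9) : ℕ := if m.tr.beq m.e2 then (if M9.beq (m.mul m) M9.one then 1 else 2) else 12

theorem fib_card (x : G) : (fib x).ncard = kk (cm x) := by
  unfold kk
  by_cases h1 : (cm x).tr = (cm x).e2
  · rw [if_pos ((T.beq_iff _ _).2 h1)]
    by_cases h2 : (cm x).mul (cm x) = M9.one
    · rw [if_pos ((M9.beq_iff _ _).2 h2)]
      rcases conj_main x with ⟨-, h | h⟩ | ⟨h, -⟩
      · rw [(eq_mk_iff x _ one_det).2 h, fib_id]
      · rw [fib_CJ r2_det h, fib_r2]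
      · exact absurd h2 h
    · rw [if_neg (by rwa [M9.beq_iff])]
      rcases kind_two h1 h2 with h | h | h | h
      · rw [fib_CJ r3A_det h, fib_r3A]
      · rw [fib_CJ c3_det h, fib_c3]
      · rw [fib_CJ r4_det h, fib_r4]
      · rw [fib_CJ c6_det h, fib_c6]
  · rw [if_neg (by rwa [T.beq_iff])]
    rcases kind_twelve h1 with h | h | h
    · rw [fib_CJ r8_det h]
      exact fib_t8 t8_y0
    · rw [fib_CJ r8i_det h]
      apply fib_t8
      rw [cm_mk]
      decide +kernel
    · exact fib_13 h

/-- twelve divided by the size of the fiber -/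
def kw (m : M9) : Nat :=
  if m.tr.beq m.e2 then (if M9.beq (m.mul m) M9.one then 12 else 6) else 1

theorem kw_check : cntS kw = 18744 := by decide +kernel

theorem count_G : (solvSet G).ncard = 1562 := by
  have h := ncard_range_eq (fun x : G => solvabilizer x) (fun x => kk (cm x)) fib_card
  have h2 := kw_check
  rw [cntS_eq] at h2
  have h3 : ∀ x : G, (1 : ℚ) / kk (cm x) = (kw (cm x) : ℚ) / 12 := by
    intro x
    unfold kk kw
    split_ifs <;> norm_num
  simp only [h3] at h
  rw [← Finset.sum_div, ← Nat.cast_sum, h2] at h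
  have h4 : ((solvSet G).ncard : ℚ) = 1562 := by
    rw [show solvSet G = Set.range (fun x : G => solvabilizer x) from rfl, h]
    norm_num
  exact_mod_cast h4

theorem center_bot : Subgroup.center G = ⊥ := by
  rw [eq_bot_iff]
  intro A hA
  rw [Matrix.SpecialLinearGroup.mem_center_iff] at hA
  obtain ⟨r, hr, hA⟩ := hA
  have h1 : r = 1 := by
    simp only [Fintype.card_fin] at hr
    clear hA
    revert r
    decide
  rw [Subgroup.mem_bot]
  apply Subtype.ext
  rw [← hA, h1]
  simp

theorem count_PSL : (solvSet (PSL 3 (ZMod 3))).ncard = 1562 := by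
  rw [← count_G]
  exact solvSet_ncard_equiv
    ((QuotientGroup.quotientMulEquivOfEq center_bot).trans QuotientGroup.quotientBot)

end SolvPSL

/-- `|Solv(PSL(3, 3))| = 1562`. -/
theorem solvSet_ncard_PSL_three_three :
    (solvSet (PSL 3 (ZMod 3))).ncard = 1562 := by
  exact SolvPSL.count_PSL
end

section
/- Let p be an odd prime, q = 2^p, and G = PSL(2, q). If x, y ∈ G satisfy Sol_G(x) = Sol_G(y), then x and y are contained in exactly the same maximal subgroups of G; that is, for every maximal subgroup M of G, x ∈ M if and only if y ∈ M. -/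
namespace PSLaux

open Matrix

variable {F : Type*} [Field F]

abbrev S (F : Type*) [Field F] := Matrix.SpecialLinearGroup (Fin 2) F

def mk2 (a b c d : F) (h : a * d - b * c = 1) : S F :=
  ⟨!![a, b; c, d], by rw [Matrix.det_fin_two_of]; exact h⟩

@[simp] lemma mk2_00 (a b c d : F) (h) : (mk2 a b c d h) 0 0 = a := rfl
@[simp] lemma mk2_01 (a b c d : F) (h) : (mk2 a b c d h) 0 1 = b := rfl
@[simp] lemma mk2_10 (a b c d : F) (h) : (mk2 a b c d h) 1 0 = c := rfl
@[simp] lemma mk2_11 (a b c d : F) (h) : (mk2 a b c d h) 1 1 = d := rfl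

lemma sext {g h : S F} : g = h ↔ g 0 0 = h 0 0 ∧ g 0 1 = h 0 1 ∧ g 1 0 = h 1 0 ∧ g 1 1 = h 1 1 := by
  constructor
  · rintro rfl; simp
  · rintro ⟨h1, h2, h3, h4⟩
    ext i j
    fin_cases i <;> fin_cases j <;> assumption

lemma m00 (g h : S F) : (g * h) 0 0 = g 0 0 * h 0 0 + g 0 1 * h 1 0 := by
  simp [Matrix.mul_apply, Fin.sum_univ_two]
lemma m01 (g h : S F) : (g * h) 0 1 = g 0 0 * h 0 1 + g 0 1 * h 1 1 := by
  simp [Matrix.mul_apply, Fin.sum_univ_two]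
lemma m10 (g h : S F) : (g * h) 1 0 = g 1 0 * h 0 0 + g 1 1 * h 1 0 := by
  simp [Matrix.mul_apply, Fin.sum_univ_two]
lemma m11 (g h : S F) : (g * h) 1 1 = g 1 0 * h 0 1 + g 1 1 * h 1 1 := by
  simp [Matrix.mul_apply, Fin.sum_univ_two]
lemma i00 (g : S F) : (g⁻¹) 0 0 = g 1 1 := by
  simp [Matrix.SpecialLinearGroup.coe_inv, Matrix.adjugate_fin_two]
lemma i01 (g : S F) : (g⁻¹) 0 1 = - g 0 1 := by
  simp [Matrix.SpecialLinearGroup.coe_inv, Matrix.adjugate_fin_two]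
lemma i10 (g : S F) : (g⁻¹) 1 0 = - g 1 0 := by
  simp [Matrix.SpecialLinearGroup.coe_inv, Matrix.adjugate_fin_two]
lemma i11 (g : S F) : (g⁻¹) 1 1 = g 0 0 := by
  simp [Matrix.SpecialLinearGroup.coe_inv, Matrix.adjugate_fin_two]
lemma o00 : (1 : S F) 0 0 = 1 := by simp
lemma o01 : (1 : S F) 0 1 = 0 := by simp
lemma o10 : (1 : S F) 1 0 = 0 := by simp
lemma o11 : (1 : S F) 1 1 = 1 := by simp
lemma sdet (g : S F) : g 0 0 * g 1 1 - g 0 1 * g 1 0 = 1 := by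
  rw [← Matrix.det_fin_two]; exact g.2

/-- trace -/
def tr (g : S F) : F := g 0 0 + g 1 1

lemma tr_conj (h a : S F) : tr (h * a * h⁻¹) = tr a := by
  have := sdet h
  simp only [tr, m00, m01, m10, m11, i00, i01, i10, i11]
  linear_combination (a 0 0 + a 1 1) * this

/-- centraliser of an element with nonzero trace is abelian -/
lemma CT (h2 : (2 : F) = 0) {a b c : S F} (hb : tr b ≠ 0) (h1 : a * b = b * a) (h3 : b * c = c * b) :
    a * c = c * a := by
  simp only [sext, m00, m01, m10, m11, tr] at *
  have hb' : b 0 0 - b 1 1 ≠ 0 := by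
    intro h; apply hb; linear_combination h + h2 * b 1 1
  refine ⟨?_, ?_, ?_, ?_⟩ <;> apply mul_left_cancel₀ hb' <;> grind

/-- commuting elements with the same nonzero trace -/
lemma L1 (h2 : (2 : F) = 0) {a b : S F} (hb : tr a ≠ 0) (hab : tr a = tr b) (h1 : a * b = b * a) :
    b = a ∨ b = a⁻¹ := by
  have da := sdet a
  have db := sdet b
  simp only [sext, m00, m01, m10, m11, i00, i01, i10, i11, tr] at *
  have hb' : a 0 0 - a 1 1 ≠ 0 := by
    intro h; apply hb; linear_combination h + h2 * a 1 1
  -- b 0 1 = a 0 1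
  have e1 : b 0 1 = a 0 1 := by
    apply mul_left_cancel₀ hb'; grind
  have e2 : b 1 0 = a 1 0 := by
    apply mul_left_cancel₀ hb'; grind
  have e3 : (b 0 0 - a 0 0) * (b 0 0 - a 1 1) = 0 := by grind
  rcases mul_eq_zero.1 e3 with h | h
  · left; grind
  · right; grind

lemma L2 (h2 : (2 : F) = 0) {a h : S F} (ha : tr a ≠ 0) (h1 : h * a = a⁻¹ * h) : tr h = 0 := by
  simp only [sext, m00, m01, m10, m11, i00, i01, i10, i11, tr] at *
  have : (a 0 0 + a 1 1) * (h 0 0 + h 1 1) = 0 := by grind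
  exact (mul_eq_zero.1 this).resolve_left ha

lemma sq_of_tr (h2 : (2 : F) = 0) {a : S F} (ha : tr a = 0) : a * a = 1 := by
  have da := sdet a
  simp only [sext, m00, m01, m10, m11, o00, o01, o10, o11, tr] at *
  grind

lemma tr_of_sq (h2 : (2 : F) = 0) {a : S F} (ha : a * a = 1) : tr a = 0 := by
  have da := sdet a
  simp only [sext, m00, m01, m10, m11, o00, o01, o10, o11, tr] at *
  have : (a 0 0 + a 1 1)^2 = 0 := by grind
  exact pow_eq_zero_iff (two_ne_zero) |>.1 this

lemma sq_one (h2 : (2 : F) = 0) {a : F} (h : a * a = 1) : a = 1 := by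
  have : (a - 1)^2 = 0 := by grind
  have := pow_eq_zero_iff (two_ne_zero) |>.1 this
  grind

lemma odd_order [Finite F] (h2 : (2 : F) = 0) {s : S F} (hs : tr s ≠ 0) : Odd (orderOf s) := by
  rw [← Nat.not_even_iff_odd]
  rintro ⟨k, hk⟩
  have hpos : 0 < orderOf s := orderOf_pos s
  have hk0 : 0 < k := by omega
  have h1 : s ^ k * s ^ k = 1 := by rw [← pow_add, ← hk, pow_orderOf_eq_one]
  have h3 : s ^ k ≠ 1 := by
    intro h
    have := orderOf_le_of_pow_eq_one hk0 h
    omega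
  have h4 : s * s ^ k = s ^ k * s := by rw [← pow_succ', pow_succ]
  apply h3
  generalize s ^ k = z at *
  have h5 := tr_of_sq h2 h1
  have dz := sdet z
  simp only [sext, m00, m01, m10, m11, o00, o01, o10, o11, tr] at *
  have hb' : s 0 0 - s 1 1 ≠ 0 := by
    intro h; apply hs; linear_combination h + h2 * s 1 1
  have e1 : z 0 1 = 0 := by
    apply mul_left_cancel₀ hb'; grind
  have e2 : z 1 0 = 0 := by
    apply mul_left_cancel₀ hb'; grind
  have e3 : z 0 0 = 1 := sq_one h2 (by grind)
  grind

end PSLaux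
namespace PSLaux

/-- a finite group in which every involution is self-centralising is generalised dihedral. -/
lemma dihedral_lemma {G : Type*} [Group G] [Finite G]
    (hI : ∀ u h : G, u ≠ 1 → u * u = 1 → h * u = u * h → h = 1 ∨ h = u)
    (u₀ : G) (hu₀ : u₀ ≠ 1) (hu₀' : u₀ * u₀ = 1)
    (r : G) (hr : ¬ (r ≠ 1 ∧ r * r = 1)) (g : G) :
    g * r = r * g ∨ g * r = r⁻¹ * g := by
  classical
  have := Fintype.ofFinite G
  set I : Finset G := Finset.univ.filter (fun u => u ≠ 1 ∧ u * u = 1) with hIdef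
  have memI : ∀ u, u ∈ I ↔ u ≠ 1 ∧ u * u = 1 := by intro u; simp [hIdef]
  -- count
  have c1 : Fintype.card G ≤ 2 * I.card := by
    have h1 := Finset.card_le_mul_card_image (f := fun g : G => g * u₀ * g⁻¹) Finset.univ 2 ?_
    · refine h1.trans (Nat.mul_le_mul_left 2 (Finset.card_le_card ?_))
      intro v hv
      obtain ⟨k, -, rfl⟩ := Finset.mem_image.1 hv
      rw [memI]
      refine ⟨by simpa using hu₀, ?_⟩
      have : k * u₀ * k⁻¹ * (k * u₀ * k⁻¹) = k * (u₀ * u₀) * k⁻¹ := by group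
      rw [this, hu₀']; group
    · intro v hv
      obtain ⟨k, -, rfl⟩ := Finset.mem_image.1 hv
      have : (Finset.univ.filter (fun x : G => x * u₀ * x⁻¹ = k * u₀ * k⁻¹)) ⊆ {k, k * u₀} := by
        intro x hx
        simp only [Finset.mem_filter, Finset.mem_univ, true_and] at hx
        have h3 : (k⁻¹ * x) * u₀ = u₀ * (k⁻¹ * x) := by
          calc (k⁻¹ * x) * u₀ = k⁻¹ * (x * u₀ * x⁻¹) * x := by group
            _ = k⁻¹ * (k * u₀ * k⁻¹) * x := by rw [hx]
            _ = _ := by group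
        rcases hI u₀ _ hu₀ hu₀' h3 with h | h
        · simp [inv_mul_eq_one.1 h]
        · simp [← h]
      exact (Finset.card_le_card this).trans Finset.card_le_two
  -- products of involutions
  have disj : ∀ u ∈ I, ∀ v ∈ I, u * v ∉ I := by
    intro u hu v hv huv
    rw [memI] at *
    have hvi : v⁻¹ = v := inv_eq_of_mul_eq_one_left hv.2
    have hui : u⁻¹ = u := inv_eq_of_mul_eq_one_left hu.2
    have hc : v * u = u * v := by
      have : (u * v)⁻¹ = u * v := inv_eq_of_mul_eq_one_left huv.2
      rw [mul_inv_rev, hvi, hui] at this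
      exact this
    rcases hI u v hu.1 hu.2 hc with h | h
    · exact hv.1 h
    · rw [h] at huv; exact huv.1 hu.2
  have key : ∀ u ∈ I, ∀ s, s ∉ I → u * s ∈ I := by
    intro u hu s hs
    have h1 : I.image (fun v => u * v) ⊆ Iᶜ := by
      intro w hw
      obtain ⟨v, hv, rfl⟩ := Finset.mem_image.1 hw
      simpa using disj u hu v hv
    have h2 : (I.image (fun v => u * v)).card = I.card :=
      Finset.card_image_of_injective _ (mul_right_injective u)
    have h3 : I.image (fun v => u * v) = Iᶜ := by
      apply Finset.eq_of_subset_of_card_le h1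
      rw [h2, Finset.card_compl]; omega
    have h4 : s ∈ I.image (fun v => u * v) := by rw [h3]; simpa using hs
    obtain ⟨v, hv, rfl⟩ := Finset.mem_image.1 h4
    have : u * (u * v) = v := by rw [← mul_assoc, ((memI u).1 hu).2, one_mul]
    simpa [this] using hv
  have inv : ∀ u ∈ I, ∀ s, s ∉ I → u * s = s⁻¹ * u := by
    intro u hu s hs
    have h1 := ((memI _).1 (key u hu s hs)).2
    have hui : u⁻¹ = u := inv_eq_of_mul_eq_one_left ((memI u).1 hu).2
    have : (u * s)⁻¹ = u * s := inv_eq_of_mul_eq_one_left h1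
    rw [mul_inv_rev, hui] at this
    exact this.symm
  have hrI : r ∉ I := by rw [memI]; exact hr
  have hu0 : u₀ ∈ I := (memI _).2 ⟨hu₀, hu₀'⟩
  by_cases hg : g ∈ I
  · right; exact inv g hg r hrI
  · left
    have h1 := inv _ (key u₀ hu0 g hg) r hrI
    -- u0 g r = r⁻¹ u0 g = u0 r g
    have h3 : u₀ * (g * r) = u₀ * (r * g) := by
      have h4 := inv _ hu0 r hrI
      rw [← mul_assoc, h1, ← mul_assoc, ← mul_assoc, h4]
    exact mul_left_cancel h3

lemma count_lemma {G : Type*} [Group G] [Fintype G] [DecidableEq G]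
    (hCT : ∀ a b c : G, b ≠ 1 → a * b = b * a → b * c = c * b → a * c = c * a)
    (hSN : ∀ a h : G, (h * a * h⁻¹) * a = a * (h * a * h⁻¹) → h * a = a * h)
    (r : G) (hr : r ≠ 1) (A X : Finset G) (hA : ∀ x, x ∈ A ↔ r * x = x * r)
    (hX : ∀ x, x ∈ X ↔ x ≠ 1 ∧ ∃ g : G, g * x * g⁻¹ ∈ A) :
    Fintype.card G * (A.card - 1) = A.card * X.card := by
  classical
  set D : Finset (G × G) := Finset.univ ×ˢ (A.erase 1) with hD
  have h1A : (1 : G) ∈ A := by rw [hA]; simp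
  have hDc : D.card = Fintype.card G * (A.card - 1) := by
    rw [hD, Finset.card_product, Finset.card_erase_of_mem h1A, Finset.card_univ]
  have him : D.image (fun x => x.1 * x.2 * x.1⁻¹) = X := by
    ext x
    simp only [Finset.mem_image, hD, Finset.mem_product, Finset.mem_univ, true_and, Finset.mem_erase,
      Prod.exists, hX]
    constructor
    · rintro ⟨g, a, ⟨h1, h2⟩, rfl⟩
      refine ⟨by simpa using h1, g⁻¹, ?_⟩
      convert h2 using 1; group
    · rintro ⟨h1, g, h2⟩
      refine ⟨g⁻¹, _, ⟨?_, h2⟩, by group⟩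
      simpa using h1
  have fib : ∀ y ∈ D.image (fun x => x.1 * x.2 * x.1⁻¹),
      (D.filter (fun x => x.1 * x.2 * x.1⁻¹ = y)).card = A.card := by
    intro y hy
    obtain ⟨⟨g, a⟩, hga, rfl⟩ := Finset.mem_image.1 hy
    simp only [hD, Finset.mem_product, Finset.mem_univ, true_and, Finset.mem_erase] at hga
    have haA := (hA a).1 hga.2
    have : D.filter (fun x => x.1 * x.2 * x.1⁻¹ = g * a * g⁻¹) = A.image (fun b => (g * b, a)) := by
      ext ⟨k, b⟩
      simp only [hD, Finset.mem_filter, Finset.mem_product, Finset.mem_univ, true_and,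
        Finset.mem_erase, Finset.mem_image, Prod.mk.injEq]
      constructor
      · rintro ⟨⟨hb1, hbA⟩, he⟩
        rw [hA] at hbA
        have e1 : (g⁻¹ * k) * b * (g⁻¹ * k)⁻¹ = a := by
          calc _ = g⁻¹ * (k * b * k⁻¹) * g := by group
            _ = g⁻¹ * (g * a * g⁻¹) * g := by rw [he]
            _ = a := by group
        have e2 : a * b = b * a := hCT a r b hr haA.symm hbA
        have e3 := hSN b (g⁻¹ * k) (by rw [e1]; exact e2)
        have e4 : b = a := by rw [e3] at e1; rw [← e1]; group
        refine ⟨g⁻¹ * k, ?_, by group, e4.symm⟩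
        rw [hA]
        exact hCT r b _ hb1 hbA e3.symm
      · rintro ⟨c, hc, rfl, rfl⟩
        refine ⟨hga, ?_⟩
        have : a * c = c * a := hCT a r c hr haA.symm ((hA c).1 hc)
        calc g * c * a * (g * c)⁻¹ = g * (c * a) * c⁻¹ * g⁻¹ := by group
          _ = g * (a * c) * c⁻¹ * g⁻¹ := by rw [this]
          _ = _ := by group
    rw [this]
    apply Finset.card_image_of_injective
    intro b c h
    simpa using h
  have l1 := Finset.card_le_mul_card_image D A.card (fun y hy => (fib y hy).le)
  have l2 := Finset.mul_card_image_le_card D A.card (fun y hy => (fib y hy).ge)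
  rw [him] at l1 l2
  rw [← hDc]; omega

lemma abelian_lemma {G : Type*} [Group G] [Finite G]
    (hCT : ∀ a b c : G, b ≠ 1 → a * b = b * a → b * c = c * b → a * c = c * a)
    (hSN : ∀ a h : G, (h * a * h⁻¹) * a = a * (h * a * h⁻¹) → h * a = a * h)
    (r g : G) : r * g = g * r := by
  classical
  have := Fintype.ofFinite G
  by_cases hr : r = 1
  · simp [hr]
  set C : G → Finset G := fun s => Finset.univ.filter (fun x => s * x = x * s) with hC
  set X : G → Finset G := fun s => Finset.univ.filter (fun x => x ≠ 1 ∧ ∃ k : G, k * x * k⁻¹ ∈ C s)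
    with hX
  have memC : ∀ s x, x ∈ C s ↔ s * x = x * s := by intro s x; simp [hC]
  have memX : ∀ s x, x ∈ X s ↔ x ≠ 1 ∧ ∃ k : G, k * x * k⁻¹ ∈ C s := by intro s x; simp [hX]
  have cnt : ∀ s, s ≠ 1 → Fintype.card G * ((C s).card - 1) = (C s).card * (X s).card :=
    fun s hs => count_lemma hCT hSN s hs _ _ (memC s) (memX s)
  have two : ∀ s, s ≠ 1 → 2 ≤ (C s).card := by
    intro s hs
    have : ({1, s} : Finset G) ⊆ C s := by
      intro x hx
      simp only [Finset.mem_insert, Finset.mem_singleton] at hx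
      rw [memC]; rcases hx with rfl | rfl <;> simp
    rw [← Finset.card_pair (Ne.symm hs)]
    exact Finset.card_le_card this
  have half : ∀ s, s ≠ 1 → Fintype.card G ≤ 2 * (X s).card := by
    intro s hs
    have h1 := cnt s hs
    have h2 := two s hs
    obtain ⟨m, hm⟩ := Nat.exists_eq_add_of_le h2
    rw [hm] at h1
    have h3 : 2 + m - 1 = m + 1 := by omega
    rw [h3] at h1
    by_contra hlt
    push Not at hlt
    nlinarith
  have cpos : 0 < Fintype.card G := Fintype.card_pos
  have sub1 : ∀ s, X s ⊆ Finset.univ.erase 1 := by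
    intro s x hx
    rw [memX] at hx
    simpa using hx.1
  have hall : X r = Finset.univ.erase 1 := by
    apply Finset.Subset.antisymm (sub1 r)
    intro s hs
    have hs1 : s ≠ 1 := by simpa using hs
    by_contra hsX
    have hdis : Disjoint (X r) (X s) := by
      rw [Finset.disjoint_left]
      intro x hx hx'
      rw [memX] at hx hx'
      obtain ⟨hx1, k, hk⟩ := hx
      obtain ⟨-, l, hl⟩ := hx'
      rw [memC] at hk hl
      apply hsX
      rw [memX]
      refine ⟨hs1, k * l⁻¹, ?_⟩
      rw [memC]
      apply hCT r (k * x * k⁻¹) _ (by simpa using hx1) hk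
      calc k * x * k⁻¹ * (k * l⁻¹ * s * (k * l⁻¹)⁻¹)
          = k * l⁻¹ * ((l * x * l⁻¹) * s) * (k * l⁻¹)⁻¹ := by group
        _ = k * l⁻¹ * (s * (l * x * l⁻¹)) * (k * l⁻¹)⁻¹ := by rw [hl]
        _ = _ := by group
    have h1 := Finset.card_le_card (Finset.union_subset (sub1 r) (sub1 s))
    rw [Finset.card_union_of_disjoint hdis, Finset.card_erase_of_mem (Finset.mem_univ _),
      Finset.card_univ] at h1
    have := half r hr
    have := half s hs1
    omega
  have h1 := cnt r hr
  rw [hall, Finset.card_erase_of_mem (Finset.mem_univ _), Finset.card_univ] at h1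
  have h2 := two r hr
  have h3 : (C r).card = Fintype.card G := by
    obtain ⟨m, hm⟩ := Nat.exists_eq_add_of_le h2
    obtain ⟨n, hn⟩ := Nat.exists_eq_add_of_le cpos
    rw [hm, hn] at h1 ⊢
    have e1 : 2 + m - 1 = m + 1 := by omega
    have e2 : 0 + 1 + n - 1 = n := by omega
    simp only [Nat.succ_eq_add_one] at *
    rw [e1, e2] at h1
    nlinarith
  have h4 : C r = Finset.univ := (Finset.card_eq_iff_eq_univ _).1 h3
  rw [← memC, h4]; simp

lemma solv_of {G : Type*} [Group G] (H K : Subgroup G)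
    (h1 : ∀ g ∈ H, ∀ h ∈ H, g * h * g⁻¹ * h⁻¹ ∈ K)
    (h2 : ∀ k ∈ K, ∀ l ∈ K, k * l = l * k) :
    Group.IsSolvable H := by
  refine ⟨⟨2, ?_⟩⟩
  have e1 : ∀ x ∈ derivedSeries H 1, (x : G) ∈ K := by
    intro x hx
    have : derivedSeries H 1 ≤ K.comap H.subtype := by
      rw [derivedSeries_succ, Subgroup.commutator_le]
      intro a _ b _
      exact h1 a a.2 b b.2
    exact this hx
  rw [derivedSeries_succ, eq_bot_iff, Subgroup.commutator_le]
  intro a ha b hb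
  rw [Subgroup.mem_bot, commutatorElement_eq_one_iff_mul_comm]
  exact Subtype.ext (h2 a (e1 a ha) b (e1 b hb))

end PSLaux
namespace PSLaux

variable {F : Type*} [Field F]

def Bz (F : Type*) [Field F] : Subgroup (S F) where
  carrier := {g | g 1 0 = 0}
  one_mem' := by simp
  mul_mem' := by
    intro a b ha hb
    simp only [Set.mem_ofPred_eq] at *
    rw [m10, ha, hb]; ring
  inv_mem' := by
    intro a ha
    simp only [Set.mem_ofPred_eq] at *
    rw [i10, ha]; ring

lemma mem_Bz {g : S F} : g ∈ Bz F ↔ g 1 0 = 0 := Iff.rfl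

def Uz (F : Type*) [Field F] : Subgroup (S F) where
  carrier := {g | g 1 0 = 0 ∧ g 0 0 = 1 ∧ g 1 1 = 1}
  one_mem' := by simp
  mul_mem' := by
    rintro a b ⟨h1, h2, h3⟩ ⟨h4, h5, h6⟩
    simp only [Set.mem_ofPred_eq, m00, m10, m11] at *
    simp [*]
  inv_mem' := by
    rintro a ⟨h1, h2, h3⟩
    simp only [Set.mem_ofPred_eq, i00, i10, i11] at *
    simp [*]

lemma mem_Uz {g : S F} : g ∈ Uz F ↔ g 1 0 = 0 ∧ g 0 0 = 1 ∧ g 1 1 = 1 := Iff.rfl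

def Bor (k : S F) : Subgroup (S F) := (Bz F).comap (MulAut.conj k⁻¹).toMonoidHom

lemma mem_Bor {k g : S F} : g ∈ Bor k ↔ (k⁻¹ * g * k) 1 0 = 0 := by
  simp [Bor, mem_Bz]

lemma Bor_solv (k : S F) : Group.IsSolvable (Bor k) := by
  apply solv_of _ ((Uz F).comap (MulAut.conj k⁻¹).toMonoidHom)
  · intro g hg h hh
    have hg : MulAut.conj k⁻¹ g ∈ Bz F := hg
    have hh : MulAut.conj k⁻¹ h ∈ Bz F := hh
    change MulAut.conj k⁻¹ (g * h * g⁻¹ * h⁻¹) ∈ Uz F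
    generalize MulAut.conj k⁻¹ = φ at *
    simp only [map_mul, map_inv]
    generalize φ g = a at *
    generalize φ h = b at *
    have da := sdet a
    have db := sdet b
    rw [mem_Bz] at hg hh
    simp only [mem_Uz, m00, m01, m10, m11, i00, i01, i10, i11, hg, hh] at *
    refine ⟨?_, ?_, ?_⟩ <;> grind
  · intro g hg h hh
    have hg : MulAut.conj k⁻¹ g ∈ Uz F := hg
    have hh : MulAut.conj k⁻¹ h ∈ Uz F := hh
    generalize MulAut.conj k⁻¹ = φ at *
    apply φ.injective
    simp only [map_mul]
    generalize φ g = a at *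
    generalize φ h = b at *
    rw [mem_Uz] at hg hh
    simp only [sext, m00, m01, m10, m11, hg, hh] at *
    simp [add_comm]

def Nr (r : S F) : Subgroup (S F) where
  carrier := {g | g * r = r * g ∨ g * r = r⁻¹ * g}
  one_mem' := by simp
  mul_mem' := by
    rintro a b ha hb
    have e : ∀ a : S F, a * r = r⁻¹ * a → a * r⁻¹ = r * a := by
      intro a h
      have := congrArg (fun x => r * x * r⁻¹) h
      simp only [mul_assoc, mul_inv_cancel, mul_one, mul_inv_cancel_left] at this
      exact this.symm
    have e' : ∀ a : S F, a * r = r * a → a * r⁻¹ = r⁻¹ * a := by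
      intro a h
      exact (Commute.inv_right (h : Commute a r) : a * r⁻¹ = r⁻¹ * a)
    simp only [Set.mem_ofPred_eq] at *
    rcases ha with ha | ha <;> rcases hb with hb | hb
    · left; rw [mul_assoc, hb, ← mul_assoc, ha, mul_assoc]
    · right; rw [mul_assoc, hb, ← mul_assoc, e' a ha, mul_assoc]
    · right; rw [mul_assoc, hb, ← mul_assoc, ha, mul_assoc]
    · left; rw [mul_assoc, hb, ← mul_assoc, e a ha, mul_assoc]
  inv_mem' := by
    rintro a (ha | ha)
    · left
      exact (Commute.inv_left (ha : Commute a r) : a⁻¹ * r = r * a⁻¹)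
    · right
      rw [inv_mul_eq_iff_eq_mul, ← mul_assoc, eq_mul_inv_iff_mul_eq]
      have := congrArg (fun x => r * x * r⁻¹) ha
      simp only [mul_assoc, mul_inv_cancel, mul_one, mul_inv_cancel_left] at this
      exact this

lemma mem_Nr {r g : S F} : g ∈ Nr r ↔ (g * r = r * g ∨ g * r = r⁻¹ * g) := Iff.rfl

lemma Nr_iff {r g : S F} : g ∈ Nr r ↔ (g * r * g⁻¹ = r ∨ g * r * g⁻¹ = r⁻¹) := by
  rw [mem_Nr, mul_inv_eq_iff_eq_mul, mul_inv_eq_iff_eq_mul]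

lemma Nr_solv (h2 : (2 : F) = 0) {r : S F} (hr : tr r ≠ 0) : Group.IsSolvable (Nr r) := by
  apply solv_of _ (Subgroup.centralizer {r})
  · intro g hg h hh
    have aux : ∀ a ∈ Nr r, (a⁻¹ * r * a = r ∧ a * r * a⁻¹ = r) ∨
        (a⁻¹ * r * a = r⁻¹ ∧ a * r * a⁻¹ = r⁻¹) := by
      intro a ha
      rw [Nr_iff] at ha
      rcases ha with h | h
      · left; refine ⟨?_, h⟩
        nth_rewrite 1 [← h]; group
      · right; refine ⟨?_, h⟩
        have : r = (a * r * a⁻¹)⁻¹ := by rw [h, inv_inv]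
        nth_rewrite 1 [this]; group
    rw [Subgroup.mem_centralizer_singleton_iff]
    suffices g * h * g⁻¹ * h⁻¹ * r * (g * h * g⁻¹ * h⁻¹)⁻¹ = r from mul_inv_eq_iff_eq_mul.1 this
    have e : g * h * g⁻¹ * h⁻¹ * r * (g * h * g⁻¹ * h⁻¹)⁻¹ =
      g * (h * (g⁻¹ * (h⁻¹ * r * h) * g) * h⁻¹) * g⁻¹ := by group
    have ci : ∀ a b : S F, (a * b⁻¹ * a⁻¹) = (a * b * a⁻¹)⁻¹ := by intros; group
    have ci' : ∀ a b : S F, (a⁻¹ * b⁻¹ * a) = (a⁻¹ * b * a)⁻¹ := by intros; group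
    rw [e]
    rcases aux g hg with ⟨a1, a2⟩ | ⟨a1, a2⟩ <;> rcases aux h hh with ⟨b1, b2⟩ | ⟨b1, b2⟩ <;>
      simp only [a1, a2, b1, b2, ci, ci', inv_inv]
  · intro k hk l hl
    rw [Subgroup.mem_centralizer_singleton_iff] at hk hl
    exact CT h2 hr hk hl.symm

/-- generation by elementary matrices -/
lemma gen_top (H : Subgroup (S F)) (hu : ∀ g : S F, g 0 0 = 1 → g 1 1 = 1 → g 1 0 = 0 → g ∈ H)
    (hl : ∀ g : S F, g 0 0 = 1 → g 1 1 = 1 → g 0 1 = 0 → g ∈ H) : H = ⊤ := by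
  have key : ∀ g : S F, g 1 0 ≠ 0 → g ∈ H := by
    intro g hg
    have dg := sdet g
    have : g = mk2 1 ((g 0 0 - 1) / g 1 0) 0 1 (by ring) * mk2 1 0 (g 1 0) 1 (by ring) *
        mk2 1 ((g 1 1 - 1) / g 1 0) 0 1 (by ring) := by
      rw [sext]
      simp only [m00, m01, m10, m11, mk2_00, mk2_01, mk2_10, mk2_11]
      refine ⟨?_, ?_, ?_, ?_⟩ <;> field_simp <;> grind
    rw [this]
    exact H.mul_mem (H.mul_mem (hu _ rfl rfl rfl) (hl _ rfl rfl rfl)) (hu _ rfl rfl rfl)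
  rw [eq_top_iff]
  intro g _
  by_cases hg : g 1 0 = 0
  · have dg := sdet g
    have h1 : mk2 1 0 1 1 (by ring) ∈ H := hl _ rfl rfl rfl
    have h3 : mk2 1 0 1 1 (by ring) * g ∈ H := by
      apply key
      simp only [m10, mk2_10, mk2_11]
      grind
    exact (H.mul_mem_cancel_left h1).1 h3
  · exact key g hg

open scoped commutatorElement in
lemma not_solv (h2 : (2 : F) = 0) (lam : F) (h0 : lam ≠ 0) (h1 : lam ≠ 1) :
    ¬ Group.IsSolvable (S F) := by
  intro hs
  have : Nontrivial (S F) := ⟨1, mk2 1 1 0 1 (by ring), by rw [Ne, sext]; simp⟩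
  apply (Group.IsSolvable.commutator_lt_top_of_nontrivial (S F)).ne
  have hl2 : lam ^ 2 - 1 ≠ 0 := by
    intro h; exact h1 (sq_one h2 (by linear_combination h))
  have hl3 : lam⁻¹ ^ 2 - 1 ≠ 0 := by
    intro h; apply h1; have := sq_one h2 (a := lam⁻¹) (by linear_combination h); simpa using this
  apply gen_top
  · intro g g0 g1 g2
    have : g = ⁅mk2 lam 0 0 lam⁻¹ (by field_simp; ring), mk2 1 (g 0 1 / (lam ^ 2 - 1)) 0 1 (by ring)⁆ := by
      rw [sext, commutatorElement_def]
      simp only [m00, m01, m10, m11, i00, i01, i10, i11, mk2_00, mk2_01, mk2_10, mk2_11]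
      refine ⟨?_, ?_, ?_, ?_⟩ <;> field_simp <;> grind
    rw [this]
    exact Subgroup.commutator_mem_commutator (Subgroup.mem_top _) (Subgroup.mem_top _)
  · intro g g0 g1 g2
    have : g = ⁅mk2 lam 0 0 lam⁻¹ (by field_simp; ring), mk2 1 0 (g 1 0 / (lam⁻¹ ^ 2 - 1)) 1 (by ring)⁆ := by
      rw [sext, commutatorElement_def]
      simp only [m00, m01, m10, m11, i00, i01, i10, i11, mk2_00, mk2_01, mk2_10, mk2_11]
      refine ⟨?_, ?_, ?_, ?_⟩ <;> grind
    rw [this]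
    exact Subgroup.commutator_mem_commutator (Subgroup.mem_top _) (Subgroup.mem_top _)

end PSLaux
namespace PSLaux

variable {F : Type*} [Field F]

/-- conjugate subgroup -/
def cj (k : S F) (H : Subgroup (S F)) : Subgroup (S F) := H.comap (MulAut.conj k).toMonoidHom

lemma mem_cj {k g : S F} {H : Subgroup (S F)} : g ∈ cj k H ↔ k * g * k⁻¹ ∈ H := by
  simp [cj]

lemma cj_top {k : S F} {H : Subgroup (S F)} (h : cj k H = ⊤) : H = ⊤ := by
  rw [eq_top_iff]
  intro g _
  have : k⁻¹ * g * k ∈ cj k H := by rw [h]; trivial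
  rw [mem_cj] at this
  convert this using 1; group

lemma mem_cj' {k g : S F} {H : Subgroup (S F)} (hg : g ∈ H) : k⁻¹ * g * k ∈ cj k H := by
  rw [mem_cj]; convert hg using 1; group

/-- unipotents -/
def up (a : F) : S F := mk2 1 a 0 1 (by ring)
def lo (a : F) : S F := mk2 1 0 a 1 (by ring)

lemma swap_mem [Finite F] (h2 : (2 : F) = 0) (H : Subgroup (S F)) {a b : F} (ha : a ≠ 0) (hb : b ≠ 0)
    (hu : up a ∈ H) (hl : lo b ∈ H) :
    ∃ w ∈ H, w 0 0 = 0 ∧ w 1 1 = 0 ∧ w 0 1 * w 1 0 = -1 ∧ w 1 0 * a = b * w 0 1 := by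
  set s := up a * lo b with hs
  have hsH : s ∈ H := H.mul_mem hu hl
  have hts : tr s ≠ 0 := by
    have : tr s = a * b := by
      simp only [hs, tr, m00, m11, up, lo, mk2_00, mk2_01, mk2_10, mk2_11]; linear_combination h2
    rw [this]; exact mul_ne_zero ha hb
  obtain ⟨k, hk⟩ := odd_order h2 hts
  set z := s ^ (k + 1) with hz
  have hzs : z * z = s := by
    rw [hz, ← pow_add, show k + 1 + (k + 1) = orderOf s + 1 by omega, pow_succ, pow_orderOf_eq_one,
      one_mul]
  have huu : up a * up a = 1 := by
    apply sq_of_tr h2; simp only [tr, up, mk2_00, mk2_11]; linear_combination h2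
  have hll : lo b * lo b = 1 := by
    apply sq_of_tr h2; simp only [tr, lo, mk2_00, mk2_11]; linear_combination h2
  have hui : (up a)⁻¹ = up a := inv_eq_of_mul_eq_one_left huu
  have hli : (lo b)⁻¹ = lo b := inv_eq_of_mul_eq_one_left hll
  have hus : up a * s * (up a)⁻¹ = s⁻¹ := by
    rw [hs, mul_inv_rev, hui, hli, ← mul_assoc, huu, one_mul]
  have huz : up a * z * (up a)⁻¹ = z⁻¹ := by
    rw [hz, ← conj_pow, hus, inv_pow]
  have huz' : up a * z = z⁻¹ * up a := mul_inv_eq_iff_eq_mul.1 huz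
  set w := up a * z with hw
  have hwH : w ∈ H := H.mul_mem hu (H.pow_mem hsH _)
  have e1 : w * lo b = up a * w := by
    have : up a * s = lo b := by rw [hs, ← mul_assoc, huu, one_mul]
    have e3 : z⁻¹ * s = z := by rw [← hzs]; group
    calc w * lo b = z⁻¹ * up a * lo b := by rw [huz']
      _ = z⁻¹ * s := by rw [mul_assoc]
      _ = z := e3
      _ = up a * up a * z := by rw [huu, one_mul]
      _ = up a * w := by rw [hw, mul_assoc]
  have hww : w * w = 1 := by
    calc w * w = z⁻¹ * up a * (up a * z) := by rw [← huz', hw]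
      _ = z⁻¹ * (up a * up a) * z := by group
      _ = 1 := by rw [huu]; group
  have htw := tr_of_sq h2 hww
  have dw := sdet w
  refine ⟨w, hwH, ?_⟩
  clear_value w
  simp only [sext, m00, m01, m10, m11, up, lo, mk2_00, mk2_01, mk2_10, mk2_11, tr] at e1 htw
  have h11 : w 1 1 = 0 := by
    apply mul_left_cancel₀ ha; linear_combination -e1.2.1
  have h00 : w 0 0 = 0 := by linear_combination htw - h11
  refine ⟨h00, h11, ?_, ?_⟩
  · rw [h00, h11] at dw; linear_combination -dw
  · linear_combination -e1.1

/-- subfield produced by a subgroup -/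
lemma closed [Finite F] (h2 : (2 : F) = 0) (H : Subgroup (S F)) {b : F} (hb : b ≠ 0) (hl : lo b ∈ H)
    {a a' c : F} (ha : a ≠ 0) (ha' : a' ≠ 0) (hu : up a ∈ H) (hu' : up a' ∈ H) (hc : up c ∈ H) :
    up (c * a / a') ∈ H := by
  obtain ⟨w, hw, w1, w2, w3, w4⟩ := swap_mem h2 H ha hb hu hl
  obtain ⟨v, hv, v1, v2, v3, v4⟩ := swap_mem h2 H ha' hb hu' hl
  have : up (c * a / a') = (w * v) * up c * (w * v)⁻¹ := by
    simp only [sext, m00, m01, m10, m11, i00, i01, i10, i11, up, mk2_00, mk2_01, mk2_10, mk2_11,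
      w1, w2, v1, v2]
    have w5 : w 0 1 ≠ 0 := by rintro h; rw [h] at w3; simp at w3
    have v5 : v 0 1 ≠ 0 := by rintro h; rw [h] at v3; simp at v3
    have w6 : w 1 0 = -1 / w 0 1 := by field_simp; linear_combination w3
    have v6 : v 1 0 = -1 / v 0 1 := by field_simp; linear_combination v3
    rw [w6] at *
    rw [v6] at *
    field_simp at w4 v4
    refine ⟨?_, ?_, ?_, ?_⟩ <;> field_simp
    · ring
    · grind
    · ring
    · ring
  rw [this]
  exact H.mul_mem (H.mul_mem (H.mul_mem hw hv) hc) (H.inv_mem (H.mul_mem hw hv))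

lemma up_add (a b : F) : up (a + b) = up a * up b := by
  simp only [sext, m00, m01, m10, m11, up, mk2_00, mk2_01, mk2_10, mk2_11]
  refine ⟨?_, ?_, ?_, ?_⟩ <;> ring

lemma up_neg (a : F) : up (-a) = (up a)⁻¹ := by
  simp only [sext, i00, i01, i10, i11, up, mk2_00, mk2_01, mk2_10, mk2_11]
  simp

lemma up_zero : up (0 : F) = 1 := by
  simp only [sext, up, mk2_00, mk2_01, mk2_10, mk2_11, o00, o01, o10, o11]
  simp

lemma core [Finite F] (h2 : (2 : F) = 0)
    (hF : ∀ K : Subfield F, (∃ k ∈ K, k ≠ 0 ∧ k ≠ 1) → K = ⊤)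
    (H : Subgroup (S F)) {a a' b : F} (ha : a ≠ 0) (ha' : a' ≠ 0) (haa : a ≠ a') (hb : b ≠ 0)
    (hu : up a ∈ H) (hu' : up a' ∈ H) (hl : lo b ∈ H) : H = ⊤ := by
  let K : Subfield F :=
    { carrier := {k | up (k * a) ∈ H}
      one_mem' := by simpa using hu
      zero_mem' := by simp [up_zero, H.one_mem]
      add_mem' := by
        intro x y hx hy
        simp only [Set.mem_ofPred_eq] at *
        rw [add_mul, up_add]; exact H.mul_mem hx hy
      neg_mem' := by
        intro x hx
        simp only [Set.mem_ofPred_eq] at *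
        rw [neg_mul, up_neg]; exact H.inv_mem hx
      mul_mem' := by
        intro x y hx hy
        simp only [Set.mem_ofPred_eq] at *
        by_cases hy0 : y = 0
        · simp [hy0, up_zero, H.one_mem]
        have := closed h2 H hb hl (mul_ne_zero hy0 ha) ha hy hu hx
        convert this using 2; field_simp
      inv_mem' := by
        intro x hx
        simp only [Set.mem_ofPred_eq] at *
        by_cases hx0 : x = 0
        · simp [hx0, up_zero, H.one_mem]
        have := closed h2 H hb hl ha (mul_ne_zero hx0 ha) hu hx hu
        convert this using 2; field_simp }
  have hK : K = ⊤ := by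
    apply hF
    refine ⟨a' / a, ?_, div_ne_zero ha' ha, ?_⟩
    · change up (a' / a * a) ∈ H
      rwa [div_mul_cancel₀ _ ha]
    · rw [Ne, div_eq_one_iff_eq ha]; exact haa.symm
  have hall : ∀ c, up c ∈ H := by
    intro c
    have : c / a ∈ K := by rw [hK]; trivial
    have : up (c / a * a) ∈ H := this
    rwa [div_mul_cancel₀ _ ha] at this
  obtain ⟨w, hw, w1, w2, w3, w4⟩ := swap_mem h2 H ha hb hu hl
  apply gen_top
  · intro g g1 g2 g3
    have : g = up (g 0 1) := by rw [sext]; simp [up, g1, g2, g3]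
    rw [this]; exact hall _
  · intro g g1 g2 g3
    have : g = w * up (g 1 0 * w 0 1 ^ 2 * (-1)) * w⁻¹ := by
      simp only [sext, m00, m01, m10, m11, i00, i01, i10, i11, up, mk2_00, mk2_01, mk2_10, mk2_11,
        w1, w2, g1, g2, g3]
      refine ⟨?_, ?_, ?_, ?_⟩ <;> grind
    rw [this]
    exact H.mul_mem (H.mul_mem hw (hall _)) (H.inv_mem hw)

lemma core2 [Finite F] (h2 : (2 : F) = 0)
    (hF : ∀ K : Subfield F, (∃ k ∈ K, k ≠ 0 ∧ k ≠ 1) → K = ⊤)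
    (H : Subgroup (S F)) {a a' : F} (ha : a ≠ 0) (ha' : a' ≠ 0) (haa : a ≠ a')
    (hu : up a ∈ H) (hu' : up a' ∈ H) (g : S F) (hg : g ∈ H) (hg1 : g 1 0 ≠ 0) : H = ⊤ := by
  set c := g 0 0 / g 1 0 with hc
  apply cj_top (k := up c)
  have hup : ∀ x, up x ∈ H → up x ∈ cj (up c) H := by
    intro x hx
    rw [mem_cj, ← up_neg, ← up_add, ← up_add]
    simpa using hx
  have hg' := mem_cj' (k := up c) hg
  have dg := sdet g
  apply core h2 hF (cj (up c) H) ha ha' haa (b := -a * g 1 0 ^ 2)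
    (mul_ne_zero (neg_ne_zero.2 ha) (pow_ne_zero _ hg1)) (hup _ hu) (hup _ hu')
  have : lo (-a * g 1 0 ^ 2) = ((up c)⁻¹ * g * up c) * up a * ((up c)⁻¹ * g * up c)⁻¹ := by
    simp only [sext, m00, m01, m10, m11, i00, i01, i10, i11, up, lo, mk2_00, mk2_01, mk2_10, mk2_11, hc]
    refine ⟨?_, ?_, ?_, ?_⟩ <;> field_simp <;> grind
  rw [this]
  exact (cj (up c) H).mul_mem ((cj (up c) H).mul_mem hg' (hup _ hu)) ((cj (up c) H).inv_mem hg')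

lemma normal_form (h2 : (2 : F) = 0) (u : S F) (hu : u ≠ 1) (ht : tr u = 0) :
    ∃ (k : S F) (a : F), a ≠ 0 ∧ k⁻¹ * u * k = up a := by
  obtain ⟨k, hk⟩ : ∃ k : S F, (k⁻¹ * u * k) 1 0 = 0 := by
    by_cases h : u 1 0 = 0
    · exact ⟨1, by simpa using h⟩
    · refine ⟨mk2 (u 0 0 - 1) (-1 / u 1 0) (u 1 0) 0 (by field_simp; ring), ?_⟩
      have du := sdet u
      simp only [tr, m10, m11, i10, i11, mk2_00, mk2_10] at *
      grind
  have h1 : tr (k⁻¹ * u * k) = 0 := by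
    have := tr_conj k⁻¹ u
    rw [inv_inv] at this; rw [this, ht]
  have hne : k⁻¹ * u * k ≠ 1 := by
    intro h; apply hu
    have : u = k * (k⁻¹ * u * k) * k⁻¹ := by group
    rw [this, h]; group
  have d := sdet (k⁻¹ * u * k)
  refine ⟨k, (k⁻¹ * u * k) 0 1, ?_⟩
  generalize k⁻¹ * u * k = v at *
  have h00 : v 0 0 = 1 := sq_one h2 (by simp only [tr] at h1; grind)
  have h11 : v 1 1 = 1 := by simp only [tr] at h1; grind
  have hv : v = up (v 0 1) := by rw [sext]; simp [up, h00, h11, hk]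
  refine ⟨?_, hv⟩
  intro h; rw [h, up_zero] at hv; exact hne hv

theorem classification [Finite F] (h2 : (2 : F) = 0)
    (hF : ∀ K : Subfield F, (∃ k ∈ K, k ≠ 0 ∧ k ≠ 1) → K = ⊤)
    (H : Subgroup (S F)) (hH : H ≠ ⊤) :
    (∃ k, H ≤ Bor k) ∨ (∃ r, tr r ≠ 0 ∧ H ≤ Nr r) := by
  by_contra hcon
  push Not at hcon
  obtain ⟨hB, hN⟩ := hcon
  by_cases hI : ∃ u ∈ H, u ≠ 1 ∧ tr u = 0
  · obtain ⟨u₀, hu₀, hu₀1, hu₀t⟩ := hI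
    -- involutions are self centralising
    have hcent : ∀ u ∈ H, u ≠ 1 → tr u = 0 → ∀ h ∈ H, h * u = u * h → h = 1 ∨ h = u := by
      intro u hu hu1 hut h hh hc
      by_contra hne
      push Not at hne
      obtain ⟨k, a, ha, hk⟩ := normal_form h2 u hu1 hut
      obtain ⟨g, hg, hgB⟩ := SetLike.not_le_iff_exists.1 (hB k)
      rw [mem_Bor] at hgB
      have c1 : (k⁻¹ * h * k) * up a = up a * (k⁻¹ * h * k) := by
        rw [← hk]
        calc k⁻¹ * h * k * (k⁻¹ * u * k) = k⁻¹ * (h * u) * k := by group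
          _ = k⁻¹ * (u * h) * k := by rw [hc]
          _ = _ := by group
      have hh' := mem_cj' (k := k) hh
      have hu' := mem_cj' (k := k) hu
      have hg' := mem_cj' (k := k) hg
      have n1 : k⁻¹ * h * k ≠ 1 := by
        intro e; apply hne.1
        have : h = k * (k⁻¹ * h * k) * k⁻¹ := by group
        rw [this, e]; group
      have n2 : k⁻¹ * h * k ≠ up a := by
        intro e; apply hne.2
        have : h = k * (k⁻¹ * h * k) * k⁻¹ := by group
        rw [this, e, ← hk]; group
      rw [hk] at hu'
      apply hH
      apply cj_top (k := k)
      generalize k⁻¹ * h * k = v at *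
      have dv := sdet v
      have hv : v = up (v 0 1) := by
        simp only [sext, m00, m01, m10, m11, up, mk2_00, mk2_01, mk2_10, mk2_11] at c1 ⊢
        have v10 : v 1 0 = 0 := by apply mul_left_cancel₀ ha; linear_combination -c1.1
        have v0 : v 0 0 = v 1 1 := by apply mul_left_cancel₀ ha; linear_combination c1.2.1
        have v1 : v 1 1 = 1 := sq_one h2 (by grind)
        exact ⟨by rw [v0, v1], trivial, v10, v1⟩
      apply core2 h2 hF _ ha (a' := v 0 1) ?_ ?_ hu' (hv ▸ hh') _ hg' hgB
      · intro e; rw [e, up_zero] at hv; exact n1 hv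
      · intro e; rw [← e] at hv; exact n2 hv
    -- a second involution
    obtain ⟨k, a, ha, hk⟩ := normal_form h2 u₀ hu₀1 hu₀t
    obtain ⟨g, hg, hgB⟩ := SetLike.not_le_iff_exists.1 (hB k)
    rw [mem_Bor] at hgB
    set v := g * u₀ * g⁻¹ with hv
    have hvH : v ∈ H := H.mul_mem (H.mul_mem hg hu₀) (H.inv_mem hg)
    have hv1 : v ≠ 1 := by simpa [hv] using hu₀1
    have hvt : tr v = 0 := by rw [hv, tr_conj]; exact hu₀t
    have hvu : v ≠ u₀ := by
      intro e
      have e1 : g * u₀ = u₀ * g := by rw [hv] at e; exact mul_inv_eq_iff_eq_mul.1 e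
      rcases hcent u₀ hu₀ hu₀1 hu₀t g hg e1 with h | h
      · apply hgB; rw [h]; simp
      · apply hgB; rw [h, hk]; rfl
    have hrH : u₀ * v ∈ H := H.mul_mem hu₀ hvH
    have s1 := sq_of_tr h2 hu₀t
    have s2 := sq_of_tr h2 hvt
    have hrt : tr (u₀ * v) ≠ 0 := by
      intro e
      have s3 := sq_of_tr h2 e
      have hc : v * u₀ = u₀ * v := by
        have : (u₀ * v)⁻¹ = u₀ * v := inv_eq_of_mul_eq_one_left s3
        rw [mul_inv_rev, inv_eq_of_mul_eq_one_left s1, inv_eq_of_mul_eq_one_left s2] at this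
        exact this
      rcases hcent u₀ hu₀ hu₀1 hu₀t v hvH hc with h | h
      · exact hv1 h
      · exact hvu h
    apply hN _ hrt
    intro h hh
    have := dihedral_lemma (G := H) ?_ ⟨u₀, hu₀⟩ ?_ ?_ ⟨u₀ * v, hrH⟩ ?_ ⟨h, hh⟩
    · rw [mem_Nr]
      simpa [Subtype.ext_iff] using this
    · rintro ⟨u, hu⟩ ⟨w, hw⟩ e1 e2 e3
      simp only [Subtype.ext_iff, Subgroup.coe_mul, Subgroup.coe_one, ne_eq] at *
      exact hcent u hu e1 (tr_of_sq h2 e2) w hw e3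
    · simpa [Subtype.ext_iff] using hu₀1
    · simpa [Subtype.ext_iff] using s1
    · rintro ⟨-, e⟩
      apply hrt
      apply tr_of_sq h2
      simpa [Subtype.ext_iff] using e
  · push Not at hI
    by_cases hr : ∃ r ∈ H, r ≠ 1
    · obtain ⟨r, hr, hr1⟩ := hr
      apply hN r (hI r hr hr1)
      intro g hg
      rw [mem_Nr]; left
      have := abelian_lemma (G := H) ?_ ?_ ⟨g, hg⟩ ⟨r, hr⟩
      · simpa [Subtype.ext_iff] using this
      · rintro ⟨a, ha⟩ ⟨b, hb⟩ ⟨c, hc⟩ e1 e2 e3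
        simp only [Subtype.ext_iff, Subgroup.coe_mul, Subgroup.coe_one, ne_eq] at *
        exact CT h2 (hI b hb e1) e2 e3
      · rintro ⟨a, ha⟩ ⟨h, hh⟩ e
        simp only [Subtype.ext_iff, Subgroup.coe_mul, Subgroup.coe_inv] at *
        by_cases ha1 : a = 1
        · simp [ha1]
        have hat := hI a ha ha1
        rcases L1 h2 hat (tr_conj h a).symm e.symm with h1 | h1
        · exact mul_inv_eq_iff_eq_mul.1 h1
        · have ht := L2 h2 hat (mul_inv_eq_iff_eq_mul.1 h1)
          by_cases hh1 : h = 1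
          · simp [hh1]
          · exact absurd ht (hI h hh hh1)
    · push Not at hr
      apply hB 1
      intro g hg
      rw [hr g hg]; exact Subgroup.one_mem _

end PSLaux
namespace PSLaux

lemma solvabilizer_map {G H : Type*} [Group G] [Group H] (e : G ≃* H) (x y : G) :
    e y ∈ solvabilizer (e x) ↔ y ∈ solvabilizer x := by
  have h : Subgroup.closure {e x, e y} = (Subgroup.closure {x, y}).map e.toMonoidHom := by
    rw [MonoidHom.map_closure, Set.image_pair]; rfl
  change Group.IsSolvable _ ↔ Group.IsSolvable _
  rw [h]
  have e' := (Subgroup.closure {x, y}).equivMapOfInjective e.toMonoidHom e.injective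
  constructor
  · intro hs
    exact Group.isSolvable_of_isSolvable_injective (f := e'.toMonoidHom) e'.injective
  · intro hs
    exact Group.isSolvable_of_isSolvable_injective (f := e'.symm.toMonoidHom) e'.symm.injective

lemma solvabilizer_map_eq {G H : Type*} [Group G] [Group H] (e : G ≃* H) {x y : G}
    (h : solvabilizer x = solvabilizer y) : solvabilizer (e x) = solvabilizer (e y) := by
  ext z
  obtain ⟨w, rfl⟩ := e.surjective z
  rw [solvabilizer_map, solvabilizer_map, h]

lemma mem_solvabilizer_of {G : Type*} [Group G] {x y : G} (H : Subgroup G) (hs : Group.IsSolvable H)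
    (hx : x ∈ H) (hy : y ∈ H) : y ∈ solvabilizer x := by
  have hle : Subgroup.closure {x, y} ≤ H := by
    rw [Subgroup.closure_le]
    rintro z (rfl | rfl)
    · exact hx
    · exact hy
  change Group.IsSolvable _
  exact Group.isSolvable_of_isSolvable_injective (f := Subgroup.inclusion hle)
    (Subgroup.inclusion_injective hle)

variable {F : Type*} [Field F]

lemma sol_cases [Finite F] (h2 : (2 : F) = 0)
    (hF : ∀ K : Subfield F, (∃ k ∈ K, k ≠ 0 ∧ k ≠ 1) → K = ⊤)
    (lam : F) (l0 : lam ≠ 0) (l1 : lam ≠ 1) {x y : S F} (h : y ∈ solvabilizer x) :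
    (∃ k, x ∈ Bor k ∧ y ∈ Bor k) ∨ (∃ r, tr r ≠ 0 ∧ x ∈ Nr r ∧ y ∈ Nr r) := by
  have hs : Group.IsSolvable (Subgroup.closure {x, y}) := h
  have hx : x ∈ Subgroup.closure {x, y} := Subgroup.subset_closure (by simp)
  have hy : y ∈ Subgroup.closure {x, y} := Subgroup.subset_closure (by simp)
  have hne : Subgroup.closure {x, y} ≠ ⊤ := by
    intro e
    rw [e] at hs
    apply not_solv h2 lam l0 l1
    exact Group.isSolvable_of_isSolvable_injective (f := (Subgroup.topEquiv (G := S F)).symm.toMonoidHom)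
      (Subgroup.topEquiv (G := S F)).symm.injective
  rcases classification h2 hF _ hne with ⟨k, hk⟩ | ⟨r, hr, hk⟩
  · exact Or.inl ⟨k, hk hx, hk hy⟩
  · exact Or.inr ⟨r, hr, hk hx, hk hy⟩

open Polynomial in
lemma cubic_false [Finite F] (hc : 4 < Nat.card F) (a b c d : F) (hc0 : c ≠ 0)
    (h : ∀ t : F, (c * t ^ 2 + (d - a) * t - b) * (a - t * c) = 0) : False := by
  classical
  have := Fintype.ofFinite F
  set P : F[X] := (C c * X ^ 2 + C (d - a) * X + C (-b)) * (C (-c) * X + C a) with hP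
  have d1 : (C c * X ^ 2 + C (d - a) * X + C (-b)).natDegree = 2 := natDegree_quadratic hc0
  have d2 : (C (-c) * X + C a).natDegree = 1 := natDegree_linear (neg_ne_zero.2 hc0)
  have n1 : (C c * X ^ 2 + C (d - a) * X + C (-b)) ≠ 0 := by
    intro e; rw [e] at d1; simp at d1
  have n2 : (C (-c) * X + C a) ≠ 0 := by
    intro e; rw [e] at d2; simp at d2
  have n3 : P ≠ 0 := mul_ne_zero n1 n2
  apply n3
  apply Polynomial.eq_zero_of_natDegree_lt_card_of_eval_eq_zero P (f := (id : F → F)) Function.injective_id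
  · intro t
    rw [← h t, hP]
    simp; ring
  · rw [hP, natDegree_mul n1 n2, d1, d2, ← Nat.card_eq_fintype_card]
    omega

lemma comm_of_Nr (h2 : (2 : F) = 0) {m r : S F} (hm : tr m ≠ 0) (hr : tr r ≠ 0) (h : m ∈ Nr r) :
    m * r = r * m := by
  rcases h with h | h
  · exact h
  · exact absurd (L2 h2 hr h) hm

lemma borel_step0 [Finite F] (h2 : (2 : F) = 0) (hc : 4 < Nat.card F)
    (hF : ∀ K : Subfield F, (∃ k ∈ K, k ≠ 0 ∧ k ≠ 1) → K = ⊤)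
    (lam : F) (l0 : lam ≠ 0) (l1 : lam ≠ 1) {x y : S F} (h : solvabilizer x = solvabilizer y)
    (hx : x 1 0 = 0) : y 1 0 = 0 := by
  by_contra hy
  apply cubic_false hc (y 0 0) (y 0 1) (y 1 0) (y 1 1) hy
  intro a
  set mu := lam⁻¹ - lam with hmu
  have hmu0 : mu ≠ 0 := by
    intro e
    apply l1
    apply sq_one h2
    have e' : lam * mu = 0 := by rw [e]; ring
    rw [hmu, mul_sub, mul_inv_cancel₀ l0] at e'
    linear_combination -e'
  set m : S F := mk2 lam (a * mu) 0 lam⁻¹ (by field_simp; ring) with hm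
  have hmt : tr m ≠ 0 := by
    simp only [tr, hm, mk2_00, mk2_11]
    intro e; apply hmu0; rw [hmu]; linear_combination e - h2 * lam
  have hmx : m ∈ solvabilizer x := by
    apply mem_solvabilizer_of (Bor 1) (Bor_solv 1) <;> rw [mem_Bor] <;> simp [hx, hm]
  rw [h] at hmx
  rcases sol_cases h2 hF lam l0 l1 hmx with ⟨k, hk1, hk2⟩ | ⟨r, hr, hk1, hk2⟩
  · rw [mem_Bor] at hk1 hk2
    have dk := sdet k
    simp only [m00, m01, m10, m11, i10, i11, hm, mk2_00, mk2_01, mk2_10, mk2_11] at hk1 hk2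
    have e1 : k 1 0 * (mu * (k 0 0 - a * k 1 0)) = 0 := by
      rw [← hk2, hmu]; ring
    rcases mul_eq_zero.1 e1 with e2 | e2
    · exfalso
      rw [e2] at hk1 dk
      have e3 : k 0 0 ≠ 0 := by rintro e; rw [e] at dk; simp at dk
      have e4 : k 0 0 * k 0 0 * y 1 0 = 0 := by linear_combination hk1
      exact (mul_ne_zero (mul_ne_zero e3 e3) hy) e4
    · have e3 := (mul_eq_zero.1 e2).resolve_left hmu0
      have e4 : k 0 0 = a * k 1 0 := by linear_combination e3
      rw [e4] at hk1 dk
      have e5 : k 1 0 ≠ 0 := by rintro e; rw [e] at dk; simp at dk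
      have e6 : k 1 0 * k 1 0 * (y 1 0 * a ^ 2 + (y 1 1 - y 0 0) * a - y 0 1) = 0 := by
        linear_combination hk1
      rw [(mul_eq_zero.1 e6).resolve_left (mul_ne_zero e5 e5), zero_mul]
  · have hmr := comm_of_Nr h2 hmt hr hk2
    rw [mem_Nr] at hk1
    simp only [sext, m00, m01, m10, m11, i00, i01, i10, i11, hm, mk2_00, mk2_01, mk2_10, mk2_11, tr]
      at hmr hk1 hr
    have r10 : r 1 0 = 0 := by
      apply mul_left_cancel₀ hmu0; rw [hmu]; linear_combination hmr.2.2.1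
    have r01 : r 0 1 = a * (r 1 1 - r 0 0) := by
      apply mul_left_cancel₀ hmu0; rw [hmu]
      have := hmr.2.1
      rw [hmu] at this
      linear_combination -this
    have hr' : r 0 0 - r 1 1 ≠ 0 := by
      intro e; apply hr; linear_combination e + h2 * r 1 1
    rw [r10, r01] at hk1
    rcases hk1 with hk1 | hk1
    · exfalso
      have : y 1 0 * (r 0 0 - r 1 1) = 0 := by linear_combination hk1.2.2.1
      exact mul_ne_zero hy hr' this
    · have : (r 0 0 - r 1 1) * (y 0 0 - a * y 1 0) = 0 := by linear_combination hk1.1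
      rw [(mul_eq_zero.1 this).resolve_left hr', mul_zero]

lemma borel_step [Finite F] (h2 : (2 : F) = 0) (hc : 4 < Nat.card F)
    (hF : ∀ K : Subfield F, (∃ k ∈ K, k ≠ 0 ∧ k ≠ 1) → K = ⊤)
    (lam : F) (l0 : lam ≠ 0) (l1 : lam ≠ 1) {x y : S F} (h : solvabilizer x = solvabilizer y)
    (k : S F) (hx : x ∈ Bor k) : y ∈ Bor k := by
  rw [mem_Bor] at *
  have := solvabilizer_map_eq (MulAut.conj k⁻¹) h
  simp only [MulAut.conj_apply, inv_inv] at this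
  exact borel_step0 h2 hc hF lam l0 l1 this hx

lemma dih_step0 [Finite F] (h2 : (2 : F) = 0) (hc : 4 < Nat.card F)
    (hF : ∀ K : Subfield F, (∃ k ∈ K, k ≠ 0 ∧ k ≠ 1) → K = ⊤)
    (lam : F) (l0 : lam ≠ 0) (l1 : lam ≠ 1) {x y r : S F} (h : solvabilizer x = solvabilizer y)
    (hr : tr r ≠ 0) (hx : x ∈ Nr r) (hy1 : y 1 0 = 0) (hr1 : r 1 0 = 0) : y * r = r * y := by
  have hx1 : x 1 0 = 0 := borel_step0 h2 hc hF lam l0 l1 h.symm hy1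
  have hr' : r 1 1 - r 0 0 ≠ 0 := by
    intro e; apply hr; simp only [tr]; linear_combination e + h2 * r 0 0
  have dx := sdet x
  have hx0 : x 0 0 ≠ 0 := by rintro e; rw [e, hx1] at dx; simp at dx
  have hxr : x * r = r * x := by
    rcases hx with hx | hx
    · exact hx
    · exfalso
      simp only [sext, m00, m01, m10, m11, i00, i01, i10, i11, hx1, hr1] at hx
      have : x 0 0 * (r 1 1 - r 0 0) = 0 := by linear_combination -hx.1
      exact mul_ne_zero hx0 hr' this
  have hx3 : x ∈ Bor (mk2 (r 0 1) (-1 / (r 1 1 - r 0 0)) (r 1 1 - r 0 0) 0 (by field_simp; ring)) := by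
    rw [mem_Bor]
    simp only [sext, m00, m01, m10, m11, i10, i11, mk2_00, mk2_10, hx1, hr1] at hxr ⊢
    linear_combination -(r 1 1 - r 0 0) * hxr.2.1
  have hy3 := borel_step h2 hc hF lam l0 l1 h _ hx3
  rw [mem_Bor] at hy3
  simp only [sext, m00, m01, m10, m11, i10, i11, mk2_00, mk2_10, hy1, hr1] at hy3 ⊢
  refine ⟨by ring, ?_, by ring, by ring⟩
  apply mul_left_cancel₀ hr'
  linear_combination -hy3

lemma dih_step [Finite F] (h2 : (2 : F) = 0) (hc : 4 < Nat.card F)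
    (hF : ∀ K : Subfield F, (∃ k ∈ K, k ≠ 0 ∧ k ≠ 1) → K = ⊤)
    (lam : F) (l0 : lam ≠ 0) (l1 : lam ≠ 1) {x y r : S F} (h : solvabilizer x = solvabilizer y)
    (hr : tr r ≠ 0) (hx : x ∈ Nr r) : y ∈ Nr r := by
  have hrx : r ∈ solvabilizer x :=
    mem_solvabilizer_of (Nr r) (Nr_solv h2 hr) hx (Or.inl rfl)
  rw [h] at hrx
  rcases sol_cases h2 hF lam l0 l1 hrx with ⟨k, hk1, hk2⟩ | ⟨s, hs, hk1, hk2⟩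
  · left
    rw [mem_Bor] at hk1 hk2
    have hh := solvabilizer_map_eq (MulAut.conj k⁻¹) h
    simp only [MulAut.conj_apply, inv_inv] at hh
    have ht : tr (k⁻¹ * r * k) ≠ 0 := by
      have := tr_conj k⁻¹ r
      rw [inv_inv] at this; rwa [this]
    have hx' : k⁻¹ * x * k ∈ Nr (k⁻¹ * r * k) := by
      rcases hx with hx | hx
      · left
        calc k⁻¹ * x * k * (k⁻¹ * r * k) = k⁻¹ * (x * r) * k := by group
          _ = k⁻¹ * (r * x) * k := by rw [hx]
          _ = _ := by group
      · right
        calc k⁻¹ * x * k * (k⁻¹ * r * k) = k⁻¹ * (x * r) * k := by group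
          _ = k⁻¹ * (r⁻¹ * x) * k := by rw [hx]
          _ = _ := by group
    have := dih_step0 h2 hc hF lam l0 l1 hh ht hx' hk1 hk2
    calc y * r = k * (k⁻¹ * y * k * (k⁻¹ * r * k)) * k⁻¹ := by group
      _ = k * (k⁻¹ * r * k * (k⁻¹ * y * k)) * k⁻¹ := by rw [this]
      _ = r * y := by group
  · have hrs := comm_of_Nr h2 hr hs hk2
    rw [Nr_iff] at hk1 ⊢
    have c1 : Commute (y * r * y⁻¹) (y * s * y⁻¹) := by
      change y * r * y⁻¹ * (y * s * y⁻¹) = y * s * y⁻¹ * (y * r * y⁻¹)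
      calc _ = y * (r * s) * y⁻¹ := by group
        _ = y * (s * r) * y⁻¹ := by rw [hrs]
        _ = _ := by group
    have c2 : Commute (y * r * y⁻¹) s := by
      rcases hk1 with e | e
      · rwa [e] at c1
      · rw [e] at c1; simpa using c1.inv_right
    have c3 : r * (y * r * y⁻¹) = (y * r * y⁻¹) * r := CT h2 hs hrs c2.symm
    exact L1 h2 hr (tr_conj y r).symm c3

theorem main_SL [Finite F] (h2 : (2 : F) = 0) (hc : 4 < Nat.card F)
    (hF : ∀ K : Subfield F, (∃ k ∈ K, k ≠ 0 ∧ k ≠ 1) → K = ⊤)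
    {x y : S F} (h : solvabilizer x = solvabilizer y) (M : Subgroup (S F)) (hM : IsCoatom M)
    (hx : x ∈ M) : y ∈ M := by
  obtain ⟨lam, l0, l1⟩ : ∃ lam : F, lam ≠ 0 ∧ lam ≠ 1 := by
    classical
    have := Fintype.ofFinite F
    have : ((Finset.univ : Finset F) \ {0, 1}).Nonempty := by
      rw [← Finset.card_pos]
      have h1 := Finset.le_card_sdiff ({0, 1} : Finset F) Finset.univ
      have h3 : ({0, 1} : Finset F).card ≤ 2 := Finset.card_le_two
      rw [Finset.card_univ, ← Nat.card_eq_fintype_card] at h1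
      omega
    obtain ⟨l, hl⟩ := this
    simp at hl
    exact ⟨l, hl.1, hl.2⟩
  have nt : ∀ N : Subgroup (S F), Group.IsSolvable N → N ≠ ⊤ := by
    rintro N hs rfl
    apply not_solv h2 lam l0 l1
    exact Group.isSolvable_of_isSolvable_injective (f := (Subgroup.topEquiv (G := S F)).symm.toMonoidHom)
      (Subgroup.topEquiv (G := S F)).symm.injective
  rcases classification h2 hF M hM.1 with ⟨k, hk⟩ | ⟨r, hr, hk⟩
  · have e : M = Bor k := (hM.le_iff_eq (nt _ (Bor_solv k))).1 hk |>.symm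
    rw [e] at hx ⊢
    exact borel_step h2 hc hF lam l0 l1 h k hx
  · have e : M = Nr r := (hM.le_iff_eq (nt _ (Nr_solv h2 hr))).1 hk |>.symm
    rw [e] at hx ⊢
    exact dih_step h2 hc hF lam l0 l1 h hr hx

lemma center_bot (h2 : (2 : F) = 0) : Subgroup.center (S F) = ⊥ := by
  rw [eq_bot_iff]
  intro z hz
  rw [Subgroup.mem_center_iff] at hz
  rw [Subgroup.mem_bot]
  have e1 := hz (up 1)
  have e2 := hz (lo 1)
  have d := sdet z
  simp only [sext, m00, m01, m10, m11, up, lo, mk2_00, mk2_01, mk2_10, mk2_11, o00, o01, o10, o11] at *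
  have z10 : z 1 0 = 0 := by linear_combination e1.1
  have z01 : z 0 1 = 0 := by linear_combination -e2.1
  have z0 : z 0 0 = z 1 1 := by linear_combination -e1.2.1
  have z1 : z 1 1 = 1 := sq_one h2 (by grind)
  exact ⟨by rw [z0, z1], z01, z10, z1⟩

lemma subfields (p : ℕ) (hp : p.Prime) (K : Subfield (GaloisField 2 p))
    (hK : ∃ k ∈ K, k ≠ 0 ∧ k ≠ 1) : K = ⊤ := by
  have hpr : Nat.Prime (Module.finrank (ZMod 2) (GaloisField 2 p)) := by
    rw [GaloisField.finrank 2 hp.ne_zero]; exact hp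
  have := IntermediateField.isSimpleOrder_of_finrank_prime (ZMod 2) (GaloisField 2 p) hpr
  let L : IntermediateField (ZMod 2) (GaloisField 2 p) :=
    K.toIntermediateField (by
      intro z
      have : z = ((z.val : ℕ) : ZMod 2) := by simp
      rw [this, map_natCast]
      exact natCast_mem K _)
  have hL : ∀ x, x ∈ L ↔ x ∈ K := fun x => Iff.rfl
  rcases eq_bot_or_eq_top L with h | h
  · exfalso
    obtain ⟨k, hk, k0, k1⟩ := hK
    rw [← hL, h, IntermediateField.mem_bot] at hk
    obtain ⟨z, rfl⟩ := hk
    have : z = 0 ∨ z = 1 := by clear k0 k1; revert z; decide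
    rcases this with rfl | rfl
    · exact k0 (map_zero _)
    · exact k1 (map_one _)
  · rw [eq_top_iff]
    intro x _
    rw [← hL, h]; trivial

lemma transfer {G H : Type*} [Group G] [Group H] (e : G ≃* H)
    (hG : ∀ x y : G, solvabilizer x = solvabilizer y → ∀ M : Subgroup G, IsCoatom M → x ∈ M → y ∈ M)
    (x y : H) (h : solvabilizer x = solvabilizer y) (M : Subgroup H) (hM : IsCoatom M) (hx : x ∈ M) :
    y ∈ M := by
  have h1 := hG (e.symm x) (e.symm y) (solvabilizer_map_eq e.symm h) (M.comap e.toMonoidHom) ?_ ?_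
  · simpa using h1
  · have := (e.symm.mapSubgroup.isCoatom_iff M).2 hM
    convert this using 1
    ext g
    simp only [Subgroup.mem_comap, MulEquiv.mapSubgroup_apply, Subgroup.mem_map]
    constructor
    · intro hg
      exact ⟨e g, hg, e.symm_apply_apply g⟩
    · rintro ⟨w, hw, rfl⟩
      change e (e.symm w) ∈ M
      rwa [e.apply_symm_apply]
  · simpa using hx

end PSLaux

theorem mem_same_maximal_subgroups_PSL_char_two
    (p : ℕ) (hp : p.Prime) (hodd : Odd p)
    (x y : PSL 2 (GaloisField 2 p))
    (h : solvabilizer x = solvabilizer y) :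
    ∀ M : Subgroup (PSL 2 (GaloisField 2 p)), IsCoatom M → (x ∈ M ↔ y ∈ M) := by
  have h2 : (2 : GaloisField 2 p) = 0 := CharTwo.two_eq_zero
  have hfin : Finite (GaloisField 2 p) := inferInstance
  have hc : 4 < Nat.card (GaloisField 2 p) := by
    rw [GaloisField.card 2 p hp.ne_zero]
    have h3 : 3 ≤ p := by
      have := hp.two_le
      rcases hodd with ⟨k, hk⟩
      omega
    calc 4 < 2 ^ 3 := by norm_num
      _ ≤ 2 ^ p := Nat.pow_le_pow_right (by norm_num) h3
  let e : PSLaux.S (GaloisField 2 p) ≃* PSL 2 (GaloisField 2 p) :=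
    (QuotientGroup.quotientBot.symm).trans
      (QuotientGroup.quotientMulEquivOfEq (PSLaux.center_bot h2).symm)
  have key := PSLaux.transfer e (fun x y h M hM hx =>
    PSLaux.main_SL h2 hc (PSLaux.subfields p hp) h M hM hx)
  intro M hM
  exact ⟨key x y h M hM, key y x h.symm M hM⟩
end
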